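/- Let d be an integer with −3 ≤ d ≤ 3 and let n, m be natural numbers with n ≥ 2 and m ≥ 3. Then C(n,2) = C(m,3) + d holds if and only if (d, n, m) is one of the following triples: for d = 3: (368, 75), (383, 77), (158118758, 421726); for d = 2: (3, 3), (4, 4), (604, 104); for d = 1: (7, 6), (9, 7), (34, 16), (77, 27), (86, 29), (2407, 260), (9879, 665), (1587767, 19630); for d = 0: (2, 3), (5, 5), (16, 10), (56, 22), (120, 36); for d = −1: (3, 4), (11, 8), (60, 23), (160403633, 425779); for d = −2: no solutions; for d = −3: (2, 4). -/

import Mathlib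

/-- Coefficients of the relations `α² = m s + n` and `s² = P s + Q α + k`. -/
structure QuarticParams where
  m : ℤ
  n : ℤ
  P : ℤ
  Q : ℤ
  k : ℤ

/-- The order `ℤ[α, s]` with `α² = m s + n`, `s² = P s + Q α + k`, as a free `ℤ`-module on
`1, α, s, α s`. -/
@[ext]
structure QuarticOrder (π : QuarticParams) where
  c0 : ℤ
  c1 : ℤ
  c2 : ℤ
  c3 : ℤ

namespace QuarticOrder

variable {π : QuarticParams}

instance : Zero (QuarticOrder π) := ⟨⟨0, 0, 0, 0⟩⟩
instance : One (QuarticOrder π) := ⟨⟨1, 0, 0, 0⟩⟩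
instance : Add (QuarticOrder π) :=
  ⟨fun x y => ⟨x.c0 + y.c0, x.c1 + y.c1, x.c2 + y.c2, x.c3 + y.c3⟩⟩
instance : Neg (QuarticOrder π) := ⟨fun x => ⟨-x.c0, -x.c1, -x.c2, -x.c3⟩⟩
instance : Mul (QuarticOrder π) := ⟨fun x y =>
  ⟨x.c0 * y.c0 + x.c1 * y.c1 * π.n + π.k * (x.c2 * y.c2 + x.c3 * y.c3 * π.n)
      + π.Q * (x.c2 * y.c3 + x.c3 * y.c2) * π.n
      + π.k * ((x.c1 * y.c3 + x.c3 * y.c1) * π.m + π.P * (x.c3 * y.c3 * π.m)),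
    x.c0 * y.c1 + x.c1 * y.c0 + π.k * (x.c2 * y.c3 + x.c3 * y.c2)
      + π.Q * (x.c2 * y.c2 + x.c3 * y.c3 * π.n)
      + π.Q * ((x.c1 * y.c3 + x.c3 * y.c1) * π.m + π.P * (x.c3 * y.c3 * π.m)),
    x.c0 * y.c2 + x.c2 * y.c0 + x.c1 * y.c1 * π.m + (x.c1 * y.c3 + x.c3 * y.c1) * π.n
      + π.P * (x.c2 * y.c2 + x.c3 * y.c3 * π.n) + π.k * (x.c3 * y.c3 * π.m)
      + π.Q * (x.c2 * y.c3 + x.c3 * y.c2) * π.m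
      + π.P * ((x.c1 * y.c3 + x.c3 * y.c1) * π.m + π.P * (x.c3 * y.c3 * π.m)),
    x.c0 * y.c3 + x.c1 * y.c2 + x.c2 * y.c1 + x.c3 * y.c0
      + π.P * (x.c2 * y.c3 + x.c3 * y.c2) + π.Q * (x.c3 * y.c3 * π.m)⟩⟩

@[simp] lemma zero_c0 : (0 : QuarticOrder π).c0 = 0 := rfl
@[simp] lemma zero_c1 : (0 : QuarticOrder π).c1 = 0 := rfl
@[simp] lemma zero_c2 : (0 : QuarticOrder π).c2 = 0 := rfl
@[simp] lemma zero_c3 : (0 : QuarticOrder π).c3 = 0 := rfl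
@[simp] lemma one_c0 : (1 : QuarticOrder π).c0 = 1 := rfl
@[simp] lemma one_c1 : (1 : QuarticOrder π).c1 = 0 := rfl
@[simp] lemma one_c2 : (1 : QuarticOrder π).c2 = 0 := rfl
@[simp] lemma one_c3 : (1 : QuarticOrder π).c3 = 0 := rfl
@[simp] lemma add_c0 (x y : QuarticOrder π) : (x + y).c0 = x.c0 + y.c0 := rfl
@[simp] lemma add_c1 (x y : QuarticOrder π) : (x + y).c1 = x.c1 + y.c1 := rfl
@[simp] lemma add_c2 (x y : QuarticOrder π) : (x + y).c2 = x.c2 + y.c2 := rfl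
@[simp] lemma add_c3 (x y : QuarticOrder π) : (x + y).c3 = x.c3 + y.c3 := rfl
@[simp] lemma neg_c0 (x : QuarticOrder π) : (-x).c0 = -x.c0 := rfl
@[simp] lemma neg_c1 (x : QuarticOrder π) : (-x).c1 = -x.c1 := rfl
@[simp] lemma neg_c2 (x : QuarticOrder π) : (-x).c2 = -x.c2 := rfl
@[simp] lemma neg_c3 (x : QuarticOrder π) : (-x).c3 = -x.c3 := rfl
lemma mul_c0 (x y : QuarticOrder π) : (x * y).c0 =
    x.c0 * y.c0 + x.c1 * y.c1 * π.n + π.k * (x.c2 * y.c2 + x.c3 * y.c3 * π.n)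
      + π.Q * (x.c2 * y.c3 + x.c3 * y.c2) * π.n
      + π.k * ((x.c1 * y.c3 + x.c3 * y.c1) * π.m + π.P * (x.c3 * y.c3 * π.m)) := rfl
lemma mul_c1 (x y : QuarticOrder π) : (x * y).c1 =
    x.c0 * y.c1 + x.c1 * y.c0 + π.k * (x.c2 * y.c3 + x.c3 * y.c2)
      + π.Q * (x.c2 * y.c2 + x.c3 * y.c3 * π.n)
      + π.Q * ((x.c1 * y.c3 + x.c3 * y.c1) * π.m + π.P * (x.c3 * y.c3 * π.m)) := rfl
lemma mul_c2 (x y : QuarticOrder π) : (x * y).c2 =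
    x.c0 * y.c2 + x.c2 * y.c0 + x.c1 * y.c1 * π.m + (x.c1 * y.c3 + x.c3 * y.c1) * π.n
      + π.P * (x.c2 * y.c2 + x.c3 * y.c3 * π.n) + π.k * (x.c3 * y.c3 * π.m)
      + π.Q * (x.c2 * y.c3 + x.c3 * y.c2) * π.m
      + π.P * ((x.c1 * y.c3 + x.c3 * y.c1) * π.m + π.P * (x.c3 * y.c3 * π.m)) := rfl
lemma mul_c3 (x y : QuarticOrder π) : (x * y).c3 =
    x.c0 * y.c3 + x.c1 * y.c2 + x.c2 * y.c1 + x.c3 * y.c0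
      + π.P * (x.c2 * y.c3 + x.c3 * y.c2) + π.Q * (x.c3 * y.c3 * π.m) := rfl

instance : CommRing (QuarticOrder π) where
  add_assoc x y z := by ext <;> simp [add_assoc]
  zero_add x := by ext <;> simp
  add_zero x := by ext <;> simp
  add_comm x y := by ext <;> simp [add_comm]
  neg_add_cancel x := by ext <;> simp
  nsmul := nsmulRec
  zsmul := zsmulRec
  mul_assoc x y z := by ext <;> simp only [mul_c0, mul_c1, mul_c2, mul_c3] <;> ring
  mul_comm x y := by ext <;> simp only [mul_c0, mul_c1, mul_c2, mul_c3] <;> ring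
  left_distrib x y z := by
    ext <;> simp only [mul_c0, mul_c1, mul_c2, mul_c3, add_c0, add_c1, add_c2, add_c3] <;> ring
  right_distrib x y z := by
    ext <;> simp only [mul_c0, mul_c1, mul_c2, mul_c3, add_c0, add_c1, add_c2, add_c3] <;> ring
  one_mul x := by ext <;> simp [mul_c0, mul_c1, mul_c2, mul_c3]
  mul_one x := by ext <;> simp [mul_c0, mul_c1, mul_c2, mul_c3]
  zero_mul x := by ext <;> simp [mul_c0, mul_c1, mul_c2, mul_c3]
  mul_zero x := by ext <;> simp [mul_c0, mul_c1, mul_c2, mul_c3]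
  natCast n := ⟨n, 0, 0, 0⟩
  natCast_zero := rfl
  natCast_succ n := by ext <;> simp
  intCast n := ⟨n, 0, 0, 0⟩
  intCast_ofNat n := rfl
  intCast_negSucc n := by ext <;> rfl

@[simp] lemma sub_c0 (x y : QuarticOrder π) : (x - y).c0 = x.c0 - y.c0 := rfl
@[simp] lemma sub_c1 (x y : QuarticOrder π) : (x - y).c1 = x.c1 - y.c1 := rfl
@[simp] lemma sub_c2 (x y : QuarticOrder π) : (x - y).c2 = x.c2 - y.c2 := rfl
@[simp] lemma sub_c3 (x y : QuarticOrder π) : (x - y).c3 = x.c3 - y.c3 := rfl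
@[simp] lemma intCast_c0 (z : ℤ) : (z : QuarticOrder π).c0 = z := rfl
@[simp] lemma intCast_c1 (z : ℤ) : (z : QuarticOrder π).c1 = 0 := rfl
@[simp] lemma intCast_c2 (z : ℤ) : (z : QuarticOrder π).c2 = 0 := rfl
@[simp] lemma intCast_c3 (z : ℤ) : (z : QuarticOrder π).c3 = 0 := rfl

@[simp] lemma intCast_mul_c0 (z : ℤ) (x : QuarticOrder π) : ((z :
    QuarticOrder π) * x).c0 = z * x.c0 := by
  simp [mul_c0]
@[simp] lemma intCast_mul_c1 (z : ℤ) (x : QuarticOrder π) : ((z :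
    QuarticOrder π) * x).c1 = z * x.c1 := by
  simp [mul_c1]
@[simp] lemma intCast_mul_c2 (z : ℤ) (x : QuarticOrder π) : ((z :
    QuarticOrder π) * x).c2 = z * x.c2 := by
  simp [mul_c2]
@[simp] lemma intCast_mul_c3 (z : ℤ) (x : QuarticOrder π) : ((z :
    QuarticOrder π) * x).c3 = z * x.c3 := by
  simp [mul_c3]

lemma intCast_dvd {z : ℤ} {x : QuarticOrder π} :
    (z : QuarticOrder π) ∣ x ↔ z ∣ x.c0 ∧ z ∣ x.c1 ∧ z ∣ x.c2 ∧ z ∣ x.c3 := by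
  constructor
  · rintro ⟨y, rfl⟩
    simp
  · rintro ⟨⟨a, ha⟩, ⟨b, hb⟩, ⟨c, hc⟩, ⟨d, hd⟩⟩
    exact ⟨⟨a, b, c, d⟩, by ext <;> simp [ha, hb, hc, hd]⟩

/-- The generator `α`. -/
def gen : QuarticOrder π := ⟨0, 1, 0, 0⟩

/-- The generator `s`. -/
def sgen : QuarticOrder π := ⟨0, 0, 1, 0⟩

lemma eq_combination (x : QuarticOrder π) :
    x = (x.c0 : QuarticOrder π) + (x.c1 : QuarticOrder π) * gen + (x.c2 : QuarticOrder π) * sgen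
      + (x.c3 : QuarticOrder π) * (gen * sgen) := by
  ext <;> simp [gen, sgen, mul_c0, mul_c1, mul_c2, mul_c3]

lemma gen_sq : (gen : QuarticOrder π) ^ 2 = (π.m : QuarticOrder π) * sgen + (π.n :
    QuarticOrder π) := by
  ext <;> simp [gen, sgen, pow_two, mul_c0, mul_c1, mul_c2, mul_c3]

lemma sgen_sq : (sgen : QuarticOrder π) ^ 2 = (π.P : QuarticOrder π) * sgen
    + (π.Q : QuarticOrder π) * gen + (π.k : QuarticOrder π) := by
  ext <;> simp [gen, sgen, pow_two, mul_c0, mul_c1, mul_c2, mul_c3]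

/-- The ring homomorphism determined by a solution of the defining relations. -/
def lift {B : Type*} [CommRing B] (α s : B) (h₁ : α ^ 2 = π.m * s + π.n)
    (h₂ : s ^ 2 = π.P * s + π.Q * α + π.k) : QuarticOrder π →+* B where
  toFun x := x.c0 + x.c1 * α + x.c2 * s + x.c3 * (α * s)
  map_one' := by simp
  map_zero' := by simp
  map_add' x y := by simp; ring
  map_mul' x y := by
    simp only [mul_c0, mul_c1, mul_c2, mul_c3]
    push_cast
    linear_combination (-(x.c1 * y.c1 : B) - (x.c1 * y.c3 + x.c3 * y.c1) * s
      - x.c3 * y.c3 * (π.P * s + π.Q * α + π.k) - π.Q * (x.c2 * y.c3 + x.c3 * y.c2)) * h₁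
      + (-(x.c2 * y.c2 : B) - (x.c2 * y.c3 + x.c3 * y.c2) * α - x.c3 * y.c3 * α ^ 2
        - π.m * (x.c1 * y.c3 + x.c3 * y.c1 + π.P * x.c3 * y.c3)) * h₂

lemma lift_apply {B : Type*} [CommRing B] (α s : B) (h₁ : α ^ 2 = π.m * s + π.n)
    (h₂ : s ^ 2 = π.P * s + π.Q * α + π.k) (x : QuarticOrder π) :
    lift α s h₁ h₂ x = x.c0 + x.c1 * α + x.c2 * s + x.c3 * (α * s) := rfl

lemma hom_ext {B : Type*} [CommRing B] {φ ψ : QuarticOrder π →+* B} (h₁ : φ gen = ψ gen)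
    (h₂ : φ sgen = ψ sgen) : φ = ψ := by
  ext x
  rw [eq_combination x]
  simp [h₁, h₂]

end QuarticOrder

section

namespace QuarticOrder

open Polynomial NumberField

variable {π : QuarticParams}

/-- The monic quartic with root `α`. -/
noncomputable def quartic (π : QuarticParams) : ℤ[X] :=
  X ^ 4 - C (2 * π.n + π.P * π.m) * X ^ 2 - C (π.Q * π.m ^ 2) * X
    + C (π.n ^ 2 + π.P * π.m * π.n - π.k * π.m ^ 2)

lemma natDegree_quartic : (quartic π).natDegree = 4 := by
  unfold quartic; compute_degree!

lemma monic_quartic : (quartic π).Monic := by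
  unfold quartic; monicity!

lemma eval₂_quartic {B : Type*} [CommRing B] (i : ℤ →+* B) (t : B) :
    (quartic π).eval₂ i t = t ^ 4 - (2 * π.n + π.P * π.m) * t ^ 2 - π.Q * π.m ^ 2 * t
      + (π.n ^ 2 + π.P * π.m * π.n - π.k * π.m ^ 2) := by
  simp only [quartic, eval₂_add, eval₂_sub, eval₂_mul, eval₂_C, eval₂_X, eval₂_X_pow]
  simp

lemma sgen_relation {B : Type*} [Field B] [CharZero B] (hm : π.m ≠ 0) {t : B}
    (ht : (quartic π).eval₂ (Int.castRingHom B) t = 0) :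
    ((t ^ 2 - π.n) / π.m) ^ 2 = π.P * ((t ^ 2 - π.n) / π.m) + π.Q * t + (π.k : B) := by
  have hm' : (π.m : B) ≠ 0 := by exact_mod_cast hm
  rw [eval₂_quartic] at ht
  field_simp
  linear_combination ht

/-- The homomorphism to a field sending `α` to a root of the quartic. -/
noncomputable def toField {B : Type*} [Field B] [CharZero B] (hm : π.m ≠ 0) {t : B}
    (ht : (quartic π).eval₂ (Int.castRingHom B) t = 0) : QuarticOrder π →+* B :=
  lift t ((t ^ 2 - π.n) / π.m)
    (by
      have hm' : (π.m : B) ≠ 0 := by exact_mod_cast hm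
      field_simp
      ring)
    (sgen_relation hm ht)

lemma toField_injective {B : Type*} [Field B] [CharZero B] (hm : π.m ≠ 0) {t : B}
    (ht : (quartic π).eval₂ (Int.castRingHom B) t = 0)
    (hirr : Irreducible ((quartic π).map (Int.castRingHom ℚ))) :
    Function.Injective (toField hm ht) := by
  rw [injective_iff_map_eq_zero]
  intro x hx
  have hm' : (π.m : B) ≠ 0 := by exact_mod_cast hm
  have hmq : (π.m : ℚ) ≠ 0 := by exact_mod_cast hm
  let p : Cubic ℚ := ⟨x.c3, x.c2, π.m * x.c1 - x.c3 * π.n, π.m * x.c0 - x.c2 * π.n⟩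
  have hp : aeval t p.toPoly = 0 := by
    have : aeval t p.toPoly = π.m * toField hm ht x := by
      simp only [toField, lift_apply, p, Cubic.toPoly, map_add, map_mul, aeval_X,
        map_pow, map_sub, map_intCast]
      field_simp
      ring
    rw [this, hx, mul_zero]
  have hmin : (quartic π).map (Int.castRingHom ℚ) = minpoly ℚ t := by
    refine minpoly.eq_of_irreducible_of_monic hirr ?_ (monic_quartic.map _)
    rw [aeval_def, eval₂_map,
      RingHom.ext_int ((algebraMap ℚ B).comp (Int.castRingHom ℚ)) (Int.castRingHom B)]
    exact ht
  have hp0 : p.toPoly = 0 := by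
    refine eq_zero_of_dvd_of_natDegree_lt (hmin ▸ minpoly.dvd ℚ t hp) ?_
    rw [natDegree_map_eq_of_injective (RingHom.injective_int _), natDegree_quartic, Nat.lt_succ_iff]
    unfold Cubic.toPoly
    compute_degree
  have e3 : p.a = 0 := by rw [← Cubic.coeff_eq_a, hp0, coeff_zero]
  have e2 : p.b = 0 := by rw [← Cubic.coeff_eq_b, hp0, coeff_zero]
  have e1 : p.c = 0 := by rw [← Cubic.coeff_eq_c, hp0, coeff_zero]
  have e0 : p.d = 0 := by rw [← Cubic.coeff_eq_d, hp0, coeff_zero]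
  have z3 : x.c3 = 0 := Int.cast_injective (α := ℚ) (e3.trans Int.cast_zero.symm)
  have z2 : x.c2 = 0 := Int.cast_injective (α := ℚ) (e2.trans Int.cast_zero.symm)
  have z1 : x.c1 = 0 := by simpa [p, z3, hmq] using e1
  have z0 : x.c0 = 0 := by simpa [p, z2, hmq] using e0
  ext <;> simp [z0, z1, z2, z3]

instance : Module.Finite ℤ (QuarticOrder π) := by
  refine Module.Finite.of_surjective
    ({ toFun := fun v => ⟨v 0, v 1, v 2, v 3⟩
       map_add' := fun v w => rfl
       map_smul' := fun z v => by
        ext <;> simp [zsmul_eq_mul] } : (Fin 4 → ℤ) →ₗ[ℤ] QuarticOrder π) ?_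
  intro x
  exact ⟨![x.c0, x.c1, x.c2, x.c3], rfl⟩

/-- Torsion units are `±1` as soon as the quartic has a real root. -/
lemma unit_eq_one_or_neg_one (hm : π.m ≠ 0)
    (hirr : Irreducible ((quartic π).map (Int.castRingHom ℚ))) {t : ℝ}
    (ht : (quartic π).eval₂ (Int.castRingHom ℝ) t = 0) {κ : (QuarticOrder π)ˣ} {N : ℤ}
    (hN : N ≠ 0) (h : κ ^ N = 1) : κ = 1 ∨ κ = -1 := by
  have hn : κ ^ N.natAbs = 1 := by
    rcases Int.natAbs_eq N with h' | h' <;> rw [h'] at h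
    · exact_mod_cast h
    · simpa using h
  have h1 : (toField hm ht κ) ^ N.natAbs = 1 := by
    rw [← map_pow, ← Units.val_pow_eq_pow_val, hn]; simp
  have h2 := (pow_eq_one_iff_cases.1 h1)
  rcases h2 with h2 | h2 | ⟨h2, -⟩
  · simp at h2; contradiction
  · left
    ext1
    apply toField_injective hm ht hirr
    simpa using h2
  · right
    ext1
    apply toField_injective hm ht hirr
    simpa using h2

open Classical in
/-- Any three units are multiplicatively dependent when the quartic has a nonreal root. -/
lemma exists_unit_relation (hm : π.m ≠ 0)
    (hirr : Irreducible ((quartic π).map (Int.castRingHom ℚ))) {z : ℂ} (hz : z.im ≠ 0)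
    (hz0 : (quartic π).eval₂ (Int.castRingHom ℂ) z = 0) (κ : Fin 3 → (QuarticOrder π)ˣ) :
    ∃ g : Fin 3 → ℤ, g ≠ 0 ∧ ∏ i, κ i ^ g i = 1 := by
  have : Fact (Irreducible ((quartic π).map (Int.castRingHom ℚ))) := ⟨hirr⟩
  let K := AdjoinRoot ((quartic π).map (Int.castRingHom ℚ))
  have hne := hirr.ne_zero
  have : FiniteDimensional ℚ K := (AdjoinRoot.powerBasis hne).finite
  have : NumberField K := { }
  have hdeg : Module.finrank ℚ K = 4 := by
    rw [(AdjoinRoot.powerBasis hne).finrank, AdjoinRoot.powerBasis_dim,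
      natDegree_map_eq_of_injective (RingHom.injective_int _), natDegree_quartic]
  let φ : K →+* ℂ := AdjoinRoot.lift (algebraMap ℚ ℂ) z (by
    rw [eval₂_map,
      RingHom.ext_int ((algebraMap ℚ ℂ).comp (Int.castRingHom ℚ)) (Int.castRingHom ℂ)]
    exact hz0)
  have hφ : ¬ ComplexEmbedding.IsReal φ := by
    intro h
    have h1 := RingHom.congr_fun h (AdjoinRoot.root _)
    rw [ComplexEmbedding.conjugate_coe_eq, AdjoinRoot.lift_root] at h1
    exact hz (Complex.conj_eq_iff_im.1 h1)
  have hc : 1 ≤ InfinitePlace.nrComplexPlaces K :=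
    Fintype.card_pos_iff.2 ⟨⟨InfinitePlace.mk φ, InfinitePlace.isComplex_mk_iff.2 hφ⟩⟩
  have hrank : Units.rank K ≤ 2 := by
    have h1 := InfinitePlace.card_add_two_mul_card_eq_rank K
    have h2 := InfinitePlace.card_eq_nrRealPlaces_add_nrComplexPlaces K
    rw [Units.rank]
    omega
  have ht : (quartic π).eval₂ (Int.castRingHom K)
      (AdjoinRoot.root ((quartic π).map (Int.castRingHom ℚ))) = 0 := by
    have := AdjoinRoot.eval₂_root ((quartic π).map (Int.castRingHom ℚ))
    rw [eval₂_map, RingHom.ext_int ((AdjoinRoot.of _).comp (Int.castRingHom ℚ))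
      (Int.castRingHom K)] at this
    exact this
  let ψ : QuarticOrder π →* 𝓞 K := RingOfIntegers.restrict_monoidHom
    (toField hm ht : QuarticOrder π →* K)
    (fun x => (Algebra.IsIntegral.isIntegral (R := ℤ) x).map (toField hm ht).toIntAlgHom)
  have hψ : Function.Injective ψ := by
    intro x y hxy
    apply toField_injective hm ht hirr
    exact congrArg (fun a : 𝓞 K => (a : K)) hxy
  have hdep : ¬ LinearIndependent ℤ (fun i => Additive.ofMul (Units.map ψ (κ i))) := by
    intro h
    have h1 := h.fintype_card_le_finrank
    rw [Units.finrank_eq, Fintype.card_fin] at h1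
    omega
  rw [Fintype.not_linearIndependent_iff] at hdep
  obtain ⟨g, hg, i, hi⟩ := hdep
  refine ⟨g, fun h => hi (congrFun h i), ?_⟩
  apply Units.map_injective hψ
  rw [map_prod, map_one]
  simp only [map_zpow]
  exact hg

end QuarticOrder

end

section UnitRelations

variable {R : Type*} [CommRing R]

/-- If `ε₁, ε₂` are independent modulo `ℓ`-th powers for all `ℓ ∈ L` and any three units are
dependent, then every unit has a power with exponent prime to `L` in `⟨-1, ε₁, ε₂⟩`. -/
lemma exists_relation_coprime {ε₁ ε₂ : Rˣ} {L : List ℕ}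
    (hT : ∀ (κ : Rˣ) (N : ℤ), N ≠ 0 → κ ^ N = 1 → κ = 1 ∨ κ = -1)
    (hD : ∀ κ : Fin 3 → Rˣ, ∃ g : Fin 3 → ℤ, g ≠ 0 ∧ ∏ i, κ i ^ g i = 1)
    (hL : ∀ ℓ ∈ L, 2 ≤ ℓ)
    (hS : ∀ ℓ ∈ L, ∀ (κ : Rˣ) (i j : ℤ), (κ ^ (ℓ : ℤ)) ^ 2 = (ε₁ ^ i * ε₂ ^ j) ^ 2 →
      (ℓ : ℤ) ∣ i ∧ (ℓ : ℤ) ∣ j) (ω : Rˣ) :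
    ∃ F a b : ℤ, (∀ ℓ ∈ L, ¬ (ℓ : ℤ) ∣ F) ∧ (ω ^ F) ^ 2 = (ε₁ ^ a * ε₂ ^ b) ^ 2 := by
  have key : ∀ n : ℕ, ∀ F a b : ℤ, F.natAbs + a.natAbs + b.natAbs = n → n ≠ 0 →
      (ω ^ F) ^ 2 = (ε₁ ^ a * ε₂ ^ b) ^ 2 →
      ∃ F a b : ℤ, (∀ ℓ ∈ L, ¬ (ℓ : ℤ) ∣ F) ∧ (ω ^ F) ^ 2 = (ε₁ ^ a * ε₂ ^ b) ^ 2 := by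
    intro n
    induction n using Nat.strong_induction_on with
    | _ n ih =>
      intro F a b hn h0 hrel
      by_cases hF : ∀ ℓ ∈ L, ¬ (ℓ : ℤ) ∣ F
      · exact ⟨F, a, b, hF, hrel⟩
      push Not at hF
      obtain ⟨ℓ, hℓ, F', rfl⟩ := hF
      have hℓ2 := hL ℓ hℓ
      obtain ⟨⟨a', rfl⟩, ⟨b', rfl⟩⟩ := hS ℓ hℓ (ω ^ F') a b (by rw [← zpow_mul, mul_comm F', hrel])
      rw [Int.natAbs_mul, Int.natAbs_mul, Int.natAbs_mul, Int.natAbs_natCast, ← Nat.mul_add,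
        ← Nat.mul_add] at hn
      refine ih (F'.natAbs + a'.natAbs + b'.natAbs) ?_ F' a' b' rfl ?_ ?_
      · rcases Nat.eq_zero_or_pos (F'.natAbs + a'.natAbs + b'.natAbs) with h | h
        · rw [h] at hn; omega
        · nlinarith
      · rintro h
        rw [h] at hn; omega
      · have h1 : (ω ^ F' * (ε₁ ^ a' * ε₂ ^ b')⁻¹) ^ ((ℓ : ℤ) * 2) = 1 := by
          have h0 : ω ^ (ℓ * F') = (ω ^ F') ^ (ℓ : ℤ) := by rw [mul_comm, zpow_mul]
          have h0' : ε₁ ^ (ℓ * a') * ε₂ ^ (ℓ * b') = (ε₁ ^ a' * ε₂ ^ b') ^ (ℓ : ℤ) := by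
            rw [mul_zpow, mul_comm (ℓ : ℤ), mul_comm (ℓ : ℤ), zpow_mul, zpow_mul]
          rw [h0, h0'] at hrel
          rw [mul_zpow, inv_zpow, mul_inv_eq_one, zpow_mul, zpow_mul _ (ℓ : ℤ) 2]
          exact_mod_cast hrel
        have h2 := hT _ _ (by positivity) h1
        have h3 : (ω ^ F' * (ε₁ ^ a' * ε₂ ^ b')⁻¹) ^ 2 = 1 := by
          rcases h2 with h2 | h2 <;> rw [h2] <;> simp
        rw [mul_pow, inv_pow, mul_inv_eq_one] at h3
        exact h3
  obtain ⟨g, hg, hprod⟩ := hD ![ω, ε₁, ε₂]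
  simp only [Fin.prod_univ_three, Matrix.cons_val_zero, Matrix.cons_val_one,
    Matrix.cons_val] at hprod
  refine key _ (g 0) (-g 1) (-g 2) rfl ?_ ?_
  · intro h
    apply hg
    ext i
    fin_cases i <;> simp <;> omega
  · congr 1
    rw [zpow_neg, zpow_neg, ← mul_inv, eq_inv_iff_mul_eq_one, ← hprod, mul_assoc]

/-- Second order binomial expansion. -/
lemma exists_one_add_pow_eq (y : R) (n : ℕ) :
    ∃ t : R, (1 + y) ^ n = 1 + n * y + n.choose 2 * y ^ 2 + y ^ 3 * t := by
  induction n with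
  | zero => exact ⟨0, by simp⟩
  | succ n ih =>
    obtain ⟨t, ht⟩ := ih
    refine ⟨n.choose 2 + t + y * t, ?_⟩
    rw [pow_succ, ht, Nat.choose_succ_succ' n 1]
    push_cast [Nat.choose_one_right]
    ring

/-- `x = 1 + p ^ w σ` up to `p ^ (w + 1)`. -/
def IsOneAdd (p w : ℕ) (σ : R) (x : Rˣ) : Prop :=
  (p : R) ^ (w + 1) ∣ (x : R) - 1 - (p : R) ^ w * σ

namespace IsOneAdd

variable {p w : ℕ} {σ τ : R} {x y : Rˣ}

lemma one : IsOneAdd p w (0 : R) 1 := by simp [IsOneAdd]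

lemma mul (hw : 1 ≤ w) (hx : IsOneAdd p w σ x) (hy : IsOneAdd p w τ y) :
    IsOneAdd p w (σ + τ) (x * y) := by
  obtain ⟨r, hr⟩ := hx
  obtain ⟨t, ht⟩ := hy
  obtain ⟨v, rfl⟩ := Nat.exists_eq_add_of_le hw
  have h1 : (x : R) = 1 + (p : R) ^ (1 + v) * σ + (p : R) ^ (1 + v + 1) * r := by
    linear_combination hr
  have h2 : (y : R) = 1 + (p : R) ^ (1 + v) * τ + (p : R) ^ (1 + v + 1) * t := by
    linear_combination ht
  refine ⟨r + t + (p : R) ^ v * (σ + p * r) * (τ + p * t), ?_⟩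
  rw [Units.val_mul, h1, h2]
  ring

lemma congr (hx : IsOneAdd p w σ x) (h : (p : R) ∣ τ - σ) : IsOneAdd p w τ x := by
  obtain ⟨r, hr⟩ := hx
  obtain ⟨t, ht⟩ := h
  exact ⟨r - t, by rw [eq_add_of_sub_eq ht]; linear_combination hr⟩

lemma sub_dvd (hx : IsOneAdd p w σ x) : (p : R) ^ w ∣ (x : R) - 1 := by
  obtain ⟨r, hr⟩ := hx
  exact ⟨σ + p * r, by linear_combination hr⟩

lemma inv (hw : 1 ≤ w) (hx : IsOneAdd p w σ x) : IsOneAdd p w (-σ) x⁻¹ := by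
  obtain ⟨s, hs⟩ : ∃ s, (x : R) - 1 = (p : R) ^ w * s := hx.sub_dvd
  obtain ⟨r, hr⟩ := hx
  obtain ⟨v, rfl⟩ := Nat.exists_eq_add_of_le hw
  have hinv : (x : R) * ↑x⁻¹ = 1 := x.mul_inv
  refine ⟨↑x⁻¹ * ((p : R) ^ v * s * σ - r), ?_⟩
  linear_combination (-(↑x⁻¹ : R)) * hr + (1 - (p : R) ^ (1 + v) * σ) * hinv
    + (↑x⁻¹ : R) * (p : R) ^ (1 + v) * σ * hs

lemma pow (hw : 1 ≤ w) (hx : IsOneAdd p w σ x) (n : ℕ) : IsOneAdd p w (n * σ) (x ^ n) := by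
  induction n with
  | zero => simpa using one
  | succ n ih =>
    rw [pow_succ]
    convert ih.mul hw hx using 1
    push_cast; ring

lemma zpow (hw : 1 ≤ w) (hx : IsOneAdd p w σ x) (n : ℤ) :
    IsOneAdd p w ((n : R) * σ) (x ^ n) := by
  obtain ⟨n, rfl | rfl⟩ := n.eq_nat_or_neg
  · simpa using hx.pow hw n
  · simpa using (hx.pow hw n).inv hw

lemma pow_prime (hp : Odd p) (hw : 1 ≤ w) (hx : IsOneAdd p w σ x) :
    IsOneAdd p (w + 1) σ (x ^ p) := by
  obtain ⟨r, hr⟩ := hx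
  obtain ⟨v, rfl⟩ := Nat.exists_eq_add_of_le hw
  obtain ⟨c, rfl⟩ := hp
  obtain ⟨t, ht⟩ := exists_one_add_pow_eq
    (((2 * c + 1 : ℕ) : R) ^ (1 + v) * (σ + ((2 * c + 1 : ℕ) : R) * r)) (2 * c + 1)
  have hch : (2 * c + 1).choose 2 = (2 * c + 1) * c := by
    rw [Nat.choose_two_right, Nat.add_sub_cancel, mul_left_comm, Nat.mul_div_cancel_left _ two_pos]
  have hx : (x : R) = 1 + ((2 * c + 1 : ℕ) : R) ^ (1 + v) * (σ + ((2 * c + 1 : ℕ) : R) * r) := by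
    linear_combination hr
  rw [hch] at ht
  unfold IsOneAdd
  rw [Units.val_pow_eq_pow_val, hx, ht, Nat.cast_mul]
  generalize ((2 * c + 1 : ℕ) : R) = q
  exact ⟨r + c * q ^ v * (σ + q * r) ^ 2 + q ^ (2 * v) * (σ + q * r) ^ 3 * t, by ring⟩

lemma pow_prime_pow (hp : Odd p) (hx : IsOneAdd p 1 σ x) (n : ℕ) :
    IsOneAdd p (n + 1) σ (x ^ p ^ n) := by
  induction n with
  | zero => simpa using hx
  | succ n ih =>
    rw [pow_succ, pow_mul]
    exact ih.pow_prime hp (by omega)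

end IsOneAdd

end UnitRelations

namespace QuarticOrder

variable {π : QuarticParams}

lemma natCast_dvd {q : ℕ} {x : QuarticOrder π} : (q : QuarticOrder π) ∣ x ↔
    (x.c0 : ZMod q) = 0 ∧ (x.c1 : ZMod q) = 0 ∧ (x.c2 : ZMod q) = 0 ∧ (x.c3 : ZMod q) = 0 := by
  simp only [ZMod.intCast_zmod_eq_zero_iff_dvd]
  rw [← intCast_dvd, Int.cast_natCast]

lemma pow_frobenius {p i j : ℕ} (hp : p.Prime)
    (hα : (p : QuarticOrder π) ∣ gen ^ p ^ (i + j) - gen ^ p ^ i)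
    (hs : (p : QuarticOrder π) ∣ sgen ^ p ^ (i + j) - sgen ^ p ^ i) (x : QuarticOrder π) :
    (p : QuarticOrder π) ∣ x ^ p ^ (i + j) - x ^ p ^ i := by
  have : Fact p.Prime := ⟨hp⟩
  have hu : (p : QuarticOrder π) ∈ nonunits (QuarticOrder π) := by
    intro h
    have h1 := natCast_dvd.1 (h.dvd (a := 1))
    simp at h1
  have := CharP.quotient (QuarticOrder π) p hu
  let mk := Ideal.Quotient.mk (Ideal.span {(p : QuarticOrder π)})
  have hmk : ∀ x y, mk x = mk y ↔ (p : QuarticOrder π) ∣ x - y := fun x y => by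
    rw [Ideal.Quotient.eq, Ideal.mem_span_singleton]
  have key : (iterateFrobenius _ p (i + j)).comp mk = (iterateFrobenius _ p i).comp mk := by
    apply hom_ext <;>
      simp only [RingHom.comp_apply, iterateFrobenius_def, ← map_pow] <;> rwa [hmk]
  have h := RingHom.congr_fun key x
  simp only [RingHom.comp_apply, iterateFrobenius_def, ← map_pow] at h
  rwa [hmk] at h

lemma unit_pow_modEq_one {p k i j : ℕ} (hp : p.Prime)
    (hα : (p : QuarticOrder π) ∣ gen ^ p ^ (i + j) - gen ^ p ^ i)
    (hs : (p : QuarticOrder π) ∣ sgen ^ p ^ (i + j) - sgen ^ p ^ i) (κ : (QuarticOrder π)ˣ) :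
    ((p ^ (k + 1) : ℕ) : QuarticOrder π) ∣
      ((κ ^ (p ^ i * (p ^ j - 1) * p ^ k) : (QuarticOrder π)ˣ) : QuarticOrder π) - 1 := by
  have h1 := pow_frobenius hp hα hs (κ : QuarticOrder π)
  have h2 : (p : QuarticOrder π) ∣ (κ : QuarticOrder π) ^ (p ^ i * (p ^ j - 1)) - 1 := by
    have h3 : (κ : QuarticOrder π) ^ p ^ (i + j) - (κ : QuarticOrder π) ^ p ^ i =
        (κ : QuarticOrder π) ^ p ^ i * ((κ : QuarticOrder π) ^ (p ^ i * (p ^ j - 1)) - 1) := by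
      rw [mul_sub, ← pow_add, mul_one, ← mul_one_add,
        Nat.add_sub_cancel' (Nat.one_le_pow _ _ hp.pos), pow_add]
    rw [h3] at h1
    exact ((κ.isUnit.pow _).dvd_mul_left).1 h1
  have h4 := dvd_sub_pow_of_dvd_sub h2 k
  rw [one_pow, ← pow_mul] at h4
  push_cast
  exact_mod_cast h4

end QuarticOrder

/-- `eager n f = f n`, written so that the kernel evaluates `n` first. -/
def eager {α : Type*} (n : ℕ) (f : ℕ → α) : α :=
  match n with
  | 0 => f 0
  | k + 1 => f (k + 1)

@[simp] lemma eager_eq {α : Type*} (n : ℕ) (f : ℕ → α) : eager n f = f n := by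
  cases n <;> rfl

/-- Coordinates of an element of a quartic order modulo some integer. -/
structure Residue where
  c0 : ℕ
  c1 : ℕ
  c2 : ℕ
  c3 : ℕ

namespace Residue

/-- `r` represents `x` modulo `q`. -/
def Rep {π : QuarticParams} (q : ℕ) (r : Residue) (x : QuarticOrder π) : Prop :=
  (r.c0 : ZMod q) = x.c0 ∧ (r.c1 : ZMod q) = x.c1 ∧ (r.c2 : ZMod q) = x.c2 ∧
    (r.c3 : ZMod q) = x.c3

/-- Equality test. -/
def same (r t : Residue) : Bool :=
  Nat.beq r.c0 t.c0 && Nat.beq r.c1 t.c1 && Nat.beq r.c2 t.c2 && Nat.beq r.c3 t.c3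

end Residue

/-- Parameters of a quartic order modulo `q`. -/
structure ResidueParams where
  q : ℕ
  m : ℕ
  n : ℕ
  P : ℕ
  Q : ℕ
  k : ℕ

namespace ResidueParams

/-- Multiplication of residues. -/
def mul (C : ResidueParams) (x y : Residue) : Residue :=
  eager ((x.c3 * y.c3) % C.q) fun t33 =>
  eager ((x.c1 * y.c3 + x.c3 * y.c1) % C.q) fun t13 =>
  eager ((x.c2 * y.c3 + x.c3 * y.c2) % C.q) fun t23 =>
  eager ((x.c1 * y.c1) % C.q) fun t11 =>
  eager ((x.c2 * y.c2 + t33 * C.n) % C.q) fun w =>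
  eager ((t13 * C.m + C.P * (t33 * C.m)) % C.q) fun z =>
  eager ((x.c0 * y.c0 + t11 * C.n + C.k * w + C.Q * t23 * C.n + C.k * z) % C.q) fun r0 =>
  eager ((x.c0 * y.c1 + x.c1 * y.c0 + C.k * t23 + C.Q * w + C.Q * z) % C.q) fun r1 =>
  eager ((x.c0 * y.c2 + x.c2 * y.c0 + t11 * C.m + t13 * C.n + C.P * w + C.k * (t33 * C.m)
    + C.Q * t23 * C.m + C.P * z) % C.q) fun r2 =>
  eager ((x.c0 * y.c3 + x.c1 * y.c2 + x.c2 * y.c1 + x.c3 * y.c0 + C.P * t23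
    + C.Q * (t33 * C.m)) % C.q) fun r3 =>
  ⟨r0, r1, r2, r3⟩

/-- `a * x ^ e` by repeated squaring, for `e < 2 ^ fuel`; slow but correct otherwise. -/
def mulPow (C : ResidueParams) : ℕ → Residue → Residue → ℕ → Residue
  | 0, a, x, e => Nat.rec a (fun _ r => C.mul r x) e
  | f + 1, a, x, e =>
    match Nat.beq e 0 with
    | true => a
    | false => match Nat.beq (e % 2) 0 with
      | true => C.mulPow f a (C.mul x x) (e / 2)
      | false => C.mulPow f (C.mul a x) (C.mul x x) (e / 2)

/-- The residue of `x`, passed on in evaluated form. -/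
def reduce {α : Type*} (C : ResidueParams) {π : QuarticParams} (x : QuarticOrder π)
    (f : Residue → α) : α :=
  eager (x.c0 % C.q).toNat fun r0 => eager (x.c1 % C.q).toNat fun r1 =>
  eager (x.c2 % C.q).toNat fun r2 => eager (x.c3 % C.q).toNat fun r3 => f ⟨r0, r1, r2, r3⟩

/-- The parameters modulo `q`, passed on in evaluated form. -/
def ofParams {α : Type*} (π : QuarticParams) (q : ℕ) (f : ResidueParams → α) : α :=
  eager q fun q => eager (π.m % q).toNat fun m => eager (π.n % q).toNat fun n =>
  eager (π.P % q).toNat fun P => eager (π.Q % q).toNat fun Q => eager (π.k % q).toNat fun k =>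
  f ⟨q, m, n, P, Q, k⟩

/-- `C` represents `π`. -/
def Rep (C : ResidueParams) (π : QuarticParams) : Prop :=
  0 < C.q ∧ (C.m : ZMod C.q) = π.m ∧ (C.n : ZMod C.q) = π.n ∧ (C.P : ZMod C.q) = π.P ∧
    (C.Q : ZMod C.q) = π.Q ∧ (C.k : ZMod C.q) = π.k

variable {C : ResidueParams} {π : QuarticParams} {x y : QuarticOrder π} {r t : Residue}

lemma natCast_toNat_emod {q : ℕ} (hq : 0 < q) (a : ℤ) : ((a % q).toNat : ZMod q) = a := by
  rw [← Int.cast_natCast, Int.toNat_of_nonneg (Int.emod_nonneg _ (by omega))]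
  simp

lemma ofParams_spec {α : Type*} {q : ℕ} (hq : 0 < q) (f : ResidueParams → α) :
    ∃ C : ResidueParams, C.q = q ∧ C.Rep π ∧ ofParams π q f = f C := by
  refine ⟨⟨q, (π.m % q).toNat, (π.n % q).toNat, (π.P % q).toNat, (π.Q % q).toNat,
    (π.k % q).toNat⟩, rfl, ?_, by simp [ofParams]⟩
  simp [Rep, natCast_toNat_emod hq, hq]

lemma reduce_spec {α : Type*} (hC : C.Rep π) (x : QuarticOrder π) (f : Residue → α) :
    ∃ r : Residue, r.Rep C.q x ∧ C.reduce x f = f r := by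
  refine ⟨⟨(x.c0 % C.q).toNat, (x.c1 % C.q).toNat, (x.c2 % C.q).toNat, (x.c3 % C.q).toNat⟩, ?_,
    by simp [reduce]⟩
  simp [Residue.Rep, natCast_toNat_emod hC.1]

lemma mul_spec (hC : C.Rep π) (hx : r.Rep C.q x) (hy : t.Rep C.q y) :
    (C.mul r t).Rep C.q (x * y) := by
  obtain ⟨-, hm, hn, hP, hQ, hk⟩ := hC
  obtain ⟨hx0, hx1, hx2, hx3⟩ := hx
  obtain ⟨hy0, hy1, hy2, hy3⟩ := hy
  simp only [Residue.Rep, mul, eager_eq, ZMod.natCast_mod, Nat.cast_add, Nat.cast_mul,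
    QuarticOrder.mul_c0, QuarticOrder.mul_c1, QuarticOrder.mul_c2, QuarticOrder.mul_c3,
    Int.cast_add, Int.cast_mul, hm, hn, hP, hQ, hk, hx0, hx1, hx2, hx3, hy0, hy1, hy2, hy3,
        and_self]

lemma mulPow_spec (hC : C.Rep π) (f : ℕ) : ∀ {x y : QuarticOrder π} {r t : Residue} {e : ℕ},
    r.Rep C.q x → t.Rep C.q y → (C.mulPow f r t e).Rep C.q (x * y ^ e) := by
  induction f with
  | zero =>
    intro x y r t e hx hy
    unfold mulPow
    induction e with
    | zero => simpa using hx
    | succ e ih =>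
      rw [pow_succ, ← mul_assoc]
      exact mul_spec hC ih hy
  | succ f ih =>
    intro x y r t e hx hy
    unfold mulPow
    cases h : Nat.beq e 0 with
    | true => rw [Nat.eq_of_beq_eq_true h]; simpa using hx
    | false =>
      have h2 := Nat.div_add_mod e 2
      cases h' : Nat.beq (e % 2) 0 with
      | true =>
        have := ih (e := e / 2) hx (mul_spec hC hy hy)
        rw [Nat.eq_of_beq_eq_true h', add_zero] at h2
        rwa [← sq, ← pow_mul, h2] at this
      | false =>
        have := ih (e := e / 2) (mul_spec hC hx hy) (mul_spec hC hy hy)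
        have h3 : e % 2 = 1 := by
          have := Nat.ne_of_beq_eq_false h'
          omega
        rw [h3] at h2
        rwa [mul_assoc, ← sq, ← pow_mul, ← pow_succ', h2] at this

end ResidueParams

namespace QuarticOrder

variable {π : QuarticParams}

lemma natCast_mul_c0 (n : ℕ) (x : QuarticOrder π) : ((n : QuarticOrder π) * x).c0 = n * x.c0 := by
  rw [← Int.cast_natCast, intCast_mul_c0]

lemma natCast_mul_c1 (n : ℕ) (x : QuarticOrder π) : ((n : QuarticOrder π) * x).c1 = n * x.c1 := by
  rw [← Int.cast_natCast, intCast_mul_c1]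

lemma natCast_mul_c2 (n : ℕ) (x : QuarticOrder π) : ((n : QuarticOrder π) * x).c2 = n * x.c2 := by
  rw [← Int.cast_natCast, intCast_mul_c2]

lemma natCast_mul_c3 (n : ℕ) (x : QuarticOrder π) : ((n : QuarticOrder π) * x).c3 = n * x.c3 := by
  rw [← Int.cast_natCast, intCast_mul_c3]

lemma natCast_mul_left_cancel {n : ℕ} (hn : n ≠ 0) {x y : QuarticOrder π}
    (h : (n : QuarticOrder π) * x = n * y) : x = y := by
  have hn' : (n : ℤ) ≠ 0 := by exact_mod_cast hn
  rw [← Int.cast_natCast] at h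
  have h0 := congrArg c0 h
  have h1 := congrArg c1 h
  have h2 := congrArg c2 h
  have h3 := congrArg c3 h
  simp only [intCast_mul_c0, intCast_mul_c1, intCast_mul_c2, intCast_mul_c3] at h0 h1 h2 h3
  ext
  exacts [mul_left_cancel₀ hn' h0, mul_left_cancel₀ hn' h1, mul_left_cancel₀ hn' h2,
    mul_left_cancel₀ hn' h3]

lemma natCast_dvd_iff {n : ℕ} {x : QuarticOrder π} : (n : QuarticOrder π) ∣ x ↔
    (n : ℤ) ∣ x.c0 ∧ (n : ℤ) ∣ x.c1 ∧ (n : ℤ) ∣ x.c2 ∧ (n : ℤ) ∣ x.c3 := by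
  rw [← intCast_dvd, Int.cast_natCast]

lemma eq_zero_of_forall_pow_dvd {p : ℕ} (hp : 1 < p) {x : QuarticOrder π}
    (h : ∀ k : ℕ, (p : QuarticOrder π) ^ k ∣ x) : x = 0 := by
  have key : ∀ z : ℤ, (∀ k : ℕ, ((p ^ k : ℕ) : ℤ) ∣ z) → z = 0 := fun z hz => by
    refine Int.eq_zero_of_abs_lt_dvd (hz z.natAbs) ?_
    rw [Int.abs_eq_natAbs]
    exact_mod_cast Nat.lt_pow_self hp
  have h' : ∀ k : ℕ, _ := fun k => (natCast_dvd_iff (n := p ^ k) (x := x)).1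
    (by push_cast; exact h k)
  ext
  exacts [key _ fun k => (h' k).1, key _ fun k => (h' k).2.1, key _ fun k => (h' k).2.2.1,
    key _ fun k => (h' k).2.2.2]

/-- Skolem's method: a unit close to `1` whose multiple by `η` lies in `ℤ + ℤ α` to first order
is trivial, if it is dependent on two units that move `η` out of `ℤ + ℤ α` independently. -/
lemma eq_one_of_skolem {p : ℕ} (hp : p.Prime) (hodd : Odd p)
    (hT : ∀ (κ : (QuarticOrder π)ˣ) (N : ℤ), N ≠ 0 → κ ^ N = 1 → κ = 1 ∨ κ = -1)
    {A B ω : (QuarticOrder π)ˣ} {τ₁ τ₂ η : QuarticOrder π}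
    (hA : IsOneAdd p 1 τ₁ A) (hB : IsOneAdd p 1 τ₂ B)
    (hω : (p : QuarticOrder π) ∣ (ω : QuarticOrder π) - 1)
    (hη₂ : (η * ((ω : QuarticOrder π) - 1)).c2 = 0) (hη₃ : (η * ((ω : QuarticOrder π) - 1)).c3 = 0)
    (hdet : ∀ a b : ℤ, (p : ℤ) ∣ (η * (a * τ₁ + b * τ₂)).c2 →
      (p : ℤ) ∣ (η * (a * τ₁ + b * τ₂)).c3 → (p : ℤ) ∣ a ∧ (p : ℤ) ∣ b)
    {F a b : ℤ} (hF : F ≠ 0) (hrel : ω ^ F = A ^ a * B ^ b) : ω = 1 := by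
  have hpR : (p : QuarticOrder π) ^ 1 = p := pow_one _
  have hAB : ∀ a b : ℤ, IsOneAdd p 1 (a * τ₁ + b * τ₂) (A ^ a * B ^ b) := fun a b =>
    (hA.zpow le_rfl a).mul le_rfl (hB.zpow le_rfl b)
  have hdet' : ∀ a b : ℤ, (p : QuarticOrder π) ∣ (a * τ₁ + b * τ₂) → (p : ℤ) ∣ a ∧ (p : ℤ) ∣ b := by
    intro a b h
    have h' := natCast_dvd_iff.1 (h.mul_left η)
    exact hdet a b h'.2.2.1 h'.2.2.2
  have hcancel : ∀ {w : ℕ} {x y : QuarticOrder π}, (p : QuarticOrder π) ^ w * x =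
      (p : QuarticOrder π) ^ w * y → x = y := fun {w x y} h =>
    natCast_mul_left_cancel (n := p ^ w) (pow_ne_zero _ hp.ne_zero) (by push_cast; exact h)
  obtain ⟨F, a, b, hF, hrel⟩ : ∃ F a b : ℤ, ¬ (p : ℤ) ∣ F ∧ ω ^ F = A ^ a * B ^ b := by
    induction hn : F.natAbs using Nat.strong_induction_on generalizing F a b with
    | _ n ih =>
      by_cases hpF : (p : ℤ) ∣ F
      · obtain ⟨F', rfl⟩ := hpF
        obtain ⟨σ, hσ⟩ := hω
        have hω' : IsOneAdd p 1 σ ω := ⟨0, by rw [hσ]; ring⟩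
        have h1 := hω'.zpow le_rfl (p * F')
        have h2 := hAB a b
        rw [hrel] at h1
        have h3 : (p : QuarticOrder π) ∣ a * τ₁ + b * τ₂ := by
          obtain ⟨r, hr⟩ := h1
          obtain ⟨t, ht⟩ := h2
          refine ⟨r - t + F' * σ, ?_⟩
          apply hcancel (w := 1)
          push_cast at hr ht
          linear_combination hr - ht
        obtain ⟨⟨a', rfl⟩, ⟨b', rfl⟩⟩ := hdet' a b h3
        have hF' : F' ≠ 0 := right_ne_zero_of_mul hF
        refine ih F'.natAbs ?_ (F := F') (a := a') (b := b') hF' ?_ rfl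
        · rw [← hn, Int.natAbs_mul, Int.natAbs_natCast]
          have := hp.one_lt
          have := Int.natAbs_pos.2 hF'
          nlinarith
        · have h4 : (ω ^ F' * (A ^ a' * B ^ b')⁻¹) ^ (p : ℤ) = 1 := by
            rw [mul_zpow, inv_zpow, mul_inv_eq_one, mul_zpow, ← zpow_mul, ← zpow_mul, ← zpow_mul,
              mul_comm F', hrel, mul_comm a', mul_comm b']
          have h5 := (hω'.zpow le_rfl F').mul le_rfl ((hAB a' b').inv le_rfl)
          rcases hT _ _ (by exact_mod_cast hp.ne_zero) h4 with h6 | h6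
          · exact mul_inv_eq_one.1 h6
          · exfalso
            rw [h6] at h5
            have h7 := (natCast_dvd_iff.1 (hpR ▸ h5.sub_dvd)).1
            simp at h7
            have h8 : p ∣ 2 := by exact_mod_cast h7
            rw [(Nat.prime_dvd_prime_iff_eq hp Nat.prime_two).1 h8] at hodd
            exact absurd hodd (by decide)
      · exact ⟨F, a, b, hpF, hrel⟩
  have key : ∀ k : ℕ, (p : QuarticOrder π) ^ (k + 1) ∣ (ω : QuarticOrder π) - 1 ∧
      (p : ℤ) ^ k ∣ a ∧ (p : ℤ) ^ k ∣ b := by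
    intro k
    induction k with
    | zero => simpa using hω
    | succ k ih =>
      obtain ⟨⟨τ, hτ⟩, ⟨a', ha'⟩, ⟨b', hb'⟩⟩ := ih
      have h1 : IsOneAdd p (k + 1) τ ω := ⟨0, by rw [hτ]; ring⟩
      have h2 := h1.zpow (by omega) F
      have h3 := ((hA.pow_prime_pow hodd k).zpow (by omega) a').mul (by omega)
        ((hB.pow_prime_pow hodd k).zpow (by omega) b')
      have h4 : (A ^ p ^ k) ^ a' * (B ^ p ^ k) ^ b' = ω ^ F := by
        rw [hrel, ha', hb', zpow_mul, zpow_mul]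
        norm_cast
      rw [h4] at h3
      have h5 : (p : QuarticOrder π) ∣ F * τ - (a' * τ₁ + b' * τ₂) := by
        obtain ⟨r, hr⟩ := h2
        obtain ⟨t, ht⟩ := h3
        refine ⟨t - r, ?_⟩
        apply hcancel (w := k + 1)
        linear_combination ht - hr
      have hητ : (η * τ).c2 = 0 ∧ (η * τ).c3 = 0 := by
        have hpk : ((p ^ (k + 1) : ℕ) : ℤ) ≠ 0 := by
          exact_mod_cast pow_ne_zero _ hp.ne_zero
        have h6 : η * ((ω : QuarticOrder π) - 1) =
            ((p ^ (k + 1) : ℕ) : QuarticOrder π) * (η * τ) := by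
          rw [hτ]; push_cast; ring
        rw [h6, natCast_mul_c2] at hη₂
        rw [h6, natCast_mul_c3] at hη₃
        exact ⟨(mul_eq_zero.1 hη₂).resolve_left hpk, (mul_eq_zero.1 hη₃).resolve_left hpk⟩
      have h7 := natCast_dvd_iff.1 (h5.mul_left η)
      have h8 : η * (F * τ - (a' * τ₁ + b' * τ₂)) =
          (F : QuarticOrder π) * (η * τ) - η * (a' * τ₁ + b' * τ₂) := by ring
      rw [h8] at h7
      simp only [sub_c2, sub_c3, intCast_mul_c2, intCast_mul_c3, hητ.1, hητ.2, mul_zero, zero_sub,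
        dvd_neg] at h7
      obtain ⟨⟨a'', rfl⟩, ⟨b'', rfl⟩⟩ := hdet a' b' h7.2.2.1 h7.2.2.2
      refine ⟨?_, ⟨a'', by rw [ha']; ring⟩, ⟨b'', by rw [hb']; ring⟩⟩
      have h9 : (p : QuarticOrder π) ∣ F * τ := by
        obtain ⟨r, hr⟩ := h5
        refine ⟨r + (a'' * τ₁ + b'' * τ₂), ?_⟩
        push_cast at hr
        linear_combination hr
      have h10 : (p : QuarticOrder π) ∣ τ := by
        have h11 := natCast_dvd_iff.1 h9
        simp only [intCast_mul_c0, intCast_mul_c1, intCast_mul_c2, intCast_mul_c3] at h11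
        have hp' := Nat.prime_iff_prime_int.1 hp
        exact natCast_dvd_iff.2 ⟨(hp'.dvd_or_dvd h11.1).resolve_left hF,
          (hp'.dvd_or_dvd h11.2.1).resolve_left hF, (hp'.dvd_or_dvd h11.2.2.1).resolve_left hF,
          (hp'.dvd_or_dvd h11.2.2.2).resolve_left hF⟩
      rw [hτ, pow_succ]
      exact mul_dvd_mul_left _ h10
  ext1
  rw [Units.val_one, ← sub_eq_zero]
  refine eq_zero_of_forall_pow_dvd hp.one_lt fun k => ?_
  exact (pow_dvd_pow _ k.le_succ).trans (key k).1

end QuarticOrder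

section

open Polynomial

lemma coeff_eq_of_quartic_eq {R : Type*} [CommRing R] {b c d a' b' c' d' : R}
    (h : (X ^ 4 + C b * X ^ 2 + C c * X + C d : R[X]) =
      X ^ 4 + C a' * X ^ 3 + C b' * X ^ 2 + C c' * X + C d') :
    0 = a' ∧ b = b' ∧ c = c' ∧ d = d' := by
  have e3 := congrArg (coeff · 3) h
  have e2 := congrArg (coeff · 2) h
  have e1 := congrArg (coeff · 1) h
  have e0 := congrArg (coeff · 0) h
  simp [coeff_X, coeff_C, coeff_X_pow] at e3 e2 e1 e0
  exact ⟨e3, e2, e1, e0⟩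

/-- Test that `X ^ 4 + u X ^ 2 + v X + w` is irreducible modulo the prime `q`. -/
def irreducibleMod (q u v w : ℕ) : Bool :=
  ((List.range q).all fun a => Nat.ble 1 ((a ^ 4 + u * a ^ 2 + v * a + w) % q)) &&
  (List.range q).all fun a => (List.range q).all fun b => eager ((u + a * a + (q - b)) % q) fun c =>
    !(Nat.beq (a * (c + (q - b)) % q) (v % q) && Nat.beq (b * c % q) (w % q))

lemma irreducible_of_irreducibleMod {q : ℕ} [Fact q.Prime] {u v w : ℕ}
    (h : irreducibleMod q u v w = true) :
    Irreducible (X ^ 4 + C (u : ZMod q) * X ^ 2 + C (v : ZMod q) * X + C (w : ZMod q)) := by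
  set f : (ZMod q)[X] := X ^ 4 + C (u : ZMod q) * X ^ 2 + C (v : ZMod q) * X + C (w : ZMod q)
    with hf
  have hdeg : f.natDegree = 4 := by rw [hf]; compute_degree!
  have hmon : f.Monic := by rw [hf]; monicity!
  simp only [irreducibleMod, Bool.and_eq_true, List.all_eq_true, List.mem_range, eager_eq,
    Bool.not_eq_true', Nat.ble_eq] at h
  obtain ⟨h1, h2⟩ := h
  have hroot : ∀ a : ZMod q, a ^ 4 + u * a ^ 2 + v * a + w ≠ 0 := by
    intro a ha
    have h3 := h1 a.val a.val_lt
    have h4 : ((a.val ^ 4 + u * a.val ^ 2 + v * a.val + w : ℕ) : ZMod q) = 0 := by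
      push_cast
      rwa [ZMod.natCast_zmod_val]
    rw [ZMod.natCast_eq_zero_iff] at h4
    have := Nat.mod_eq_zero_of_dvd h4
    omega
  have hquad : ∀ a b c : ZMod q, b + c - a ^ 2 = u → a * (c - b) = v → b * c ≠ w := by
    intro a b c hu hv hw
    have h3 := h2 a.val a.val_lt b.val b.val_lt
    have hb : ((q - b.val : ℕ) : ZMod q) = -b := by
      rw [Nat.cast_sub b.val_lt.le, ZMod.natCast_zmod_val, CharP.cast_eq_zero, zero_sub]
    have hc : (((u + a.val * a.val + (q - b.val)) % q : ℕ) : ZMod q) = c := by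
      rw [ZMod.natCast_mod]
      push_cast
      rw [hb, ZMod.natCast_zmod_val, ← hu]
      ring
    rw [Bool.and_eq_false_iff] at h3
    rcases h3 with h3 | h3
    · refine Nat.ne_of_beq_eq_false h3 ?_
      refine (ZMod.natCast_eq_natCast_iff' _ _ _).1 ?_
      push_cast [hb, hc, ZMod.natCast_zmod_val]
      rw [← hv]; ring
    · refine Nat.ne_of_beq_eq_false h3 ?_
      refine (ZMod.natCast_eq_natCast_iff' _ _ _).1 ?_
      push_cast [hc, ZMod.natCast_zmod_val]
      exact hw
  rw [hmon.irreducible_iff_natDegree']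
  refine ⟨fun h => by rw [h] at hdeg; simp at hdeg, ?_⟩
  intro g k hg hk hgk hmem
  rw [hdeg, Finset.mem_Ioc] at hmem
  have hdg : g.natDegree + k.natDegree = 4 := by rw [← hg.natDegree_mul hk, hgk, hdeg]
  obtain hk1 | hk2 : k.natDegree = 1 ∨ k.natDegree = 2 := by omega
  · have hkx : k = X + C (k.coeff 0) := by
      have := hk.as_sum
      rw [hk1] at this
      simpa using this
    apply hroot (-k.coeff 0)
    have h3 : f.eval (-k.coeff 0) = 0 := by
      rw [← hgk, eval_mul]
      have : k.eval (-k.coeff 0) = 0 := by rw [hkx]; simp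
      rw [this, mul_zero]
    simpa [hf] using h3
  · have hg2 : g.natDegree = 2 := by omega
    have hkx : k = X ^ 2 + C (k.coeff 1) * X + C (k.coeff 0) := by
      have := hk.as_sum
      rw [hk2] at this
      rw [this]
      simp [Finset.sum_range_succ]
      ring
    have hgx : g = X ^ 2 + C (g.coeff 1) * X + C (g.coeff 0) := by
      have := hg.as_sum
      rw [hg2] at this
      rw [this]
      simp [Finset.sum_range_succ]
      ring
    generalize k.coeff 1 = a at hkx
    generalize k.coeff 0 = b at hkx
    generalize g.coeff 1 = a' at hgx
    generalize g.coeff 0 = b' at hgx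
    have hprod : X ^ 4 + C (u : ZMod q) * X ^ 2 + C (v : ZMod q) * X + C (w : ZMod q) =
        X ^ 4 + C (a + a') * X ^ 3 + C (b + b' + a * a') * X ^ 2 + C (a * b' + a' * b) * X
          + C (b * b') := by
      rw [← hf, ← hgk, hkx, hgx]
      simp only [C_add, C_mul]
      ring
    obtain ⟨e3, e2, e1, e0⟩ := coeff_eq_of_quartic_eq hprod
    have ha' : a' = -a := by linear_combination -e3
    subst ha'
    exact hquad a b b' (by linear_combination -e2) (by linear_combination -e1) e0.symm

/-- A depressed real quartic of negative discriminant has a nonreal root. -/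
lemma exists_nonreal_root {p q r : ℝ}
    (h : 16 * p ^ 4 * r - 4 * p ^ 3 * q ^ 2 - 128 * p ^ 2 * r ^ 2 + 144 * p * q ^ 2 * r
      - 27 * q ^ 4 + 256 * r ^ 3 < 0) :
    ∃ z : ℂ, z.im ≠ 0 ∧ z ^ 4 + p * z ^ 2 + q * z + r = 0 := by
  set f : ℂ[X] := X ^ 4 + C (p : ℂ) * X ^ 2 + C (q : ℂ) * X + C (r : ℂ) with hf
  have hdeg : f.natDegree = 4 := by rw [hf]; compute_degree!
  have hmon : f.Monic := by rw [hf]; monicity!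
  have hs := IsAlgClosed.splits f
  have hcard : f.roots.card = 4 := by rw [← hs.natDegree_eq_card_roots, hdeg]
  obtain ⟨z₁, z₂, z₃, z₄, hz⟩ := Multiset.card_eq_four.1 hcard
  have hprod := hs.eq_prod_roots_of_monic hmon
  rw [hz] at hprod
  simp only [Multiset.insert_eq_cons, Multiset.map_cons, Multiset.map_singleton, Multiset.prod_cons,
    Multiset.prod_singleton] at hprod
  by_contra! hcon
  have hreal : ∀ z ∈ f.roots, z.im = 0 := by
    intro z hz
    by_contra him
    refine hcon z him ?_
    have := (mem_roots'.1 hz).2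
    simpa [hf] using this
  have hexp : X ^ 4 + C (p : ℂ) * X ^ 2 + C (q : ℂ) * X + C (r : ℂ) =
      X ^ 4 + C (-(z₁ + z₂ + z₃ + z₄)) * X ^ 3
      + C (z₁ * z₂ + z₁ * z₃ + z₁ * z₄ + z₂ * z₃ + z₂ * z₄ + z₃ * z₄) * X ^ 2
      + C (-(z₁ * z₂ * z₃ + z₁ * z₂ * z₄ + z₁ * z₃ * z₄ + z₂ * z₃ * z₄)) * X
      + C (z₁ * z₂ * z₃ * z₄) := by
    rw [← hf, hprod]
    simp only [C_add, C_mul, C_neg]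
    ring
  obtain ⟨e3, e2, e1, e0⟩ := coeff_eq_of_quartic_eq hexp
  obtain ⟨x₁, rfl⟩ : ∃ x : ℝ, (x : ℂ) = z₁ :=
    ⟨z₁.re, Complex.ext rfl (hreal z₁ (by simp [hz])).symm⟩
  obtain ⟨x₂, rfl⟩ : ∃ x : ℝ, (x : ℂ) = z₂ :=
    ⟨z₂.re, Complex.ext rfl (hreal z₂ (by simp [hz])).symm⟩
  obtain ⟨x₃, rfl⟩ : ∃ x : ℝ, (x : ℂ) = z₃ :=
    ⟨z₃.re, Complex.ext rfl (hreal z₃ (by simp [hz])).symm⟩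
  obtain ⟨x₄, rfl⟩ : ∃ x : ℝ, (x : ℂ) = z₄ :=
    ⟨z₄.re, Complex.ext rfl (hreal z₄ (by simp [hz])).symm⟩
  norm_cast at e3 e2 e1 e0
  have hx : x₄ = -(x₁ + x₂ + x₃) := by linear_combination e3
  subst hx
  have : (((x₁ - x₂) * (x₁ - x₃) * (x₁ + (x₁ + x₂ + x₃)) * (x₂ - x₃) * (x₂ + (x₁ + x₂ + x₃))
      * (x₃ + (x₁ + x₂ + x₃))) ^ 2) < 0 := by
    rw [e2, e1, e0] at h
    convert h using 1
    ring
  exact absurd this (not_lt.2 (sq_nonneg _))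

end

section

open Polynomial QuarticOrder

/-- Primality test by trial division. -/
def isPrimeNat (p : ℕ) : Bool :=
  Nat.ble 2 p && (List.range (2 ^ (p.log2 / 2 + 1))).all fun d =>
    Nat.ble d 1 || Nat.ble p d || Nat.ble 1 (p % d)

lemma prime_of_isPrimeNat {p : ℕ} (h : isPrimeNat p = true) : p.Prime := by
  simp only [isPrimeNat, Bool.and_eq_true, Nat.ble_eq, List.all_eq_true, List.mem_range,
    Bool.or_eq_true] at h
  obtain ⟨h2, h⟩ := h
  rw [Nat.prime_def_le_sqrt]
  refine ⟨h2, fun d hd hds hdp => ?_⟩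
  have h1 : d * d ≤ p := Nat.le_sqrt.1 hds
  have h3 : d < 2 ^ (p.log2 / 2 + 1) := by
    by_contra! h4
    have h5 : p < 2 ^ (p.log2 + 1) := Nat.lt_log2_self
    have h6 : 2 ^ (p.log2 + 1) ≤ 2 ^ (p.log2 / 2 + 1) * 2 ^ (p.log2 / 2 + 1) := by
      rw [← pow_add]
      exact Nat.pow_le_pow_right two_pos (by omega)
    have := Nat.mul_le_mul h4 h4
    omega
  rcases h d h3 with (h4 | h4) | h4
  · omega
  · have : 2 * d ≤ d * d := Nat.mul_le_mul_right d hd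
    omega
  · have := Nat.mod_eq_zero_of_dvd hdp
    omega

/-- A ring homomorphism to `ZMod q` given by the images of `α` and `s`. -/
structure ResidueChar where
  q : ℕ
  r : ℕ
  s : ℕ

namespace ResidueChar

variable {π : QuarticParams}

/-- Test that `c` defines a homomorphism from the order of `π` to a prime field. -/
def ok (c : ResidueChar) (π : QuarticParams) : Bool :=
  isPrimeNat c.q && decide ((c.r ^ 2 - (π.m * c.s + π.n)) % (c.q : ℤ) = 0) &&
    decide ((c.s ^ 2 - (π.P * c.s + π.Q * c.r + π.k)) % (c.q : ℤ) = 0)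

/-- The image of `x`. -/
def val (c : ResidueChar) (x : QuarticOrder π) : ℕ :=
  ((x.c0 + x.c1 * c.r + (x.c2 + x.c3 * c.r) * c.s) % (c.q : ℤ)).toNat

lemma exists_hom {c : ResidueChar} (h : c.ok π = true) :
    c.q.Prime ∧ ∃ φ : QuarticOrder π →+* ZMod c.q, ∀ x, φ x = c.val x := by
  simp only [ok, Bool.and_eq_true, decide_eq_true_eq] at h
  obtain ⟨⟨hp, h1⟩, h2⟩ := h
  have hq := prime_of_isPrimeNat hp
  refine ⟨hq, lift (c.r : ZMod c.q) (c.s : ZMod c.q) ?_ ?_, fun x => ?_⟩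
  · have := (ZMod.intCast_zmod_eq_zero_iff_dvd _ c.q).2 (Int.dvd_of_emod_eq_zero h1)
    push_cast at this
    linear_combination this
  · have := (ZMod.intCast_zmod_eq_zero_iff_dvd _ c.q).2 (Int.dvd_of_emod_eq_zero h2)
    push_cast at this
    linear_combination this
  · rw [lift_apply, val, ResidueParams.natCast_toNat_emod hq.pos]
    push_cast
    ring

end ResidueChar

/-- Data showing that `ε₁, ε₂` are independent modulo `ℓ`-th powers. -/
structure PowerCert where
  l : ℕ
  c : ResidueChar
  d : ResidueChar

namespace PowerCert

variable {π : QuarticParams}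

/-- Correctness test. -/
def ok (s : PowerCert) (ε₁ ε₂ : QuarticOrder π) : Bool :=
  isPrimeNat s.l && s.c.ok π && s.d.ok π && Nat.beq (s.c.q % (2 * s.l)) 1 &&
    Nat.beq (s.d.q % (2 * s.l)) 1 && Nat.beq (s.c.val ε₂ ^ (s.c.q / s.l) % s.c.q) 1 &&
    !Nat.beq (s.c.val ε₁ ^ (s.c.q / s.l) % s.c.q) 1 &&
    !Nat.beq (s.d.val ε₂ ^ (s.d.q / s.l) % s.d.q) 1

lemma pow_val_eq_one {c : ResidueChar} {l : ℕ} (hl : l.Prime) (hc : c.ok π = true)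
    (hq : c.q % (2 * l) = 1) {ε₁ ε₂ κ : (QuarticOrder π)ˣ} {i j : ℤ}
    (h : (κ ^ (l : ℤ)) ^ 2 = (ε₁ ^ i * ε₂ ^ j) ^ 2) : ∃ u₁ u₂ : (ZMod c.q)ˣ,
      (u₁ : ZMod c.q) = (c.val (ε₁ : QuarticOrder π) ^ (c.q / l) % c.q : ℕ) ∧
      (u₂ : ZMod c.q) = (c.val (ε₂ : QuarticOrder π) ^ (c.q / l) % c.q : ℕ) ∧
      u₁ ^ l = 1 ∧ u₂ ^ l = 1 ∧ u₁ ^ i * u₂ ^ j = 1 := by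
  obtain ⟨hp, φ, hφ⟩ := c.exists_hom hc
  have : Fact c.q.Prime := ⟨hp⟩
  obtain ⟨e, he⟩ : ∃ e, c.q = 2 * l * e + 1 := ⟨c.q / (2 * l), by
    have := Nat.div_add_mod c.q (2 * l); omega⟩
  have hel : c.q / l = 2 * e := by
    rw [he, mul_comm 2 l, mul_assoc, Nat.mul_add_div hl.pos, Nat.div_eq_of_lt hl.one_lt, add_zero]
  have hcard : ∀ u : (ZMod c.q)ˣ, (u ^ (2 * e)) ^ l = 1 := fun u => by
    rw [← pow_mul]
    have h1 := ZMod.units_pow_card_sub_one_eq_one c.q u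
    rwa [show c.q - 1 = 2 * e * l by rw [he]; simp; ring] at h1
  let Φ := Units.map (φ : QuarticOrder π →* ZMod c.q)
  refine ⟨Φ ε₁ ^ (2 * e), Φ ε₂ ^ (2 * e), ?_, ?_, hcard _, hcard _, ?_⟩
  · simp [Φ, hφ, hel]
  · simp [Φ, hφ, hel]
  · have h1 := congrArg (fun x => Φ x ^ e) h
    simp only [map_pow, map_mul, map_zpow] at h1
    have h2 := hcard (Φ κ)
    rw [← pow_mul, ← zpow_natCast, ← zpow_mul] at h1
    rw [← pow_mul, ← zpow_natCast] at h2
    rw [show (l : ℤ) * ((2 * e : ℕ) : ℤ) = ((2 * e * l : ℕ) : ℤ) by push_cast; ring, h2] at h1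
    rw [h1, ← pow_mul, mul_pow, ← zpow_natCast, ← zpow_natCast, ← zpow_natCast, ← zpow_natCast,
      ← zpow_mul, ← zpow_mul, ← zpow_mul, ← zpow_mul, mul_comm i, mul_comm j]

lemma dvd_exponents {s : PowerCert} {ε₁ ε₂ κ : (QuarticOrder π)ˣ}
    (h : s.ok (ε₁ : QuarticOrder π) ε₂ = true) {i j : ℤ}
    (hrel : (κ ^ (s.l : ℤ)) ^ 2 = (ε₁ ^ i * ε₂ ^ j) ^ 2) : (s.l : ℤ) ∣ i ∧ (s.l : ℤ) ∣ j := by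
  simp only [ok, Bool.and_eq_true, Nat.beq_eq, Bool.not_eq_true'] at h
  obtain ⟨⟨⟨⟨⟨⟨⟨hl, hc⟩, hd⟩, hc1⟩, hd1⟩, hc2⟩, hc3⟩, hd2⟩ := h
  have hl := prime_of_isPrimeNat hl
  have : Fact s.l.Prime := ⟨hl⟩
  have hne : ∀ {q : ℕ}, q.Prime → ∀ {a : ℕ}, (a % q).beq 1 = false → ((a % q : ℕ) : ZMod q) ≠ 1 :=
      by
    intro q hq a h h1
    rw [ZMod.natCast_mod, ← Nat.cast_one, ZMod.natCast_eq_natCast_iff', Nat.mod_eq_of_lt hq.one_lt]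
      at h1
    exact Nat.ne_of_beq_eq_false h h1
  have hi : (s.l : ℤ) ∣ i := by
    obtain ⟨u₁, u₂, h1, h2, h3, h4, h5⟩ := pow_val_eq_one hl hc hc1 hrel
    have hu2 : u₂ = 1 := by ext1; rw [h2, hc2]; simp
    rw [hu2, one_zpow, mul_one] at h5
    have hord : orderOf u₁ = s.l := orderOf_eq_prime h3 fun h => by
      rw [h, Units.val_one] at h1
      exact hne (ResidueChar.exists_hom hc).1 hc3 h1.symm
    rw [← hord]
    exact orderOf_dvd_iff_zpow_eq_one.2 h5
  refine ⟨hi, ?_⟩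
  obtain ⟨u₁, u₂, h1, h2, h3, h4, h5⟩ := pow_val_eq_one hl hd hd1 hrel
  obtain ⟨i', rfl⟩ := hi
  rw [zpow_mul, zpow_natCast, h3, one_zpow, one_mul] at h5
  have hord : orderOf u₂ = s.l := orderOf_eq_prime h4 fun h => by
    rw [h, Units.val_one] at h2
    exact hne (ResidueChar.exists_hom hd).1 hd2 h2.symm
  rw [← hord]
  exact orderOf_dvd_iff_zpow_eq_one.2 h5

end PowerCert

/-- Data about the unit group of the order of `π`: independent units with their inverses, a prime
at which the quartic is irreducible, a point where its homogenization is negative, and independence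
modulo `ℓ`-th powers. -/
structure UnitCert (π : QuarticParams) where
  e₁ : QuarticOrder π
  f₁ : QuarticOrder π
  e₂ : QuarticOrder π
  f₂ : QuarticOrder π
  q : ℕ
  t₁ : ℤ
  t₂ : ℤ
  powers : List PowerCert

namespace UnitCert

variable {π : QuarticParams}

/-- Coefficient of `X ^ 2` of the quartic. -/
def coeffTwo (π : QuarticParams) : ℤ := -(2 * π.n + π.P * π.m)

/-- Coefficient of `X` of the quartic. -/
def coeffOne (π : QuarticParams) : ℤ := -(π.Q * π.m ^ 2)

/-- Constant coefficient of the quartic. -/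
def coeffZero (π : QuarticParams) : ℤ := π.n ^ 2 + π.P * π.m * π.n - π.k * π.m ^ 2

/-- Coordinatewise test for `x = 1`. -/
def isOne (x : QuarticOrder π) : Bool :=
  decide (x.c0 = 1) && decide (x.c1 = 0) && decide (x.c2 = 0) && decide (x.c3 = 0)

lemma eq_one_of_isOne {x : QuarticOrder π} (h : isOne x = true) : x = 1 := by
  simp only [isOne, Bool.and_eq_true, decide_eq_true_eq] at h
  ext <;> simp [h]

/-- The discriminant of `X ^ 4 + p X ^ 2 + q X + r`. -/
def quarticDisc (p q r : ℤ) : ℤ :=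
  16 * p ^ 4 * r - 4 * p ^ 3 * q ^ 2 - 128 * p ^ 2 * r ^ 2 + 144 * p * q ^ 2 * r
    - 27 * q ^ 4 + 256 * r ^ 3

/-- Correctness test. -/
def ok (u : UnitCert π) : Bool :=
  isOne (u.e₁ * u.f₁) && isOne (u.e₂ * u.f₂) && decide (π.m ≠ 0) && isPrimeNat u.q &&
    (eager (coeffTwo π % u.q).toNat fun a => eager (coeffOne π % u.q).toNat fun b =>
      eager (coeffZero π % u.q).toNat fun c => irreducibleMod u.q a b c) &&
    decide (u.t₂ ≠ 0) &&
    decide (u.t₁ ^ 4 + coeffTwo π * u.t₁ ^ 2 * u.t₂ ^ 2 + coeffOne π * u.t₁ * u.t₂ ^ 3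
      + coeffZero π * u.t₂ ^ 4 < 0) &&
    decide (quarticDisc (coeffTwo π) (coeffOne π) (coeffZero π) < 0) &&
    u.powers.any (fun s => Nat.beq s.l 2) && u.powers.all fun s => s.ok u.e₁ u.e₂

variable {u : UnitCert π}

lemma irreducible_of_ok (h : u.ok = true) :
    Irreducible ((quartic π).map (Int.castRingHom ℚ)) := by
  simp only [ok, Bool.and_eq_true, eager_eq] at h
  obtain ⟨⟨⟨⟨⟨-, hq⟩, hirr⟩, -⟩, -⟩, -⟩ := h.1.1
  have hq := prime_of_isPrimeNat hq
  have : Fact u.q.Prime := ⟨hq⟩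
  have h1 := irreducible_of_irreducibleMod hirr
  rw [ResidueParams.natCast_toNat_emod hq.pos, ResidueParams.natCast_toNat_emod hq.pos,
    ResidueParams.natCast_toNat_emod hq.pos] at h1
  have h2 : Irreducible ((quartic π).map (Int.castRingHom (ZMod u.q))) := by
    convert h1 using 1
    simp only [quartic, coeffTwo, coeffOne, coeffZero, Polynomial.map_add, Polynomial.map_sub,
      Polynomial.map_mul, Polynomial.map_pow, map_X, map_C, Int.coe_castRingHom, Int.cast_neg,
          C_neg]
    ring
  have h3 := monic_quartic.irreducible_of_irreducible_map _ _ h2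
  exact (IsPrimitive.Int.irreducible_iff_irreducible_map_cast monic_quartic.isPrimitive).1 h3

lemma eval₂_quartic' {B : Type*} [CommRing B] (t : B) :
    (quartic π).eval₂ (Int.castRingHom B) t =
      t ^ 4 + coeffTwo π * t ^ 2 + coeffOne π * t + coeffZero π := by
  rw [eval₂_quartic, coeffTwo, coeffOne, coeffZero]
  push_cast
  ring

lemma exists_real_root (h : u.ok = true) :
    ∃ t : ℝ, (quartic π).eval₂ (Int.castRingHom ℝ) t = 0 := by
  simp only [ok, Bool.and_eq_true, decide_eq_true_eq] at h
  obtain ⟨⟨⟨-, ht0⟩, ht⟩, -⟩ := h.1.1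
  have hcont : Continuous fun t : ℝ => (quartic π).eval₂ (Int.castRingHom ℝ) t := by
    simp only [eval₂_quartic']
    fun_prop
  have hneg : (quartic π).eval₂ (Int.castRingHom ℝ) ((u.t₁ : ℝ) / u.t₂) < 0 := by
    have h1 : (0 : ℝ) < (u.t₂ : ℝ) ^ 4 := by
      have : (u.t₂ : ℝ) ≠ 0 := by exact_mod_cast ht0
      positivity
    rw [← mul_lt_mul_iff_left₀ h1, zero_mul, eval₂_quartic']
    have : (u.t₂ : ℝ) ≠ 0 := by exact_mod_cast ht0
    field_simp
    exact_mod_cast lt_of_eq_of_lt (by ring) ht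
  have hpos : ∃ t : ℝ, 0 < (quartic π).eval₂ (Int.castRingHom ℝ) t := by
    refine ⟨1 + |(coeffTwo π : ℝ)| + |(coeffOne π : ℝ)| + |(coeffZero π : ℝ)|, ?_⟩
    rw [eval₂_quartic']
    set a := (coeffTwo π : ℝ)
    set b := (coeffOne π : ℝ)
    set c := (coeffZero π : ℝ)
    set t := 1 + |a| + |b| + |c| with ht
    have ha := abs_nonneg a
    have hb := abs_nonneg b
    have hc := abs_nonneg c
    have h1 : 1 ≤ t := by linarith
    have h2 : -|a| * t ^ 2 ≤ a * t ^ 2 :=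
      mul_le_mul_of_nonneg_right (neg_abs_le a) (by positivity)
    have h3 : -|b| * t ≤ b * t := mul_le_mul_of_nonneg_right (neg_abs_le b) (by positivity)
    have h4 := neg_abs_le c
    have h5 : t ≤ t ^ 2 := by nlinarith
    have h6 : t ^ 2 * t ≤ t ^ 2 * t ^ 2 := mul_le_mul_of_nonneg_left h5 (by positivity)
    have h7 : |b| * t ≤ |b| * t ^ 2 := mul_le_mul_of_nonneg_left h5 hb
    have h8 : |c| ≤ |c| * t ^ 2 := by nlinarith
    have h9 : t ^ 2 * t = t ^ 2 + |a| * t ^ 2 + |b| * t ^ 2 + |c| * t ^ 2 := by rw [ht]; ring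
    nlinarith
  obtain ⟨t, hpos⟩ := hpos
  exact mem_range_of_exists_le_of_exists_ge hcont ⟨_, hneg.le⟩ ⟨t, hpos.le⟩

lemma exists_nonreal (h : u.ok = true) :
    ∃ z : ℂ, z.im ≠ 0 ∧ (quartic π).eval₂ (Int.castRingHom ℂ) z = 0 := by
  simp only [ok, Bool.and_eq_true, decide_eq_true_eq] at h
  have hd := h.1.1.2
  obtain ⟨z, hz, h0⟩ := exists_nonreal_root (p := coeffTwo π) (q := coeffOne π) (r := coeffZero π)
    (by rw [quarticDisc] at hd; exact_mod_cast hd)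
  refine ⟨z, hz, ?_⟩
  rw [eval₂_quartic']
  exact_mod_cast h0

lemma m_ne_zero (h : u.ok = true) : π.m ≠ 0 := by
  simp only [ok, Bool.and_eq_true, decide_eq_true_eq] at h
  exact h.1.1.1.1.1.1.1.2

lemma torsion (h : u.ok = true) (κ : (QuarticOrder π)ˣ) (N : ℤ) (hN : N ≠ 0) (hκ : κ ^ N = 1) :
    κ = 1 ∨ κ = -1 :=
  have ⟨_, ht⟩ := exists_real_root h
  unit_eq_one_or_neg_one (m_ne_zero h) (irreducible_of_ok h) ht hN hκ

lemma exists_units (h : u.ok = true) :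
    ∃ ε₁ ε₂ : (QuarticOrder π)ˣ, (ε₁ : QuarticOrder π) = u.e₁ ∧ (ε₂ : QuarticOrder π) = u.e₂ := by
  simp only [ok, Bool.and_eq_true] at h
  obtain ⟨h1, h2⟩ := h.1.1.1.1.1.1.1.1
  exact ⟨Units.mkOfMulEqOne _ _ (eq_one_of_isOne h1), Units.mkOfMulEqOne _ _ (eq_one_of_isOne h2),
    rfl, rfl⟩

lemma exists_relation (h : u.ok = true) {ε₁ ε₂ : (QuarticOrder π)ˣ}
    (h₁ : (ε₁ : QuarticOrder π) = u.e₁) (h₂ : (ε₂ : QuarticOrder π) = u.e₂)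
    (ω : (QuarticOrder π)ˣ) : ∃ F a b : ℤ, (∀ s ∈ u.powers, IsCoprime F (s.l : ℤ)) ∧ Odd F ∧
      (ω ^ F = ε₁ ^ a * ε₂ ^ b ∨ ω ^ F = -(ε₁ ^ a * ε₂ ^ b)) := by
  have hok := h
  simp only [ok, Bool.and_eq_true] at h
  obtain ⟨⟨-, htwo⟩, hpow⟩ := h
  rw [List.all_eq_true, ← h₁, ← h₂] at hpow
  have hprime : ∀ s ∈ u.powers, s.l.Prime := fun s hs => by
    have := hpow s hs
    simp only [PowerCert.ok, Bool.and_eq_true] at this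
    exact prime_of_isPrimeNat this.1.1.1.1.1.1.1
  obtain ⟨z, hz, hz0⟩ := exists_nonreal hok
  obtain ⟨F, a, b, hF, hrel⟩ := exists_relation_coprime (ε₁ := ε₁) (ε₂ := ε₂)
    (L := u.powers.map PowerCert.l) (torsion hok)
    (exists_unit_relation (m_ne_zero hok) (irreducible_of_ok hok) hz hz0)
    (fun ℓ hℓ => by
      obtain ⟨s, hs, rfl⟩ := List.mem_map.1 hℓ
      exact (hprime s hs).two_le)
    (fun ℓ hℓ κ i j hrel => by
      obtain ⟨s, hs, rfl⟩ := List.mem_map.1 hℓ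
      exact PowerCert.dvd_exponents (hpow s hs) hrel) ω
  have hF' : ∀ s ∈ u.powers, ¬ (s.l : ℤ) ∣ F := fun s hs => hF s.l (List.mem_map_of_mem hs)
  refine ⟨F, a, b, fun s hs => ?_, ?_, ?_⟩
  · exact ((Nat.prime_iff_prime_int.1 (hprime s hs)).coprime_iff_not_dvd.2 (hF' s hs)).symm
  · rw [List.any_eq_true] at htwo
    obtain ⟨s, hs, hs2⟩ := htwo
    have := hF' s hs
    rw [Nat.eq_of_beq_eq_true hs2] at this
    rw [← Int.not_even_iff_odd, even_iff_two_dvd]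
    exact this
  · rcases torsion hok (ω ^ F * (ε₁ ^ a * ε₂ ^ b)⁻¹) 2 two_ne_zero (by
        rw [mul_zpow, inv_zpow, mul_inv_eq_one]; exact_mod_cast hrel) with h3 | h3
    · left; exact mul_inv_eq_one.1 h3
    · right; rw [mul_inv_eq_iff_eq_mul.1 h3, neg_one_mul]

end UnitCert

end

section

open QuarticOrder

namespace QuarticOrder

variable {π : QuarticParams}

/-- Units congruent to `1` or `-1` modulo `q`. -/
def nearOne (π : QuarticParams) (q : ℕ) : Subgroup (QuarticOrder π)ˣ where
  carrier := {κ | (q : QuarticOrder π) ∣ κ - 1 ∨ (q : QuarticOrder π) ∣ κ + 1}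
  one_mem' := by simp
  mul_mem' := by
    rintro x y (⟨a, ha⟩ | ⟨a, ha⟩) (⟨b, hb⟩ | ⟨b, hb⟩)
    · left; exact ⟨x * b + a, by push_cast; linear_combination (x : QuarticOrder π) * hb + ha⟩
    · right; exact ⟨x * b - a, by push_cast; linear_combination (x : QuarticOrder π) * hb - ha⟩
    · right; exact ⟨x * b + a, by push_cast; linear_combination (x : QuarticOrder π) * hb + ha⟩
    · left; exact ⟨x * b - a, by push_cast; linear_combination (x : QuarticOrder π) * hb - ha⟩
  inv_mem' := by
    rintro x (⟨a, ha⟩ | ⟨a, ha⟩)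
    · left; exact ⟨-(x⁻¹ : (QuarticOrder π)ˣ) * a, by
        linear_combination -((x⁻¹ : (QuarticOrder π)ˣ) : QuarticOrder π) * ha + x.inv_mul⟩
    · right; exact ⟨(x⁻¹ : (QuarticOrder π)ˣ) * a, by
        linear_combination ((x⁻¹ : (QuarticOrder π)ˣ) : QuarticOrder π) * ha - x.inv_mul⟩

lemma mem_nearOne {q : ℕ} {κ : (QuarticOrder π)ˣ} : κ ∈ nearOne π q ↔
    (q : QuarticOrder π) ∣ κ - 1 ∨ (q : QuarticOrder π) ∣ κ + 1 := Iff.rfl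

lemma neg_one_mem_nearOne (q : ℕ) : (-1 : (QuarticOrder π)ˣ) ∈ nearOne π q := by
  right; simp

lemma dvd_of_mul_inv_mem_nearOne {q : ℕ} {κ μ : (QuarticOrder π)ˣ} (h : κ * μ⁻¹ ∈ nearOne π q) :
    (q : QuarticOrder π) ∣ κ - μ ∨ (q : QuarticOrder π) ∣ κ + μ := by
  rcases h with ⟨a, ha⟩ | ⟨a, ha⟩
  · left; exact ⟨μ * a, by
      rw [Units.val_mul] at ha
      linear_combination (μ : QuarticOrder π) * ha - (κ : QuarticOrder π) * μ.inv_mul⟩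
  · right; exact ⟨μ * a, by
      rw [Units.val_mul] at ha
      linear_combination (μ : QuarticOrder π) * ha - (κ : QuarticOrder π) * μ.inv_mul⟩

end QuarticOrder

lemma Subgroup.mul_inv_zpow_mem {G : Type*} [CommGroup G] (N : Subgroup G) {ω ε₁ ε₂ : G}
    {F K t a b : ℤ} {E o₁ o₂ : ℕ} (hrel : ω ^ F * (ε₁ ^ a * ε₂ ^ b)⁻¹ ∈ N) (hF : F * K = 1 + E * t)
    (hE : ω ^ E ∈ N) (h₁ : ε₁ ^ o₁ ∈ N) (h₂ : ε₂ ^ o₂ ∈ N) {i j : ℕ}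
    (hi : (o₁ : ℤ) ∣ a * K - i) (hj : (o₂ : ℤ) ∣ b * K - j) : ω * (ε₁ ^ i * ε₂ ^ j)⁻¹ ∈ N := by
  rw [← QuotientGroup.eq_one_iff] at hrel hE h₁ h₂ ⊢
  simp only [QuotientGroup.mk_mul, QuotientGroup.mk_inv, QuotientGroup.mk_zpow,
    QuotientGroup.mk_pow] at hrel hE h₁ h₂ ⊢
  rw [mul_inv_eq_one] at hrel ⊢
  obtain ⟨s, hs⟩ := hi
  obtain ⟨r, hr⟩ := hj
  have h := congrArg (· ^ K) hrel
  simp only [mul_zpow, ← zpow_mul] at h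
  rw [hF, show a * K = i + o₁ * s by linarith, show b * K = j + o₂ * r by linarith, zpow_add,
    zpow_add, zpow_add, zpow_mul, zpow_mul, zpow_mul] at h
  simpa only [zpow_one, zpow_natCast, hE, h₁, h₂, one_zpow, mul_one] using h

/-- A test on pairs of exponents known modulo `o₁` and `o₂`. -/
structure ExponentTest where
  o₁ : ℕ
  o₂ : ℕ
  alive : ℕ → ℕ → Bool

/-- No pair of exponents congruent to `(i, j)` modulo `(N₁, N₂)` passes all tests. -/
def sieve : List ExponentTest → ℕ → ℕ → ℕ → ℕ → Bool
  | [], _, _, _, _ => false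
  | t :: ts, N₁, N₂, i, j =>
    eager (Nat.lcm N₁ t.o₁) fun M₁ => eager (Nat.lcm N₂ t.o₂) fun M₂ =>
      (List.range (M₁ / N₁)).all fun a => (List.range (M₂ / N₂)).all fun b =>
        eager (i + N₁ * a) fun i' => eager (j + N₂ * b) fun j' =>
          match t.alive i' j' with
          | false => true
          | true => sieve ts M₁ M₂ i' j'

lemma exists_lift {I : ℤ} {N M i : ℕ} (hN : 0 < N) (hM : 0 < M) (hNM : N ∣ M)
    (h : (N : ℤ) ∣ I - i) (hi : i < N) :
    ∃ a < M / N, (M : ℤ) ∣ I - (i + N * a : ℕ) ∧ i + N * a < M := by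
  obtain ⟨c, rfl⟩ := hNM
  obtain ⟨s, hs⟩ := h
  have hc : 0 < c := Nat.pos_of_mul_pos_left hM
  have hc' : (0 : ℤ) < c := by exact_mod_cast hc
  have h1 : (s % c).toNat < c := by
    have := Int.emod_lt_of_pos s hc'
    omega
  refine ⟨(s % c).toNat, by rwa [Nat.mul_div_cancel_left _ hN], ⟨s / c, ?_⟩, ?_⟩
  · push_cast
    rw [Int.toNat_of_nonneg (Int.emod_nonneg _ hc'.ne')]
    linear_combination hs - (N : ℤ) * Int.emod_add_mul_ediv s c
  · nlinarith

lemma sieve_sound {I J : ℤ} : ∀ (ts : List ExponentTest) {N₁ N₂ i j : ℕ}, 0 < N₁ → 0 < N₂ →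
    (N₁ : ℤ) ∣ I - i → (N₂ : ℤ) ∣ J - j → i < N₁ → j < N₂ →
    (∀ t ∈ ts, 0 < t.o₁ ∧ 0 < t.o₂ ∧ ∀ i j : ℕ, (t.o₁ : ℤ) ∣ I - i → (t.o₂ : ℤ) ∣ J - j →
      t.alive i j = true) → sieve ts N₁ N₂ i j = false := by
  intro ts
  induction ts with
  | nil => simp [sieve]
  | cons t ts ih =>
    intro N₁ N₂ i j hN₁ hN₂ hI hJ hi hj hts
    obtain ⟨h1, h2, halive⟩ := hts t List.mem_cons_self
    have hM₁ : 0 < N₁.lcm t.o₁ := Nat.lcm_pos hN₁ h1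
    have hM₂ : 0 < N₂.lcm t.o₂ := Nat.lcm_pos hN₂ h2
    obtain ⟨a, ha, hIa, hia⟩ := exists_lift hN₁ hM₁ (Nat.dvd_lcm_left _ _) hI hi
    obtain ⟨b, hb, hJb, hjb⟩ := exists_lift hN₂ hM₂ (Nat.dvd_lcm_left _ _) hJ hj
    have hal := halive _ _ ((Int.natCast_dvd_natCast.2 (Nat.dvd_lcm_right N₁ t.o₁)).trans hIa)
      ((Int.natCast_dvd_natCast.2 (Nat.dvd_lcm_right N₂ t.o₂)).trans hJb)
    have hs := ih hM₁ hM₂ hIa hJb hia hjb fun t' ht' => hts t' (List.mem_cons_of_mem _ ht')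
    rw [← Bool.not_eq_true]
    intro hsieve
    simp only [sieve, eager_eq, List.all_eq_true, List.mem_range] at hsieve
    have := hsieve a ha b hb
    rw [hal] at this
    simp [hs] at this

/-- Sieving modulus `p ^ (k + 1)`; here `x ^ p ^ (i + j) ≡ x ^ p ^ i` modulo `p`, and `o₁, o₂` are
orders of the units up to sign. -/
structure SieveModulus where
  p : ℕ
  k : ℕ
  i : ℕ
  j : ℕ
  o₁ : ℕ
  o₂ : ℕ

namespace Residue

/-- The residue `1`. -/
def one : Residue := ⟨1, 0, 0, 0⟩

/-- Test for `1` or `-1` modulo `q`. -/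
def isSign (q : ℕ) (r : Residue) : Bool :=
  (Nat.beq (r.c0 % q) (1 % q) || Nat.beq ((r.c0 + 1) % q) 0) && Nat.beq (r.c1 % q) 0 &&
    Nat.beq (r.c2 % q) 0 && Nat.beq (r.c3 % q) 0

variable {π : QuarticParams} {q : ℕ} {r t : Residue} {x y : QuarticOrder π}

lemma one_rep : one.Rep q (1 : QuarticOrder π) := by simp [Rep, one]

lemma dvd_sub_of_same (h : r.same t = true) (hr : r.Rep q x) (ht : t.Rep q y) :
    (q : QuarticOrder π) ∣ x - y := by
  simp only [same, Bool.and_eq_true, Nat.beq_eq] at h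
  rw [natCast_dvd]
  simp [← hr.1, ← hr.2.1, ← hr.2.2.1, ← hr.2.2.2, ← ht.1, ← ht.2.1, ← ht.2.2.1, ← ht.2.2.2, h]

lemma dvd_of_isSign (h : r.isSign q = true) (hr : r.Rep q x) :
    (q : QuarticOrder π) ∣ x - 1 ∨ (q : QuarticOrder π) ∣ x + 1 := by
  simp only [isSign, Bool.and_eq_true, Bool.or_eq_true, Nat.beq_eq] at h
  obtain ⟨⟨⟨h0, h1⟩, h2⟩, h3⟩ := h
  have key : ∀ a : ℕ, a % q = 0 → (a : ZMod q) = 0 := fun a ha =>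
    (ZMod.natCast_eq_zero_iff _ _).2 (Nat.dvd_of_mod_eq_zero ha)
  rcases h0 with h0 | h0
  · left
    rw [natCast_dvd]
    have := (ZMod.natCast_eq_natCast_iff' _ _ q).2 h0
    simp [← hr.1, ← hr.2.1, ← hr.2.2.1, ← hr.2.2.2, this, key _ h1, key _ h2, key _ h3]
  · right
    rw [natCast_dvd]
    have := key _ h0
    push_cast at this
    simp [← hr.1, ← hr.2.1, ← hr.2.2.1, ← hr.2.2.2, this, key _ h1, key _ h2, key _ h3]

end Residue

namespace SieveModulus

/-- The modulus. -/
def q (M : SieveModulus) : ℕ := M.p ^ (M.k + 1)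

/-- A multiple of the exponent of the units modulo `q`. -/
def exponent (M : SieveModulus) : ℕ := M.p ^ M.i * (M.p ^ M.j - 1) * M.p ^ M.k

/-- Frobenius test on a generator. -/
def frobenius (M : SieveModulus) (C : ResidueParams) (g : Residue) : Bool :=
  (C.mulPow 60 .one g (M.p ^ (M.i + M.j))).same (C.mulPow 60 .one g (M.p ^ M.i))

variable {π : QuarticParams}

/-- Check the data in `M`, then call `f` with the parameters and units modulo `q`. -/
def run (M : SieveModulus) (e₁ e₂ : QuarticOrder π) (E : ℕ)
    (f : ResidueParams → Residue → Residue → Bool) : Bool :=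
  isPrimeNat M.p && Nat.ble 1 M.o₁ && Nat.ble 1 M.o₂ && Nat.beq (E % M.exponent) 0 &&
  (ResidueParams.ofParams π M.p fun C =>
    M.frobenius C ⟨0, 1, 0, 0⟩ && M.frobenius C ⟨0, 0, 1, 0⟩) &&
  ResidueParams.ofParams π M.q fun C => C.reduce e₁ fun r₁ => C.reduce e₂ fun r₂ =>
    (C.mulPow 12 .one r₁ M.o₁).isSign M.q && (C.mulPow 12 .one r₂ M.o₂).isSign M.q && f C r₁ r₂

/-- The facts about `M` verified by `run`. -/
structure Valid (M : SieveModulus) (ε₁ ε₂ : (QuarticOrder π)ˣ) (E : ℕ) : Prop where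
  prime : M.p.Prime
  pos₁ : 0 < M.o₁
  pos₂ : 0 < M.o₂
  mem₁ : ε₁ ^ M.o₁ ∈ nearOne π M.q
  mem₂ : ε₂ ^ M.o₂ ∈ nearOne π M.q
  pow_mem : ∀ κ : (QuarticOrder π)ˣ, κ ^ E ∈ nearOne π M.q

lemma run_spec {M : SieveModulus} {ε₁ ε₂ : (QuarticOrder π)ˣ} {E : ℕ}
    {f : ResidueParams → Residue → Residue → Bool}
    (h : M.run (ε₁ : QuarticOrder π) ε₂ E f = true) : M.Valid ε₁ ε₂ E ∧
      ∃ C r₁ r₂, C.q = M.q ∧ C.Rep π ∧ r₁.Rep M.q (ε₁ : QuarticOrder π) ∧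
        r₂.Rep M.q (ε₂ : QuarticOrder π) ∧ f C r₁ r₂ = true := by
  simp only [run, Bool.and_eq_true, Nat.ble_eq, Nat.beq_eq] at h
  obtain ⟨⟨⟨⟨⟨hp, h1⟩, h2⟩, hE⟩, hfrob⟩, h⟩ := h
  have hp := prime_of_isPrimeNat hp
  have hq : 0 < M.q := Nat.pow_pos hp.pos
  obtain ⟨C₀, hC₀q, hC₀, hC₀f⟩ := ResidueParams.ofParams_spec (π := π) hp.pos
    fun C => M.frobenius C ⟨0, 1, 0, 0⟩ && M.frobenius C ⟨0, 0, 1, 0⟩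
  obtain ⟨C, hCq, hC, hCf⟩ := ResidueParams.ofParams_spec (π := π) hq
    fun C => C.reduce (ε₁ : QuarticOrder π) fun r₁ => C.reduce (ε₂ : QuarticOrder π) fun r₂ =>
    (C.mulPow 12 .one r₁ M.o₁).isSign M.q && (C.mulPow 12 .one r₂ M.o₂).isSign M.q && f C r₁ r₂
  rw [hC₀f, Bool.and_eq_true] at hfrob
  rw [hCf] at h
  obtain ⟨r₁, hr₁, h'⟩ := ResidueParams.reduce_spec hC (ε₁ : QuarticOrder π)
    fun r₁ => C.reduce (ε₂ : QuarticOrder π) fun r₂ =>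
    (C.mulPow 12 .one r₁ M.o₁).isSign M.q && (C.mulPow 12 .one r₂ M.o₂).isSign M.q && f C r₁ r₂
  rw [h'] at h
  obtain ⟨r₂, hr₂, h'⟩ := ResidueParams.reduce_spec hC (ε₂ : QuarticOrder π) fun r₂ =>
    (C.mulPow 12 .one r₁ M.o₁).isSign M.q && (C.mulPow 12 .one r₂ M.o₂).isSign M.q && f C r₁ r₂
  rw [h', Bool.and_eq_true, Bool.and_eq_true] at h
  obtain ⟨⟨ho₁, ho₂⟩, h⟩ := h
  have hpow : ∀ (g : Residue) (x : QuarticOrder π), g.Rep C₀.q x → M.frobenius C₀ g = true →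
      (M.p : QuarticOrder π) ∣ x ^ M.p ^ (M.i + M.j) - x ^ M.p ^ M.i := by
    intro g x hg hf
    have := Residue.dvd_sub_of_same hf (ResidueParams.mulPow_spec hC₀ _ Residue.one_rep hg)
      (ResidueParams.mulPow_spec hC₀ _ Residue.one_rep hg)
    rwa [one_mul, one_mul, hC₀q] at this
  have hgen := hpow ⟨0, 1, 0, 0⟩ gen (by simp [Residue.Rep, gen]) hfrob.1
  have hsgen := hpow ⟨0, 0, 1, 0⟩ sgen (by simp [Residue.Rep, sgen]) hfrob.2
  refine ⟨⟨hp, h1, h2, ?_, ?_, fun κ => ?_⟩, C, r₁, r₂, hCq, hC, hCq ▸ hr₁, hCq ▸ hr₂, h⟩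
  · rw [mem_nearOne, Units.val_pow_eq_pow_val]
    refine Residue.dvd_of_isSign ho₁ ?_
    rw [← one_mul ((ε₁ : QuarticOrder π) ^ _), ← hCq]
    exact ResidueParams.mulPow_spec hC _ Residue.one_rep hr₁
  · rw [mem_nearOne, Units.val_pow_eq_pow_val]
    refine Residue.dvd_of_isSign ho₂ ?_
    rw [← one_mul ((ε₂ : QuarticOrder π) ^ _), ← hCq]
    exact ResidueParams.mulPow_spec hC _ Residue.one_rep hr₂
  · obtain ⟨e, he⟩ := Nat.dvd_of_mod_eq_zero hE
    rw [he, pow_mul]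
    exact pow_mem (mem_nearOne.2 (Or.inl (unit_pow_modEq_one hp hgen hsgen κ))) e

/-- The residue of `ε₁ ^ i * ε₂ ^ j`. -/
def residue (M : SieveModulus) (C : ResidueParams) (r₁ r₂ : Residue) (i j : ℕ) : Residue :=
  C.mulPow 12 (C.mulPow 12 .one r₁ (i % M.o₁)) r₂ (j % M.o₂)

/-- Test whether a residue is a combination of `1` and `α`. -/
def isLinear (q : ℕ) (r : Residue) : Bool := Nat.beq (r.c2 % q) 0 && Nat.beq (r.c3 % q) 0

/-- The test provided by `M` and a property `P` of residues. -/
def test (M : SieveModulus) (P : ℕ → Residue → Bool) (C : ResidueParams) (r₁ r₂ : Residue) :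
    ExponentTest :=
  ⟨M.o₁, M.o₂, fun i j => P M.q (M.residue C r₁ r₂ i j)⟩

lemma residue_rep {M : SieveModulus} {C : ResidueParams} {r₁ r₂ : Residue}
    {ε₁ ε₂ : (QuarticOrder π)ˣ} (hC : C.Rep π) (hCq : C.q = M.q)
    (h₁ : r₁.Rep M.q (ε₁ : QuarticOrder π)) (h₂ : r₂.Rep M.q (ε₂ : QuarticOrder π)) (i j : ℕ) :
    (M.residue C r₁ r₂ i j).Rep M.q
      ((ε₁ ^ (i % M.o₁) * ε₂ ^ (j % M.o₂) : (QuarticOrder π)ˣ) : QuarticOrder π) := by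
  rw [← hCq] at h₁ h₂ ⊢
  have := ResidueParams.mulPow_spec hC 12 (e := j % M.o₂)
    (ResidueParams.mulPow_spec hC 12 (e := i % M.o₁) Residue.one_rep h₁) h₂
  rw [one_mul] at this
  push_cast
  exact this

/-- The unit `κ` is `± ε₁ ^ I * ε₂ ^ J` modulo `M`. -/
def Match (M : SieveModulus) (ε₁ ε₂ κ : (QuarticOrder π)ˣ) (I J : ℤ) : Prop :=
  ∀ i j : ℕ, (M.o₁ : ℤ) ∣ I - i → (M.o₂ : ℤ) ∣ J - j →
    κ * (ε₁ ^ i * ε₂ ^ j)⁻¹ ∈ nearOne π M.q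

lemma dvd_sub_mod {o i : ℕ} {I : ℤ} (h : (o : ℤ) ∣ I - i) : (o : ℤ) ∣ I - (i % o : ℕ) := by
  have : (o : ℤ) ∣ i - (i % o : ℕ) := by
    rw [Int.natCast_mod]
    exact Int.dvd_self_sub_emod
  simpa using h.add this

lemma isLinear_of_rep {q : ℕ} {r : Residue} {x y : QuarticOrder π} (hr : r.Rep q x)
    (h2 : y.c2 = 0) (h3 : y.c3 = 0)
    (h : (q : QuarticOrder π) ∣ y - x ∨ (q : QuarticOrder π) ∣ y + x) : isLinear q r = true := by
  simp only [isLinear, Bool.and_eq_true, Nat.beq_eq]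
  rw [natCast_dvd, natCast_dvd] at h
  simp only [sub_c2, sub_c3, add_c2, add_c3, h2, h3, Int.cast_neg,
    zero_sub, zero_add, neg_eq_zero, ← hr.2.2.1, ← hr.2.2.2] at h
  constructor
  · exact Nat.mod_eq_zero_of_dvd ((ZMod.natCast_eq_zero_iff _ _).1 (h.elim (·.2.2.1) (·.2.2.1)))
  · exact Nat.mod_eq_zero_of_dvd ((ZMod.natCast_eq_zero_iff _ _).1 (h.elim (·.2.2.2) (·.2.2.2)))

lemma Match.dvd {M : SieveModulus} {ε₁ ε₂ κ : (QuarticOrder π)ˣ} {I J : ℤ}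
    (h : M.Match ε₁ ε₂ κ I J) {i j : ℕ} (hi : (M.o₁ : ℤ) ∣ I - i) (hj : (M.o₂ : ℤ) ∣ J - j) :
    (M.q : QuarticOrder π) ∣
      κ - ((ε₁ ^ (i % M.o₁) * ε₂ ^ (j % M.o₂) : (QuarticOrder π)ˣ) : QuarticOrder π) ∨
    (M.q : QuarticOrder π) ∣
      κ + ((ε₁ ^ (i % M.o₁) * ε₂ ^ (j % M.o₂) : (QuarticOrder π)ˣ) : QuarticOrder π) :=
  dvd_of_mul_inv_mem_nearOne (h _ _ (dvd_sub_mod hi) (dvd_sub_mod hj))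

lemma Valid.match {M : SieveModulus} {ε₁ ε₂ : (QuarticOrder π)ˣ} {E : ℕ} (h : M.Valid ε₁ ε₂ E)
    {κ : (QuarticOrder π)ˣ} {F K t a b : ℤ} (hF : F * K = 1 + E * t)
    (hrel : κ ^ F = ε₁ ^ a * ε₂ ^ b ∨ κ ^ F = -(ε₁ ^ a * ε₂ ^ b)) :
    M.Match ε₁ ε₂ κ (a * K) (b * K) := fun i j hi hj => by
  refine Subgroup.mul_inv_zpow_mem _ ?_ hF (h.pow_mem κ) h.mem₁ h.mem₂ hi hj
  rcases hrel with h1 | h1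
  · rw [h1, mul_inv_cancel]
    exact one_mem _
  · rw [h1, neg_mul, mul_inv_cancel]
    exact neg_one_mem_nearOne _

/-- Collect the tests for a list of moduli, then call `f`. -/
def runAll (P : ℕ → Residue → Bool) (e₁ e₂ : QuarticOrder π) (E : ℕ) :
    List SieveModulus → (List ExponentTest → Bool) → Bool
  | [], f => f []
  | M :: Ms, f => M.run e₁ e₂ E fun C r₁ r₂ =>
      runAll P e₁ e₂ E Ms fun ts => f (M.test P C r₁ r₂ :: ts)

lemma runAll_spec {P : ℕ → Residue → Bool} {ε₁ ε₂ κ : (QuarticOrder π)ˣ} {I J : ℤ} {E : ℕ}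
    (hP : ∀ (q : ℕ) (r : Residue) (x : QuarticOrder π), r.Rep q x →
      ((q : QuarticOrder π) ∣ κ - x ∨ (q : QuarticOrder π) ∣ κ + x) → P q r = true)
    (hM : ∀ M : SieveModulus, M.Valid ε₁ ε₂ E → M.Match ε₁ ε₂ κ I J) (Ms : List SieveModulus) :
    ∀ {f : List ExponentTest → Bool}, runAll P (ε₁ : QuarticOrder π) ε₂ E Ms f = true →
    ∃ ts, f ts = true ∧ ∀ t ∈ ts, 0 < t.o₁ ∧ 0 < t.o₂ ∧ ∀ i j : ℕ, (t.o₁ : ℤ) ∣ I - i →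
      (t.o₂ : ℤ) ∣ J - j → t.alive i j = true := by
  induction Ms with
  | nil => intro f hf; exact ⟨[], hf, by simp⟩
  | cons M Ms ih =>
    intro f hf
    obtain ⟨hv, C, r₁, r₂, hCq, hC, hr₁, hr₂, hf⟩ := run_spec hf
    obtain ⟨ts, hts, h⟩ := ih hf
    refine ⟨_, hts, fun t ht => ?_⟩
    rcases List.mem_cons.1 ht with rfl | ht
    · refine ⟨hv.pos₁, hv.pos₂, fun i j hi hj => ?_⟩
      exact hP _ _ _ (residue_rep hC hCq hr₁ hr₂ i j) ((hM M hv).dvd hi hj)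
    · exact h t ht

end SieveModulus

end

section

open QuarticOrder

/-- The quartic form attached to `π`, the norm of `u - v α`. -/
def thue (π : QuarticParams) (u v : ℤ) : ℤ :=
  u ^ 4 - (2 * π.n + π.P * π.m) * u ^ 2 * v ^ 2 - π.Q * π.m ^ 2 * u * v ^ 3 +
    (π.n ^ 2 + π.P * π.m * π.n - π.k * π.m ^ 2) * v ^ 4

namespace QuarticOrder

variable {π : QuarticParams}

/-- The element `u - v α`. -/
def lin (π : QuarticParams) (u v : ℤ) : QuarticOrder π := ⟨u, -v, 0, 0⟩

lemma exists_unit_lin {u v : ℤ} (h : thue π u v = 1) :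
    ∃ κ : (QuarticOrder π)ˣ, (κ : QuarticOrder π) = lin π u v := by
  refine ⟨Units.mkOfMulEqOne (lin π u v)
    ⟨u ^ 3 + u * v ^ 2 * π.n - (2 * π.n + π.P * π.m) * v ^ 2 * u - π.Q * π.m ^ 2 * v ^ 3,
      u ^ 2 * v + v ^ 3 * π.n - (2 * π.n + π.P * π.m) * v ^ 3, u * v ^ 2 * π.m, v ^ 3 * π.m⟩ ?_,
          rfl⟩
  rw [thue] at h
  ext <;> simp only [lin, mul_c0, mul_c1, mul_c2, mul_c3, one_c0, one_c1, one_c2, one_c3] <;>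
    first | linear_combination h | ring

end QuarticOrder

/-- The multiple `τ` of `p` in a residue of the form `1 + p τ`. -/
def Residue.tau (π : QuarticParams) (p : ℕ) (r : Residue) : QuarticOrder π :=
  ⟨(r.c0 / p : ℕ), (r.c1 / p : ℕ), (r.c2 / p : ℕ), (r.c3 / p : ℕ)⟩

/-- Test for a residue of the form `1 + p τ`. -/
def Residue.isOneAdd (p : ℕ) (r : Residue) : Bool :=
  Nat.beq (r.c0 % p) 1 && Nat.beq (r.c1 % p) 0 && Nat.beq (r.c2 % p) 0 && Nat.beq (r.c3 % p) 0

lemma Residue.isOneAdd_spec {π : QuarticParams} {p : ℕ} {r : Residue} {κ : (QuarticOrder π)ˣ}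
    (h : r.isOneAdd p = true) (hr : r.Rep (p ^ 2) (κ : QuarticOrder π)) :
    IsOneAdd p 1 (r.tau π p) κ := by
  simp only [isOneAdd, Bool.and_eq_true, Nat.beq_eq] at h
  obtain ⟨⟨⟨h0, h1⟩, h2⟩, h3⟩ := h
  obtain ⟨hr0, hr1, hr2, hr3⟩ := hr
  rw [IsOneAdd, pow_one, ← Nat.cast_pow, natCast_dvd]
  have key : ∀ a b : ℕ, p * (a / p) + b = a → (a : ZMod (p ^ 2)) = p * (a / p : ℕ) + b :=
    fun a b h => by rw [← Nat.cast_mul, ← Nat.cast_add, h]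
  simp only [sub_c0, sub_c1, sub_c2, sub_c3, one_c0, one_c1, one_c2, one_c3, natCast_mul_c0,
    natCast_mul_c1, natCast_mul_c2, natCast_mul_c3, tau, Int.cast_sub, Int.cast_mul,
    Int.cast_natCast, Int.cast_one, Int.cast_zero, ← hr0, ← hr1, ← hr2, ← hr3]
  refine ⟨?_, ?_, ?_, ?_⟩
  · linear_combination key _ 1 (h0 ▸ Nat.div_add_mod r.c0 p) + (Nat.cast_one (R := ZMod (p ^ 2)))
  · linear_combination key _ 0 (h1 ▸ Nat.div_add_mod r.c1 p) + (Nat.cast_zero (R := ZMod (p ^ 2)))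
  · linear_combination key _ 0 (h2 ▸ Nat.div_add_mod r.c2 p) + (Nat.cast_zero (R := ZMod (p ^ 2)))
  · linear_combination key _ 0 (h3 ▸ Nat.div_add_mod r.c3 p) + (Nat.cast_zero (R := ZMod (p ^ 2)))

namespace UnitCert

variable {π : QuarticParams}

/-- A product of powers of the primes in the certificate. -/
def exponent (u : UnitCert π) : ℕ := (u.powers.map PowerCert.l).prod ^ 64

lemma exists_inverse {u : UnitCert π} {F : ℤ} (h : ∀ c ∈ u.powers, IsCoprime F (c.l : ℤ)) :
    ∃ K t : ℤ, F * K = 1 + u.exponent * t := by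
  have h1 : IsCoprime F ((u.powers.map PowerCert.l).prod : ℤ) := by
    revert h
    generalize u.powers = l
    induction l with
    | nil => simp [isCoprime_one_right]
    | cons c l ih =>
      intro h
      simp only [List.map_cons, List.prod_cons, Nat.cast_mul]
      exact (h c List.mem_cons_self).mul_right (ih fun c' hc' => h c' (List.mem_cons_of_mem _ hc'))
  obtain ⟨a, b, hab⟩ := h1.pow_right (n := 64)
  refine ⟨a, -b, ?_⟩
  rw [exponent, Nat.cast_pow]
  linear_combination hab

end UnitCert

/-- Data determining the solutions of a quartic Thue equation. -/
structure ThueCert (π : QuarticParams) where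
  units : UnitCert π
  moduli : List SieveModulus
  last : SieveModulus
  sols : List (ℤ × ℤ)

namespace ThueCert

variable {π : QuarticParams}

/-- Test for congruence to a known solution up to sign. -/
def known (sols : List (ℤ × ℤ)) (q : ℕ) (r : Residue) : Bool :=
  sols.any fun s =>
    (decide ((r.c0 - s.1) % (q : ℤ) = 0) && decide ((r.c1 + s.2) % (q : ℤ) = 0)) ||
      (decide ((r.c0 + s.1) % (q : ℤ) = 0) && decide ((r.c1 - s.2) % (q : ℤ) = 0))

/-- The pairs of exponents which do not come from a known solution. -/
def lastTest (s : ThueCert π) (C : ResidueParams) (r₁ r₂ : Residue) : ExponentTest :=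
  ⟨s.last.o₁, s.last.o₂, fun i j =>
    SieveModulus.isLinear s.last.q (s.last.residue C r₁ r₂ i j) &&
      !known s.sols s.last.q (s.last.residue C r₁ r₂ i j)⟩

/-- The determinant of the logarithmic derivatives is nonzero at each known solution. -/
def independent (s : ThueCert π) (τ₁ τ₂ : QuarticOrder π) : Bool :=
  s.sols.all fun w =>
    decide (((lin π w.1 w.2 * τ₁).c2 * (lin π w.1 w.2 * τ₂).c3 -
      (lin π w.1 w.2 * τ₁).c3 * (lin π w.1 w.2 * τ₂).c2) % (s.last.p : ℤ) ≠ 0)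

/-- Test that Skolem's method applies at each known solution. -/
def skolem (s : ThueCert π) : Bool :=
  ResidueParams.ofParams π (s.last.p ^ 2) fun C =>
    C.reduce s.units.e₁ fun r₁ => C.reduce s.units.e₂ fun r₂ =>
    (C.mulPow 12 .one r₁ (2 * s.last.o₁)).isOneAdd s.last.p &&
    (C.mulPow 12 .one r₂ (2 * s.last.o₂)).isOneAdd s.last.p &&
    s.independent ((C.mulPow 12 .one r₁ (2 * s.last.o₁)).tau π s.last.p)
      ((C.mulPow 12 .one r₂ (2 * s.last.o₂)).tau π s.last.p)


/-- Correctness test. -/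
def ok (s : ThueCert π) : Bool :=
  s.units.ok && (s.sols.all fun w => decide (thue π w.1 w.2 = 1)) && Nat.beq s.last.k 0 &&
    Nat.beq (s.last.p % 2) 1 && s.skolem &&
    SieveModulus.runAll SieveModulus.isLinear s.units.e₁ s.units.e₂ s.units.exponent s.moduli fun ts =>
      s.last.run s.units.e₁ s.units.e₂ s.units.exponent fun C r₁ r₂ =>
        sieve (ts ++ [s.lastTest C r₁ r₂]) 1 1 0 0

variable {s : ThueCert π}

lemma exists_of_known {sols : List (ℤ × ℤ)} {q : ℕ} {r : Residue} {x : QuarticOrder π}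
    (hr : r.Rep q x) (hlin : SieveModulus.isLinear q r = true) (h : known sols q r = true) :
    ∃ w ∈ sols, (q : QuarticOrder π) ∣ x - lin π w.1 w.2 ∨
      (q : QuarticOrder π) ∣ x + lin π w.1 w.2 := by
  simp only [known, List.any_eq_true, Bool.or_eq_true, Bool.and_eq_true, decide_eq_true_eq] at h
  simp only [SieveModulus.isLinear, Bool.and_eq_true, Nat.beq_eq] at hlin
  obtain ⟨w, hw, h⟩ := h
  have h2 : (x.c2 : ZMod q) = 0 := by
    rw [← hr.2.2.1, ZMod.natCast_eq_zero_iff]; exact Nat.dvd_of_mod_eq_zero hlin.1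
  have h3 : (x.c3 : ZMod q) = 0 := by
    rw [← hr.2.2.2, ZMod.natCast_eq_zero_iff]; exact Nat.dvd_of_mod_eq_zero hlin.2
  have key : ∀ z : ℤ, z % q = 0 → (z : ZMod q) = 0 := fun z hz =>
    (ZMod.intCast_zmod_eq_zero_iff_dvd _ _).2 (Int.dvd_of_emod_eq_zero hz)
  refine ⟨w, hw, h.imp ?_ ?_⟩ <;>
  · rintro ⟨h0, h1⟩
    have h0 := key _ h0
    have h1 := key _ h1
    push_cast at h0 h1
    rw [hr.1] at h0
    rw [hr.2.1] at h1
    rw [natCast_dvd]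
    simp only [lin, sub_c0, sub_c1, sub_c2, sub_c3, add_c0, add_c1, add_c2, add_c3]
    push_cast
    exact ⟨by linear_combination h0, by linear_combination h1, by linear_combination h2,
      by linear_combination h3⟩

lemma exists_known {κ : (QuarticOrder π)ˣ} {ε₁ ε₂ : (QuarticOrder π)ˣ} (h : s.ok = true)
    (h₁ : (ε₁ : QuarticOrder π) = s.units.e₁) (h₂ : (ε₂ : QuarticOrder π) = s.units.e₂)
    (hκ₂ : (κ : QuarticOrder π).c2 = 0) (hκ₃ : (κ : QuarticOrder π).c3 = 0) :
    s.last.Valid ε₁ ε₂ s.units.exponent ∧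
    ∃ w ∈ s.sols, (s.last.p : QuarticOrder π) ∣ κ - lin π w.1 w.2 ∨
      (s.last.p : QuarticOrder π) ∣ κ + lin π w.1 w.2 := by
  simp only [ok, Bool.and_eq_true, Nat.beq_eq] at h
  obtain ⟨⟨⟨⟨⟨hu, -⟩, hk⟩, -⟩, -⟩, h⟩ := h
  obtain ⟨F, a, b, hF, -, hrel⟩ := s.units.exists_relation hu h₁ h₂ κ
  obtain ⟨K, t, hFK⟩ := UnitCert.exists_inverse hF
  have hM : ∀ M : SieveModulus, M.Valid ε₁ ε₂ s.units.exponent →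
      M.Match ε₁ ε₂ κ (a * K) (b * K) := fun M hM => hM.match hFK hrel
  rw [← h₁, ← h₂] at h
  obtain ⟨ts, h, hts⟩ := SieveModulus.runAll_spec
    (fun _ _ _ hr => SieveModulus.isLinear_of_rep hr hκ₂ hκ₃) hM _ h
  obtain ⟨hv, C, r₁, r₂, hCq, hC, hr₁, hr₂, h⟩ := SieveModulus.run_spec h
  refine ⟨hv, ?_⟩
  by_contra! hno
  rw [sieve_sound (I := a * K) (J := b * K) _ one_pos one_pos (by simp) (by simp) one_pos one_pos]
    at h
  · exact absurd h (by simp)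
  intro t' ht'
  rcases List.mem_append.1 ht' with ht' | ht'
  · exact hts t' ht'
  obtain rfl := List.mem_singleton.1 ht'
  refine ⟨hv.pos₁, hv.pos₂, fun i j hi hj => ?_⟩
  have hd := (hM _ hv).dvd hi hj
  have hrep := SieveModulus.residue_rep hC hCq hr₁ hr₂ i j
  simp only [lastTest, Bool.and_eq_true, Bool.not_eq_true']
  have hlin := SieveModulus.isLinear_of_rep hrep hκ₂ hκ₃ hd
  refine ⟨hlin, ?_⟩
  rw [Bool.eq_false_iff]
  intro hkn
  obtain ⟨w, hw, hx⟩ := exists_of_known hrep hlin hkn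
  rw [SieveModulus.q, hk, zero_add, pow_one] at hd hx
  have := hno w hw
  rcases hd with hd | hd <;> rcases hx with hx | hx
  · exact this.1 (by convert hd.add hx using 1; ring)
  · exact this.2 (by convert hd.add hx using 1; ring)
  · exact this.2 (by convert hd.sub hx using 1; ring)
  · exact this.1 (by convert hd.sub hx using 1; ring)

lemma odd_last (h : s.ok = true) : Odd s.last.p := by
  simp only [ok, Bool.and_eq_true, Nat.beq_eq] at h
  exact Nat.odd_iff.2 h.1.1.2

lemma skolem_spec {ε₁ ε₂ : (QuarticOrder π)ˣ} (h : s.ok = true) (hp : s.last.p.Prime)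
    (h₁ : (ε₁ : QuarticOrder π) = s.units.e₁) (h₂ : (ε₂ : QuarticOrder π) = s.units.e₂) :
    ∃ τ₁ τ₂, IsOneAdd s.last.p 1 τ₁ (ε₁ ^ (2 * s.last.o₁)) ∧
      IsOneAdd s.last.p 1 τ₂ (ε₂ ^ (2 * s.last.o₂)) ∧ s.independent τ₁ τ₂ = true := by
  simp only [ok, Bool.and_eq_true] at h
  have h := h.1.2
  rw [skolem] at h
  obtain ⟨C, hCq, hC, hCf⟩ := ResidueParams.ofParams_spec (π := π) (Nat.pow_pos hp.pos) _
  rw [hCf] at h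
  obtain ⟨r₁, hr₁, hf⟩ := ResidueParams.reduce_spec hC s.units.e₁ _
  rw [hf] at h
  obtain ⟨r₂, hr₂, hf⟩ := ResidueParams.reduce_spec hC s.units.e₂ _
  rw [hf] at h
  simp only [Bool.and_eq_true] at h
  rw [← h₁] at hr₁
  rw [← h₂] at hr₂
  refine ⟨_, _, Residue.isOneAdd_spec h.1.1 ?_, Residue.isOneAdd_spec h.1.2 ?_, h.2⟩
  · rw [← hCq, Units.val_pow_eq_pow_val, ← one_mul ((ε₁ : QuarticOrder π) ^ _)]
    exact ResidueParams.mulPow_spec hC _ Residue.one_rep hr₁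
  · rw [← hCq, Units.val_pow_eq_pow_val, ← one_mul ((ε₂ : QuarticOrder π) ^ _)]
    exact ResidueParams.mulPow_spec hC _ Residue.one_rep hr₂

lemma eq_of_dvd {κ μ ε₁ ε₂ : (QuarticOrder π)ˣ} {w : ℤ × ℤ} (h : s.ok = true)
    (hv : s.last.Valid ε₁ ε₂ s.units.exponent)
    (h₁ : (ε₁ : QuarticOrder π) = s.units.e₁) (h₂ : (ε₂ : QuarticOrder π) = s.units.e₂)
    (hκ₂ : (κ : QuarticOrder π).c2 = 0) (hκ₃ : (κ : QuarticOrder π).c3 = 0) (hw : w ∈ s.sols)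
    (hμ : (μ : QuarticOrder π) = lin π w.1 w.2) (hd : (s.last.p : QuarticOrder π) ∣ κ - μ) :
    κ = μ := by
  have hu : s.units.ok = true := by
    simp only [ok, Bool.and_eq_true] at h
    exact h.1.1.1.1.1
  obtain ⟨τ₁, τ₂, hA, hB, hind⟩ := skolem_spec h hv.prime h₁ h₂
  obtain ⟨F, a, b, -, hF, hrel⟩ := s.units.exists_relation hu h₁ h₂ (κ * μ⁻¹)
  have hmul : (μ : QuarticOrder π) * (((κ * μ⁻¹ : (QuarticOrder π)ˣ) : QuarticOrder π) - 1) =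
      κ - μ := by
    rw [Units.val_mul]
    linear_combination (κ : QuarticOrder π) * μ.mul_inv
  refine mul_inv_eq_one.1 (eq_one_of_skolem (η := (μ : QuarticOrder π)) (a := a * s.last.o₂)
    (b := b * s.last.o₁) (F := F * (2 * s.last.o₁ * s.last.o₂)) hv.prime (odd_last h)
    (s.units.torsion hu) hA hB ?_ ?_ ?_ ?_ ?_ ?_)
  · rw [← (Units.isUnit μ).dvd_mul_left, hmul]
    exact hd
  · rw [hmul, hμ]
    simp [lin, hκ₂]
  · rw [hmul, hμ]
    simp [lin, hκ₃]
  · have hdet := List.all_eq_true.1 hind w hw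
    rw [decide_eq_true_eq, ← hμ] at hdet
    have hdet' : ¬ (s.last.p : ℤ) ∣ _ := fun hd => hdet (Int.emod_eq_zero_of_dvd hd)
    have hpp := Nat.prime_iff_prime_int.1 hv.prime
    intro x y hx hy
    have e : (μ : QuarticOrder π) * (x * τ₁ + y * τ₂) =
        x * (μ * τ₁) + y * (μ * τ₂) := by ring
    rw [e] at hx hy
    simp only [add_c2, add_c3, intCast_mul_c2, intCast_mul_c3] at hx hy
    constructor
    · refine (hpp.dvd_or_dvd ?_).resolve_right hdet'
      convert (hx.mul_right (μ * τ₂ : QuarticOrder π).c3).sub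
        (hy.mul_right (μ * τ₂ : QuarticOrder π).c2) using 1
      ring
    · refine (hpp.dvd_or_dvd ?_).resolve_right hdet'
      convert (hy.mul_right (μ * τ₁ : QuarticOrder π).c2).sub
        (hx.mul_right (μ * τ₁ : QuarticOrder π).c3) using 1
      ring
  · have h0 : F ≠ 0 := by rintro rfl; simp at hF
    have := hv.pos₁
    have := hv.pos₂
    positivity
  · have hsq : ((κ * μ⁻¹) ^ F) ^ (2 : ℤ) = (ε₁ ^ a * ε₂ ^ b) ^ (2 : ℤ) := by
      rcases hrel with h | h <;> rw [h]
      exact Even.neg_zpow even_two _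
    rw [show F * (2 * s.last.o₁ * s.last.o₂) = F * (2 * (s.last.o₁ * s.last.o₂)) by ring, zpow_mul,
      zpow_mul, hsq, ← zpow_mul, mul_zpow, ← zpow_mul, ← zpow_mul, ← zpow_natCast, ← zpow_natCast,
      ← zpow_mul, ← zpow_mul]
    push_cast
    congr 2 <;> ring

theorem mem_sols {u v : ℤ} (h : s.ok = true) (huv : thue π u v = 1) :
    (u, v) ∈ s.sols ∨ (-u, -v) ∈ s.sols := by
  obtain ⟨κ, hκ⟩ := exists_unit_lin huv
  obtain ⟨ε₁, ε₂, h₁, h₂⟩ := s.units.exists_units (by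
    simp only [ok, Bool.and_eq_true] at h; exact h.1.1.1.1.1)
  have hκ₂ : (κ : QuarticOrder π).c2 = 0 := by rw [hκ]; rfl
  have hκ₃ : (κ : QuarticOrder π).c3 = 0 := by rw [hκ]; rfl
  obtain ⟨hv, w, hw, hd⟩ := exists_known h h₁ h₂ hκ₂ hκ₃
  have hthue : thue π w.1 w.2 = 1 := by
    simp only [ok, Bool.and_eq_true, List.all_eq_true, decide_eq_true_eq] at h
    exact h.1.1.1.1.2 w hw
  obtain ⟨μ, hμ⟩ := exists_unit_lin hthue
  rw [← hμ] at hd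
  rcases hd with hd | hd
  · left
    have := congrArg Units.val (eq_of_dvd h hv h₁ h₂ hκ₂ hκ₃ hw hμ hd)
    rw [hκ, hμ] at this
    simp only [lin, QuarticOrder.mk.injEq, neg_inj] at this
    rwa [show (u, v) = w from Prod.ext this.1 this.2.1]
  · right
    have := congrArg Units.val (eq_of_dvd (κ := -κ) h hv h₁ h₂ (by simp [hκ₂]) (by simp [hκ₃]) hw hμ
      (by rw [← dvd_neg]; convert hd using 1; push_cast; ring))
    rw [Units.val_neg, hκ, hμ] at this
    have h0 := congrArg QuarticOrder.c0 this
    have h1 := congrArg QuarticOrder.c1 this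
    simp only [lin, neg_c0, neg_c1, neg_neg] at h0 h1
    rwa [show (-u, -v) = w from Prod.ext h0 (by linarith)]

end ThueCert

end

section

open QuarticOrder

lemma mul_mul_sq_mul_sq {G : Type*} [CommMonoid G] (s x y p q r : G) :
    s * (x * p ^ 2 * (y * q ^ 2)) * r ^ 2 = s * (x * y) * (p * q * r) ^ 2 := by
  simp only [mul_pow]
  ac_rfl

lemma eq_mul_sq_of_zpow_eq {G : Type*} [CommGroup G] {x s p q : G} {f a b : ℤ} {i j : ℕ}
    (h : x ^ (2 * f + 1) = s * (p ^ (2 * a + i) * q ^ (2 * b + j))) :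
    x = s * (p ^ i * q ^ j) * (p ^ a * q ^ b * x ^ (-f)) ^ (2 : ℕ) := by
  have e : x = x ^ (2 * f + 1) * (x ^ (-f)) ^ (2 : ℕ) := by
    rw [← zpow_natCast (x ^ (-f)), ← zpow_mul, ← zpow_add]
    nth_rewrite 1 [← zpow_one x]
    congr 1
    push_cast
    ring
  have e' : ∀ (y : G) (c : ℤ) (k : ℕ), y ^ (2 * c + k) = y ^ k * (y ^ c) ^ (2 : ℕ) :=
      fun y c k => by
    rw [zpow_add, zpow_natCast, mul_comm (2 : ℤ), zpow_mul, mul_comm, zpow_ofNat]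
  nth_rewrite 1 [e]
  rw [h, e', e']
  exact mul_mul_sq_mul_sq _ _ _ _ _ _

namespace QuarticOrder

variable {π : QuarticParams}

lemma intCast_add_mul_gen_add_mul_sgen (a b c : ℤ) :
    (a : QuarticOrder π) + (b : QuarticOrder π) * gen + (c : QuarticOrder π) * sgen =
      ⟨a, b, c, 0⟩ := by
  ext <;> simp [gen, sgen, mul_c0, mul_c1, mul_c2, mul_c3]

/-- If `thue π (3 u) v = 9` and `3` is suitably ramified, then three times a unit is a square. -/
lemma exists_unit_three_mul_eq_sq {m n M u v : ℤ} (hm : π.m = 3 * m) (hn : π.n = 3 * n)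
    (hM : 2 * n + π.P * m = 3 * M) (h : thue π (3 * u) v = 9) :
    ∃ (η : (QuarticOrder π)ˣ) (β : QuarticOrder π), 3 * (η : QuarticOrder π) = β ^ 2 ∧
      (η : QuarticOrder π).c0 = 3 * u ^ 2 + n * v ^ 2 ∧ (η : QuarticOrder π).c1 = -(2 * u * v) ∧
      (η : QuarticOrder π).c2 = m * v ^ 2 ∧ (η : QuarticOrder π).c3 = 0 := by
  set α : QuarticOrder π := gen with hα
  set w : QuarticOrder π := m * (sgen : QuarticOrder π) + n with hw
  have hα2 : α ^ 2 = 3 * w := by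
    rw [hα, gen_sq, hm, hn, hw]
    push_cast
    ring
  have hMc : (2 * n + π.P * m : QuarticOrder π) = 3 * M := by exact_mod_cast congrArg Int.cast hM
  have hw2 : w ^ 2 = 3 * M * w + m ^ 2 * π.Q * α - (n ^ 2 + π.P * m * n - π.k * m ^ 2) := by
    have hs := sgen_sq (π := π)
    rw [hw, hα]
    linear_combination (m : QuarticOrder π) ^ 2 * hs + (m * sgen + n) * hMc
  have hE : 9 * u ^ 4 - 9 * M * u ^ 2 * v ^ 2 - 3 * (m ^ 2 * π.Q) * u * v ^ 3 +
      (n ^ 2 + π.P * m * n - π.k * m ^ 2) * v ^ 4 = 1 := by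
    rw [thue, hm, hn] at h
    have h9 : (9 : ℤ) ≠ 0 := by norm_num
    apply mul_left_cancel₀ h9
    linear_combination h + 27 * u ^ 2 * v ^ 2 * hM
  have hEc : (9 * u ^ 4 - 9 * M * u ^ 2 * v ^ 2 - 3 * (m ^ 2 * π.Q) * u * v ^ 3 +
      (n ^ 2 + π.P * m * n - π.k * m ^ 2) * v ^ 4 : QuarticOrder π) = 1 := by
    exact_mod_cast congrArg Int.cast hE
  set A : QuarticOrder π := 3 * u ^ 3 + u ^ 2 * v * α + u * v ^ 2 * w - M * v ^ 2 * (3 * u + v * α)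
    - m ^ 2 * π.Q * v ^ 3 with hA
  set B : QuarticOrder π := v ^ 3 * w with hB
  have hcof : (3 * u - v * α) * (3 * A + B * α) = 3 := by
    rw [hA, hB]
    linear_combination (-3 * u ^ 2 * v ^ 2 + 3 * M * v ^ 4 - v ^ 4 * w) * hα2 - 3 * v ^ 4 * hw2
      + 3 * hEc
  have hone : (3 * u ^ 2 - 2 * u * v * α + v ^ 2 * w) * (3 * A ^ 2 + 2 * A * B * α + B ^ 2 * w) =
      1 := by
    refine natCast_mul_left_cancel (n := 9) (by norm_num) ?_
    push_cast
    linear_combination ((3 * u - v * α) * (3 * A + B * α) + 3) * hcof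
      - v ^ 2 * (3 * A + B * α) ^ 2 * hα2
      - B ^ 2 * (9 * u ^ 2 - 6 * u * v * α + 3 * v ^ 2 * w) * hα2
  have hη : 3 * u ^ 2 - 2 * u * v * α + v ^ 2 * w =
      (⟨3 * u ^ 2 + n * v ^ 2, -(2 * u * v), m * v ^ 2, 0⟩ : QuarticOrder π) := by
    rw [← intCast_add_mul_gen_add_mul_sgen, hw, hα]
    push_cast
    ring
  obtain ⟨η, hη'⟩ : ∃ η : (QuarticOrder π)ˣ, (η : QuarticOrder π) =
      3 * u ^ 2 - 2 * u * v * α + v ^ 2 * w := ⟨Units.mkOfMulEqOne _ _ hone, rfl⟩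
  refine ⟨η, 3 * u - v * α, ?_, ?_⟩
  · rw [hη']
    linear_combination -v ^ 2 * hα2
  · rw [hη', hη]
    exact ⟨rfl, rfl, rfl, rfl⟩

end QuarticOrder

namespace ResidueChar

variable {π : QuarticParams}

/-- Test that `3 σ ε₁ ^ i ε₂ ^ j` maps to a nonresidue. -/
def isNonresidue (c : ResidueChar) (e₁ e₂ : QuarticOrder π) (σ : ℤ) (i j : ℕ) : Bool :=
  c.ok π && Nat.ble 5 c.q &&
    decide ((3 * σ * c.val e₁ ^ i * c.val e₂ ^ j) ^ (c.q / 2) % (c.q : ℤ) ≠ 1)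

lemma not_isNonresidue {c : ResidueChar} {ε₁ ε₂ : (QuarticOrder π)ˣ} {β : QuarticOrder π} {σ : ℤ}
    (hσ : σ = 1 ∨ σ = -1) {i j : ℕ} {κ : (QuarticOrder π)ˣ}
    (h : 3 * σ * (ε₁ ^ i * ε₂ ^ j * κ ^ 2 : QuarticOrder π) = β ^ 2) :
    c.isNonresidue (ε₁ : QuarticOrder π) ε₂ σ i j = false := by
  rw [Bool.eq_false_iff]
  intro hc
  simp only [isNonresidue, Bool.and_eq_true, Nat.ble_eq, decide_eq_true_eq] at hc
  obtain ⟨⟨hok, hq5⟩, hne⟩ := hc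
  obtain ⟨hq, φ, hφ⟩ := exists_hom hok
  have := Fact.mk hq
  apply hne
  have hsq : (3 * σ * φ ε₁ ^ i * φ ε₂ ^ j : ZMod c.q) * φ κ ^ 2 = φ β ^ 2 := by
    rw [← map_pow φ β, ← h]
    simp only [map_mul, map_pow, map_intCast, map_ofNat]
    ring
  have hu : ∀ ε : (QuarticOrder π)ˣ, φ ε ≠ 0 := fun ε => (ε.isUnit.map φ).ne_zero
  have h3 : (3 : ZMod c.q) ≠ 0 := by
    intro h
    have : ((3 : ℕ) : ZMod c.q) = 0 := by exact_mod_cast h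
    rw [ZMod.natCast_eq_zero_iff] at this
    have := Nat.le_of_dvd (by norm_num) this
    omega
  have hσ0 : (σ : ZMod c.q) ≠ 0 := by rcases hσ with rfl | rfl <;> simp
  have hne : (3 * σ * φ ε₁ ^ i * φ ε₂ ^ j : ZMod c.q) ≠ 0 :=
    mul_ne_zero (mul_ne_zero (mul_ne_zero h3 hσ0) (pow_ne_zero _ (hu _))) (pow_ne_zero _ (hu _))
  have hpow : (3 * σ * φ ε₁ ^ i * φ ε₂ ^ j : ZMod c.q) ^ (c.q / 2) = 1 := by
    rw [← ZMod.euler_criterion _ hne]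
    refine ⟨φ β * (φ κ)⁻¹, ?_⟩
    have := hu κ
    field_simp
    linear_combination hsq
  rw [hφ, hφ] at hpow
  have hpow' : (((3 * σ * c.val (ε₁ : QuarticOrder π) ^ i * c.val (ε₂ : QuarticOrder π) ^ j)
      ^ (c.q / 2) : ℤ) : ZMod c.q) = (1 : ℤ) := by
    push_cast
    exact hpow
  rw [ZMod.intCast_eq_intCast_iff, Int.ModEq] at hpow'
  rw [hpow']
  exact Int.emod_eq_of_lt (by norm_num) (by omega)

end ResidueChar

/-- A necessary condition for a residue to be that of an element of the form
`3 u ^ 2 - 2 u v α + v ^ 2 (m s + n)` up to sign. -/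
def SieveModulus.isQuadric (m n : ℤ) (q : ℕ) (r : Residue) : Bool :=
  Nat.beq (r.c3 % q) 0 &&
    decide ((3 * m ^ 2 * r.c1 ^ 2 - 4 * (m * r.c0 - n * r.c2) * r.c2) % (q : ℤ) = 0)

lemma SieveModulus.isQuadric_of_rep {π : QuarticParams} {m n u v : ℤ} {q : ℕ} {r : Residue}
    {x y : QuarticOrder π} (hr : r.Rep q x) (h0 : y.c0 = 3 * u ^ 2 + n * v ^ 2)
    (h1 : y.c1 = -(2 * u * v)) (h2 : y.c2 = m * v ^ 2) (h3 : y.c3 = 0)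
    (h : (q : QuarticOrder π) ∣ y - x ∨ (q : QuarticOrder π) ∣ y + x) :
    isQuadric m n q r = true := by
  obtain ⟨r0, r1, r2, r3⟩ := hr
  simp only [isQuadric, Bool.and_eq_true, Nat.beq_eq, decide_eq_true_eq]
  rw [natCast_dvd, natCast_dvd] at h
  simp only [sub_c0, sub_c1, sub_c2, sub_c3, add_c0, add_c1, add_c2, add_c3, h0, h1, h2, h3,
    Int.cast_sub, Int.cast_add, Int.cast_mul, Int.cast_pow, Int.cast_neg, Int.cast_ofNat,
    Int.cast_zero, ← r0, ← r1, ← r2, ← r3] at h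
  constructor
  · refine Nat.mod_eq_zero_of_dvd ((ZMod.natCast_eq_zero_iff _ _).1 ?_)
    rcases h with ⟨-, -, -, h⟩ | ⟨-, -, -, h⟩ <;> simpa using h
  · refine Int.emod_eq_zero_of_dvd ((ZMod.intCast_zmod_eq_zero_iff_dvd _ _).1 ?_)
    push_cast
    rcases h with ⟨e0, e1, e2, -⟩ | ⟨e0, e1, e2, -⟩
    · rw [← sub_eq_zero.1 e0, ← sub_eq_zero.1 e1, ← sub_eq_zero.1 e2]
      ring
    · rw [← neg_eq_of_add_eq_zero_right e0, ← neg_eq_of_add_eq_zero_right e1,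
        ← neg_eq_of_add_eq_zero_right e2]
      ring

/-- Data showing that `thue π (3 u) v = 9` has no solutions. -/
structure SquareCert (π : QuarticParams) where
  units : UnitCert π
  chars : List ResidueChar
  i : ℕ
  j : ℕ
  moduli : List SieveModulus

namespace SquareCert

variable {π : QuarticParams}

/-- Test that `3 σ ε₁ ^ i ε₂ ^ j` is not a square outside one parity class of `(i, j)`. -/
def parity (s : SquareCert π) : Bool :=
  [(1 : ℤ), -1].all fun σ => [0, 1].all fun i => [0, 1].all fun j =>
    (Nat.beq i s.i && Nat.beq j s.j) ||
      s.chars.any fun c => c.isNonresidue s.units.e₁ s.units.e₂ σ i j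

/-- Correctness test. -/
def ok (s : SquareCert π) : Bool :=
  s.units.ok && decide (π.m % 3 = 0) && decide (π.n % 3 = 0) &&
    decide ((2 * (π.n / 3) + π.P * (π.m / 3)) % 3 = 0) && Nat.beq (s.units.exponent % 2) 0 &&
    s.parity &&
    SieveModulus.runAll (SieveModulus.isQuadric (π.m / 3) (π.n / 3)) s.units.e₁ s.units.e₂
      s.units.exponent s.moduli fun ts => sieve ts 2 2 s.i s.j

variable {s : SquareCert π}

lemma exists_parity (a : ℤ) : ∃ i ∈ [0, 1], ∃ a' : ℤ, a = 2 * a' + (i : ℕ) := by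
  rcases Int.even_or_odd' a with ⟨c, hc | hc⟩
  · exact ⟨0, by simp, c, by simp [hc]⟩
  · exact ⟨1, by simp, c, by simp [hc]⟩

lemma parity_spec {η ε₁ ε₂ : (QuarticOrder π)ˣ} {β : QuarticOrder π} {F a b : ℤ}
    (h : s.parity = true) (h₁ : (ε₁ : QuarticOrder π) = s.units.e₁)
    (h₂ : (ε₂ : QuarticOrder π) = s.units.e₂) (hηβ : 3 * (η : QuarticOrder π) = β ^ 2)
    (hF : Odd F) (hrel : η ^ F = ε₁ ^ a * ε₂ ^ b ∨ η ^ F = -(ε₁ ^ a * ε₂ ^ b)) :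
    s.i < 2 ∧ s.j < 2 ∧ (2 : ℤ) ∣ a - s.i ∧ (2 : ℤ) ∣ b - s.j := by
  obtain ⟨f, hf⟩ := hF
  obtain ⟨σ, hσ, hrel⟩ : ∃ σ : (QuarticOrder π)ˣ, (σ = 1 ∨ σ = -1) ∧
      η ^ F = σ * (ε₁ ^ a * ε₂ ^ b) := by
    rcases hrel with h | h
    · exact ⟨1, Or.inl rfl, by rw [h, one_mul]⟩
    · exact ⟨-1, Or.inr rfl, by rw [h, neg_one_mul]⟩
  obtain ⟨σ', hσ', hσσ⟩ : ∃ σ' : ℤ, (σ' = 1 ∨ σ' = -1) ∧ (σ : QuarticOrder π) = σ' := by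
    rcases hσ with rfl | rfl
    · exact ⟨1, by simp⟩
    · exact ⟨-1, by simp⟩
  obtain ⟨i, hi, a', ha⟩ := exists_parity a
  obtain ⟨j, hj, b', hb⟩ := exists_parity b
  rw [hf, ha, hb] at hrel
  have hη := eq_mul_sq_of_zpow_eq hrel
  simp only [parity, List.all_eq_true] at h
  have hσm : σ' ∈ [(1 : ℤ), -1] := by rcases hσ' with rfl | rfl <;> simp
  have := h σ' hσm i hi j hj
  rw [Bool.or_eq_true, List.any_eq_true, Bool.and_eq_true, Nat.beq_eq, Nat.beq_eq] at this
  rcases this with ⟨h3, h4⟩ | ⟨c, -, hc⟩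
  · rw [← h3, ← h4, ha, hb]
    refine ⟨?_, ?_, by simp, by simp⟩
    · simp only [List.mem_cons, List.not_mem_nil, or_false] at hi; omega
    · simp only [List.mem_cons, List.not_mem_nil, or_false] at hj; omega
  · rw [← h₁, ← h₂, ResidueChar.not_isNonresidue (κ := ε₁ ^ a' * ε₂ ^ b' * η ^ (-f)) hσ'
      (β := β)] at hc
    · simp at hc
    · rw [← hηβ]
      nth_rewrite 2 [hη]
      simp only [Units.val_mul, Units.val_pow_eq_pow_val, hσσ]
      ring

theorem thue_ne_nine {x y : ℤ} (h : s.ok = true) : thue π (3 * x) y ≠ 9 := by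
  intro hxy
  simp only [ok, Bool.and_eq_true, decide_eq_true_eq, Nat.beq_eq] at h
  obtain ⟨⟨⟨⟨⟨⟨hu, hm⟩, hn⟩, hM⟩, hE⟩, hpar⟩, h⟩ := h
  obtain ⟨η, β, hηβ, h0, h1, h2, h3⟩ := exists_unit_three_mul_eq_sq (m := π.m / 3) (n := π.n / 3)
    (M := (2 * (π.n / 3) + π.P * (π.m / 3)) / 3) (by omega) (by omega) (by omega) hxy
  obtain ⟨ε₁, ε₂, h₁, h₂⟩ := s.units.exists_units hu
  obtain ⟨F, a, b, hF, hodd, hrel⟩ := s.units.exists_relation hu h₁ h₂ η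
  obtain ⟨hi, hj, ha, hb⟩ := parity_spec hpar h₁ h₂ hηβ hodd hrel
  obtain ⟨K, t, hFK⟩ := UnitCert.exists_inverse hF
  have hK : (2 : ℤ) ∣ K - 1 := by
    obtain ⟨f, rfl⟩ := hodd
    obtain ⟨e, he⟩ := Nat.dvd_of_mod_eq_zero hE
    exact ⟨e * t - f * K, by rw [he] at hFK; push_cast at hFK; linear_combination hFK⟩
  have hIJ : ∀ {a : ℤ} {i : ℕ}, (2 : ℤ) ∣ a - i → ((2 : ℕ) : ℤ) ∣ a * K - i := fun {a i} h => by
    obtain ⟨c, hc⟩ := h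
    obtain ⟨k, hk⟩ := hK
    exact ⟨c * K + i * k, by push_cast; linear_combination K * hc + i * hk⟩
  have hmatch : ∀ M : SieveModulus, M.Valid ε₁ ε₂ s.units.exponent →
      M.Match ε₁ ε₂ η (a * K) (b * K) := fun M hM => hM.match hFK hrel
  rw [← h₁, ← h₂] at h
  obtain ⟨ts, h, hts⟩ := SieveModulus.runAll_spec
    (fun _ _ _ hr => SieveModulus.isQuadric_of_rep hr h0 h1 h2 h3) hmatch _ h
  rw [sieve_sound ts two_pos two_pos (hIJ ha) (hIJ hb) hi hj hts] at h
  simp at h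

end SquareCert

end

/-- The binary quartic form `a X⁴ + 4 b X³ Y + 6 c X² Y² + 4 d X Y³ + e Y⁴`. -/
structure QuarticForm where
  a : ℤ
  b : ℤ
  c : ℤ
  d : ℤ
  e : ℤ

namespace QuarticForm

/-- The value of a form. -/
def eval {R : Type*} [CommRing R] (f : QuarticForm) (x y : R) : R :=
  f.a * x ^ 4 + 4 * f.b * x ^ 3 * y + 6 * f.c * x ^ 2 * y ^ 2 + 4 * f.d * x * y ^ 3 + f.e * y ^ 4

/-- The value of minus the Hessian covariant, normalized to have leading coefficient
`b ^ 2 - a c`. -/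
def hess (f : QuarticForm) (x y : ℤ) : ℤ :=
  (f.b * x ^ 2 + 2 * f.c * x * y + f.d * y ^ 2) ^ 2 -
    (f.a * x ^ 2 + 2 * f.b * x * y + f.c * y ^ 2) * (f.c * x ^ 2 + 2 * f.d * x * y + f.e * y ^ 2)

/-- The invariant of degree two. -/
def invI (f : QuarticForm) : ℤ := f.a * f.e - 4 * f.b * f.d + 3 * f.c ^ 2

/-- The invariant of degree three. -/
def invJ (f : QuarticForm) : ℤ :=
  f.a * f.c * f.e + 2 * f.b * f.c * f.d - f.a * f.d ^ 2 - f.b ^ 2 * f.e - f.c ^ 3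

/-- The substitution `X ↦ α X + β Y`, `Y ↦ γ X + δ Y`. -/
def comp (f : QuarticForm) (α β γ δ : ℤ) : QuarticForm where
  a := f.eval α γ
  b := (f.a * α ^ 3 + 3 * f.b * α ^ 2 * γ + 3 * f.c * α * γ ^ 2 + f.d * γ ^ 3) * β +
    (f.b * α ^ 3 + 3 * f.c * α ^ 2 * γ + 3 * f.d * α * γ ^ 2 + f.e * γ ^ 3) * δ
  c := (f.a * α ^ 2 + 2 * f.b * α * γ + f.c * γ ^ 2) * β ^ 2 +
    2 * (f.b * α ^ 2 + 2 * f.c * α * γ + f.d * γ ^ 2) * β * δ +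
    (f.c * α ^ 2 + 2 * f.d * α * γ + f.e * γ ^ 2) * δ ^ 2
  d := (f.a * β ^ 3 + 3 * f.b * β ^ 2 * δ + 3 * f.c * β * δ ^ 2 + f.d * δ ^ 3) * α +
    (f.b * β ^ 3 + 3 * f.c * β ^ 2 * δ + 3 * f.d * β * δ ^ 2 + f.e * δ ^ 3) * γ
  e := f.eval β δ

section comp

variable (f : QuarticForm) (α β γ δ : ℤ)

lemma eval_comp {R : Type*} [CommRing R] (x y : R) :
    (f.comp α β γ δ).eval x y = f.eval (α * x + β * y) (γ * x + δ * y) := by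
  simp only [comp, eval]
  push_cast
  ring

lemma hess_comp (x y : ℤ) :
    (f.comp α β γ δ).hess x y =
      (α * δ - β * γ) ^ 2 * f.hess (α * x + β * y) (γ * x + δ * y) := by
  simp only [comp, hess, eval]
  push_cast
  ring

lemma invI_comp : (f.comp α β γ δ).invI = (α * δ - β * γ) ^ 4 * f.invI := by
  simp only [comp, invI, eval]
  push_cast
  ring

lemma invJ_comp : (f.comp α β γ δ).invJ = (α * δ - β * γ) ^ 6 * f.invJ := by
  simp only [comp, invJ, eval]
  push_cast
  ring

end comp

/-- A form with a nonreal root is equivalent to one with a root in the standard fundamental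
domain. -/
lemma exists_root_mem_fd (f : QuarticForm) {z : ℂ} (hz : z.im ≠ 0) (h : f.eval z 1 = 0) :
    ∃ (α β γ δ : ℤ) (w : ℂ), α * δ - β * γ = 1 ∧ 3 ≤ 4 * w.im ^ 2 ∧
      (f.comp α β γ δ).eval w 1 = 0 := by
  wlog hpos : 0 < z.im generalizing z
  · refine this (z := starRingEnd ℂ z) (by simpa using hz) ?_ ?_
    · have := congrArg (starRingEnd ℂ) h
      simpa [eval, map_ofNat] using this
    · have := lt_of_le_of_ne (not_lt.1 hpos) hz
      simpa using this
  obtain ⟨g, hg⟩ := ModularGroup.exists_smul_mem_fd (⟨z, hpos⟩ : UpperHalfPlane)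
  have him := ModularGroup.three_le_four_mul_im_sq_of_mem_fd hg
  set w := g • (⟨z, hpos⟩ : UpperHalfPlane) with hw
  have hz' : (⟨z, hpos⟩ : UpperHalfPlane) = g⁻¹ • w := by simp [hw]
  have hz'' : z = ((g⁻¹ • w : UpperHalfPlane) : ℂ) := by rw [← hz']
  rw [UpperHalfPlane.coe_specialLinearGroup_apply] at hz''
  have hdet := Matrix.SpecialLinearGroup.det_coe g⁻¹
  rw [Matrix.det_fin_two] at hdet
  generalize g⁻¹ 0 0 = α at *
  generalize g⁻¹ 0 1 = β at *
  generalize g⁻¹ 1 0 = γ at *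
  generalize g⁻¹ 1 1 = δ at *
  refine ⟨α, β, γ, δ, w, hdet, him, ?_⟩
  simp only [algebraMap_int_eq, eq_intCast, Complex.ofReal_intCast] at hz''
  have hden : (γ * w + δ : ℂ) ≠ 0 := by
    intro h0
    have h1 := congrArg Complex.im h0
    have h2 := congrArg Complex.re h0
    have h3 : γ = 0 := by simpa [w.im_ne_zero] using h1
    have h4 : δ = 0 := by simpa [h3] using h2
    simp [h3, h4] at hdet
  rw [eval_comp]
  have key : f.eval (α * w + β * 1 : ℂ) (γ * w + δ * 1) = (γ * w + δ) ^ 4 * f.eval z 1 := by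
    have : (α * w + β : ℂ) = z * (γ * w + δ) := by rw [hz'', div_mul_cancel₀ _ hden]
    simp only [eval, mul_one, this]
    ring
  rw [key, h, mul_zero]

/-- The relations between the coefficients of a real quartic with the root `p + i h`, in terms of
the coefficients of its translate by `p`. -/
lemma exists_real_relations (f : QuarticForm) {w : ℂ} (hw : w.im ≠ 0) (h : f.eval w 1 = 0) :
    ∃ B ρ : ℝ, 4 * ρ ^ 3 - f.invI * ρ + f.invJ = 0 ∧
      3 * ρ ^ 2 - f.invI =
        4 * B ^ 2 * w.im ^ 2 + f.a ^ 2 * w.im ^ 4 - 6 * f.a * ρ * w.im ^ 2 ∧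
      (f.b ^ 2 - f.a * f.c : ℝ) = B ^ 2 - f.a * ρ ∧ (f.a = 0 → B = f.b) := by
  obtain ⟨p, k⟩ := w
  simp only at hw
  have hre := congrArg Complex.re h
  have him := congrArg Complex.im h
  simp only [eval, pow_succ, pow_zero, one_mul, mul_one, Complex.add_re, Complex.mul_re,
    Complex.add_im, Complex.mul_im, Complex.intCast_re, Complex.intCast_im, Complex.re_ofNat,
    Complex.im_ofNat, Complex.zero_re, Complex.zero_im] at hre him
  obtain ⟨a, b, c, d, e⟩ := f
  simp only [invI, invJ]
  push_cast
  simp only at hre him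
  have hE : (e + 4 * p * d + 6 * p ^ 2 * c + 4 * p ^ 3 * b + p ^ 4 * a : ℝ) =
      6 * (c + 2 * p * b + p ^ 2 * a) * k ^ 2 - a * k ^ 4 := by
    linear_combination hre
  have hD : (d + 3 * p * c + 3 * p ^ 2 * b + p ^ 3 * a : ℝ) = (b + p * a) * k ^ 2 := by
    refine mul_left_cancel₀ hw ?_
    linear_combination him / 4
  obtain ⟨B, hB⟩ : ∃ B : ℝ, B = b + p * a := ⟨_, rfl⟩
  obtain ⟨ρ, hρ⟩ : ∃ ρ : ℝ, ρ = c + 2 * p * b + p ^ 2 * a := ⟨_, rfl⟩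
  rw [← hB] at hD
  rw [← hρ] at hE
  have hb : (b : ℝ) = B - p * a := by linear_combination -hB
  have hc : (c : ℝ) = ρ - 2 * p * b - p ^ 2 * a := by linear_combination -hρ
  have hd : (d : ℝ) = B * k ^ 2 - 3 * p * c - 3 * p ^ 2 * b - p ^ 3 * a := by
    linear_combination hD
  have he : (e : ℝ) = 6 * ρ * k ^ 2 - a * k ^ 4 - 4 * p * d - 6 * p ^ 2 * c - 4 * p ^ 3 * b -
      p ^ 4 * a := by
    linear_combination hE
  refine ⟨B, ρ, ?_, ?_, ?_, fun ha ↦ ?_⟩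
  · rw [he, hd, hc, hb]
    ring
  · rw [he, hd, hc, hb]
    ring
  · rw [hc, hb]
    ring
  · simp [hB, ha]

end QuarticForm

namespace QuarticForm

/-- A form with a nonreal root is equivalent to one with a root in the upper half plane of
imaginary part at least `√3 / 2` whose second coefficient is reduced modulo the first. -/
lemma exists_reduced (f : QuarticForm) {z : ℂ} (hz : z.im ≠ 0) (h : f.eval z 1 = 0) :
    ∃ (α β γ δ : ℤ) (w : ℂ), α * δ - β * γ = 1 ∧ 3 ≤ 4 * w.im ^ 2 ∧
      (f.comp α β γ δ).eval w 1 = 0 ∧ ((f.comp α β γ δ).a ≠ 0 →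
        0 ≤ (f.comp α β γ δ).b ∧ (f.comp α β γ δ).b < |(f.comp α β γ δ).a|) := by
  obtain ⟨α, β, γ, δ, w, hdet, him, hw⟩ := f.exists_root_mem_fd hz h
  obtain ⟨t, ht⟩ : ∃ t : ℤ, t = -((f.comp α β γ δ).b / (f.comp α β γ δ).a) := ⟨_, rfl⟩
  refine ⟨α, α * t + β, γ, γ * t + δ, w - t, by linear_combination hdet, by simpa using him, ?_,
    fun ha ↦ ?_⟩
  · rw [eval_comp] at hw ⊢
    rw [← hw]
    congr 1 <;> push_cast <;> ring
  · have hb : (f.comp α (α * t + β) γ (γ * t + δ)).b =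
        (f.comp α β γ δ).b % (f.comp α β γ δ).a := by
      rw [Int.emod_def, sub_eq_add_neg, ← mul_neg, ← ht]
      simp only [comp, eval, Int.cast_id]
      ring
    have ha' : (f.comp α (α * t + β) γ (γ * t + δ)).a = (f.comp α β γ δ).a := rfl
    rw [ha'] at ha ⊢
    rw [hb]
    exact ⟨Int.emod_nonneg _ ha, Int.emod_lt_abs _ ha⟩

end QuarticForm

/-- Bounds for the real root `ρ` of the resolvent `4 ρ³ - 36 ρ + J` and for `3 ρ² - 36`. -/
structure ResolventBound where
  J : ℤ
  c : ℤ
  D : ℤ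

namespace ResolventBound

/-- The test that `c < 1000 ρ < c + 1` and `1000 (3 ρ² - 36) ≤ D`. -/
def ok (R : ResolventBound) : Bool :=
  decide (4 * R.c ^ 3 - 36 * 10 ^ 6 * R.c + R.J * 10 ^ 9 < 0) &&
  decide (0 < 4 * (R.c + 1) ^ 3 - 36 * 10 ^ 6 * (R.c + 1) + R.J * 10 ^ 9) &&
  decide (12 * 10 ^ 6 < R.c ^ 2) && decide (12 * 10 ^ 6 < (R.c + 1) ^ 2) &&
  decide (3 * R.c ^ 2 - 36 * 10 ^ 6 ≤ 1000 * R.D) &&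
  decide (3 * (R.c + 1) ^ 2 - 36 * 10 ^ 6 ≤ 1000 * R.D) &&
  decide (|R.c| ≤ 8400) && decide (R.D ≤ 180000) && decide (46656 < 27 * R.J ^ 2)

variable {R : ResolventBound}

lemma bounds (hR : R.ok = true) {ρ : ℝ} (h : 4 * ρ ^ 3 - 36 * ρ + R.J = 0) :
    R.c < 1000 * ρ ∧ 1000 * ρ < R.c + 1 ∧ 1000 * (3 * ρ ^ 2 - 36) ≤ R.D ∧ 0 < 3 * ρ ^ 2 - 36 := by
  simp only [ok, Bool.and_eq_true, decide_eq_true_eq] at hR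
  obtain ⟨⟨⟨⟨⟨⟨⟨⟨h1, h2⟩, h3⟩, h4⟩, h5⟩, h6⟩, h7⟩, -⟩, -⟩ := hR
  have h1' : (4 * R.c ^ 3 - 36 * 10 ^ 6 * R.c + R.J * 10 ^ 9 : ℝ) < 0 := by exact_mod_cast h1
  have h2' : (0 : ℝ) < 4 * (R.c + 1) ^ 3 - 36 * 10 ^ 6 * (R.c + 1) + R.J * 10 ^ 9 := by
    exact_mod_cast h2
  have h3' : (12 * 10 ^ 6 : ℝ) < R.c ^ 2 := by exact_mod_cast h3
  have h4' : (12 * 10 ^ 6 : ℝ) < (R.c + 1) ^ 2 := by exact_mod_cast h4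
  have h5' : (3 * R.c ^ 2 - 36 * 10 ^ 6 : ℝ) ≤ 1000 * R.D := by exact_mod_cast h5
  have h6' : (3 * (R.c + 1) ^ 2 - 36 * 10 ^ 6 : ℝ) ≤ 1000 * R.D := by exact_mod_cast h6
  obtain ⟨s, hs⟩ : ∃ s : ℝ, s = 1000 * ρ := ⟨_, rfl⟩
  have hs' : 4 * s ^ 3 - 36 * 10 ^ 6 * s + R.J * 10 ^ 9 = 0 := by
    rw [hs]
    linear_combination 10 ^ 9 * h
  have key (t : ℝ) (ht : 12 * 10 ^ 6 < t ^ 2) :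
      0 < 4 * (s ^ 2 + s * t + t ^ 2) - 36 * 10 ^ 6 := by
    nlinarith [sq_nonneg (2 * s + t)]
  have hlo : (R.c : ℝ) < s := by
    have := key _ h3'
    by_contra! hc
    nlinarith
  have hhi : s < R.c + 1 := by
    have := key _ h4'
    by_contra! hc
    nlinarith
  rw [show 1000 * (3 * ρ ^ 2 - 36) = (3 * s ^ 2 - 36 * 10 ^ 6) / 1000 by rw [hs]; ring,
    show 3 * ρ ^ 2 - 36 = (3 * s ^ 2 - 36 * 10 ^ 6) / 10 ^ 6 by rw [hs]; ring]
  rw [← hs]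
  have hsign : 0 ≤ R.c ∨ R.c + 1 ≤ 0 := by omega
  have hsign' : (0 : ℝ) ≤ R.c ∨ (R.c + 1 : ℝ) ≤ 0 := by exact_mod_cast hsign
  refine ⟨hlo, hhi, ?_, ?_⟩
  · rw [div_le_iff₀ (by norm_num)]
    rcases hsign' with h0 | h0 <;> nlinarith
  · refine div_pos ?_ (by norm_num)
    rcases hsign' with h0 | h0 <;> nlinarith

/-- The bounds for the coefficients of a reduced form of invariants `36` and `J`. -/
lemma coeff_bounds (hR : R.ok = true) {f : QuarticForm} (hI : f.invI = 36) (hJ : f.invJ = R.J)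
    {w : ℂ} (hw : 3 ≤ 4 * w.im ^ 2) (h : f.eval w 1 = 0) :
    |f.a| ≤ 75 ∧ -f.a * R.c - |f.a| ≤ 1000 * (f.b ^ 2 - f.a * f.c) ∧
      48000 * (f.b ^ 2 - f.a * f.c) ≤
        16 * R.D + 24 * (R.c * f.a + |f.a|) - 9000 * f.a ^ 2 ∧ (f.a = 0 → f.b ≠ 0) := by
  have hw0 : w.im ≠ 0 := by
    intro h0
    norm_num [h0] at hw
  obtain ⟨B, ρ, h1, h2, h3, h4⟩ := f.exists_real_relations hw0 h
  rw [hI, hJ] at h1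
  rw [hI] at h2
  push_cast at h1 h2
  obtain ⟨hlo, hhi, hD, hpos⟩ := bounds hR h1
  obtain ⟨k, hk⟩ : ∃ k, k = w.im ^ 2 := ⟨_, rfl⟩
  rw [show w.im ^ 4 = k ^ 2 by rw [hk]; ring, ← hk] at h2
  rw [← hk] at hw
  obtain ⟨a, b, c, d, e⟩ := f
  simp only at *
  have habs : |(1000 * ρ - R.c) * a| ≤ |(a : ℝ)| := by
    rw [abs_mul]
    refine mul_le_of_le_one_left (abs_nonneg _) ?_
    rw [abs_le]
    constructor <;> linarith
  have hA : ((|a| : ℤ) : ℝ) = |(a : ℝ)| := by push_cast; rfl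
  rw [abs_le] at habs
  have hlow : (-a * R.c - |a| : ℝ) ≤ 1000 * (b ^ 2 - a * c) := by
    rw [h3]
    nlinarith [sq_nonneg B]
  have hup : (48000 * (b ^ 2 - a * c) : ℝ) ≤ 16 * R.D + 24 * (R.c * a + |a|) - 9000 * a ^ 2 := by
    rw [h3]
    have hH : 4 * k * (B ^ 2 - a * ρ) = 3 * ρ ^ 2 - 36 + 2 * a * ρ * k - a ^ 2 * k ^ 2 := by
      linear_combination -h2
    have h5 : 3 * (B ^ 2 - a * ρ) ≤ 3 * ρ ^ 2 - 36 + 3 / 2 * a * ρ - 9 / 16 * a ^ 2 := by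
      have hk0 : 0 < k := by linarith
      refine le_of_mul_le_mul_left ?_ hk0
      have e1 : 0 ≤ (3 * ρ ^ 2 - 36) * (k - 3 / 4) := mul_nonneg hpos.le (by linarith)
      have e2 : 0 ≤ (a : ℝ) ^ 2 * (k * (k - 3 / 4)) :=
        mul_nonneg (sq_nonneg _) (mul_nonneg hk0.le (by linarith))
      linarith [e1, e2, hH]
    nlinarith
  have hlow' : -a * R.c - |a| ≤ 1000 * (b ^ 2 - a * c) := by exact_mod_cast hlow
  have hup' : 48000 * (b ^ 2 - a * c) ≤ 16 * R.D + 24 * (R.c * a + |a|) - 9000 * a ^ 2 := by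
    exact_mod_cast hup
  refine ⟨?_, hlow', hup', fun ha hb ↦ ?_⟩
  · simp only [ok, Bool.and_eq_true, decide_eq_true_eq] at hR
    obtain ⟨⟨⟨-, h7⟩, h8⟩, -⟩ := hR
    have h9 : R.c * a ≤ 8400 * |a| :=
      (le_abs_self _).trans (by rw [abs_mul]; exact mul_le_mul_of_nonneg_right h7 (abs_nonneg _))
    by_contra! h10
    rw [← sq_abs a] at hup'
    nlinarith
  · rw [h4 ha, ha, hb] at h2
    norm_num at h2
    linarith

end ResolventBound

section

namespace QuarticForm

/-- The form `X⁴ - 18 x X² Y² + 36 y X Y³ + (36 - 27 x²) Y⁴`. -/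
def base (x y : ℤ) : QuarticForm := ⟨1, 0, -3 * x, 9 * y, 36 - 27 * x ^ 2⟩

/-- The form `9 X⁴ - 18 x X² Y² + 12 y X Y³ + (4 - 3 x²) Y⁴`. -/
def ninth (x y : ℤ) : QuarticForm := ⟨9, 0, -3 * x, 3 * y, 4 - 3 * x ^ 2⟩

lemma invI_base (x y : ℤ) : (base x y).invI = 36 := by
  simp only [base, invI]
  ring

lemma invJ_base (x y : ℤ) : (base x y).invJ = 108 * x ^ 3 - 108 * x - 81 * y ^ 2 := by
  simp only [base, invJ]
  ring

/-- The property of being congruent to the fourth power of the linear form `r X + s Y` with respect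
to the modulus `9`, the middle coefficient only being taken into account modulo `3`. -/
def IsFourth (f : QuarticForm) (r s : ℤ) : Prop :=
  f.a ≡ r ^ 4 [ZMOD 9] ∧ f.b ≡ r ^ 3 * s [ZMOD 9] ∧ f.c ≡ r ^ 2 * s ^ 2 [ZMOD 3] ∧
    f.d ≡ r * s ^ 3 [ZMOD 9] ∧ f.e ≡ s ^ 4 [ZMOD 9]

instance (f : QuarticForm) (r s : ℤ) : Decidable (f.IsFourth r s) := by
  unfold IsFourth
  infer_instance

lemma isFourth_comp_base (x y α β γ δ : ℤ) : ((base x y).comp α β γ δ).IsFourth α β := by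
  simp only [IsFourth, comp, base, eval, Int.cast_id]
  refine ⟨.symm (Int.modEq_iff_dvd.2
      ⟨-2 * x * α ^ 2 * γ ^ 2 + 4 * y * α * γ ^ 3 + (4 - 3 * x ^ 2) * γ ^ 4, ?_⟩),
    .symm (Int.modEq_iff_dvd.2 ⟨(-x * α * γ ^ 2 + y * γ ^ 3) * β +
      (-x * α ^ 2 * γ + 3 * y * α * γ ^ 2 + (4 - 3 * x ^ 2) * γ ^ 3) * δ, ?_⟩),
    .symm (Int.modEq_iff_dvd.2 ⟨-x * γ ^ 2 * β ^ 2 + 2 * (-2 * x * α * γ + 3 * y * γ ^ 2) * β * δ +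
      (-x * α ^ 2 + 6 * y * α * γ + (12 - 9 * x ^ 2) * γ ^ 2) * δ ^ 2, ?_⟩),
    .symm (Int.modEq_iff_dvd.2 ⟨(-x * β * δ ^ 2 + y * δ ^ 3) * α +
      (-x * β ^ 2 * δ + 3 * y * β * δ ^ 2 + (4 - 3 * x ^ 2) * δ ^ 3) * γ, ?_⟩),
    .symm (Int.modEq_iff_dvd.2
      ⟨-2 * x * β ^ 2 * δ ^ 2 + 4 * y * β * δ ^ 3 + (4 - 3 * x ^ 2) * δ ^ 4, ?_⟩)⟩ <;>
    push_cast <;> ring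

lemma IsFourth.emod {f : QuarticForm} {r s : ℤ} (h : f.IsFourth r s) :
    f.IsFourth (r % 9) (s % 9) := by
  have hr : r ≡ r % 9 [ZMOD 9] := (Int.mod_modEq r 9).symm
  have hs : s ≡ s % 9 [ZMOD 9] := (Int.mod_modEq s 9).symm
  have h3 : (3 : ℤ) ∣ 9 := by norm_num
  exact ⟨h.1.trans (hr.pow 4), h.2.1.trans ((hr.pow 3).mul hs),
    h.2.2.1.trans (((hr.of_dvd h3).pow 2).mul ((hs.of_dvd h3).pow 2)),
    h.2.2.2.1.trans (hr.mul (hs.pow 3)), h.2.2.2.2.trans (hs.pow 4)⟩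

lemma IsFourth.three_dvd {f : QuarticForm} {r s : ℤ} (h : f.IsFourth r s) :
    (f.b ^ 2 - f.a * f.c) % 3 = 0 := by
  have h3 : (3 : ℤ) ∣ 9 := by norm_num
  have := ((h.2.1.of_dvd h3).pow 2).sub ((h.1.of_dvd h3).mul h.2.2.1)
  rw [show (r ^ 3 * s) ^ 2 - r ^ 4 * (r ^ 2 * s ^ 2) = 0 by ring] at this
  exact this

lemma IsFourth.nine_dvd {f : QuarticForm} {r s : ℤ} (h : f.IsFourth r s) (ha : f.a = 0) :
    9 ∣ f.b := by
  have h4 : (9 : ℤ) ∣ r ^ 4 := by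
    have := h.1
    rw [ha] at this
    exact Int.modEq_zero_iff_dvd.1 this.symm
  have h3 : (3 : ℤ) ∣ r := Int.prime_three.dvd_of_dvd_pow ((by norm_num : (3 : ℤ) ∣ 9).trans h4)
  obtain ⟨t, rfl⟩ := h3
  refine Int.modEq_zero_iff_dvd.1 (h.2.1.trans (Int.modEq_zero_iff_dvd.2 ?_))
  exact ⟨3 * t ^ 3 * s, by ring⟩

/-- Equality test. -/
def same (f g : QuarticForm) : Bool :=
  decide (f.a = g.a) && decide (f.b = g.b) && decide (f.c = g.c) && decide (f.d = g.d) &&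
    decide (f.e = g.e)

lemma eq_of_same {f g : QuarticForm} (h : f.same g = true) : f = g := by
  simp only [same, Bool.and_eq_true, decide_eq_true_eq] at h
  obtain ⟨a, b, c, d, e⟩ := f
  obtain ⟨a', b', c', d', e'⟩ := g
  simp_all

/-- A necessary test for a form to be a fourth power in the sense of `IsFourth`. -/
def fourthTest (f : QuarticForm) : Bool :=
  (List.range 9).any fun r ↦ (List.range 9).any fun s ↦ decide (f.IsFourth r s)

lemma IsFourth.fourthTest {f : QuarticForm} {r s : ℤ} (h : f.IsFourth r s) :
    f.fourthTest = true := by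
  have h1 : ((r % 9).toNat : ℤ) = r % 9 := Int.toNat_of_nonneg (Int.emod_nonneg _ (by norm_num))
  have h2 : ((s % 9).toNat : ℤ) = s % 9 := Int.toNat_of_nonneg (Int.emod_nonneg _ (by norm_num))
  have h3 : r % 9 < 9 := Int.emod_lt_of_pos _ (by norm_num)
  have h4 : s % 9 < 9 := Int.emod_lt_of_pos _ (by norm_num)
  refine List.any_eq_true.2 ⟨(r % 9).toNat, List.mem_range.2 (by omega),
    List.any_eq_true.2 ⟨(s % 9).toNat, List.mem_range.2 (by omega), ?_⟩⟩
  rw [decide_eq_true_eq, h1, h2]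
  exact h.emod

/-- A necessary test for a form to represent `1`. -/
def oneTest (f : QuarticForm) : Bool :=
  (List.range 25).any fun p ↦ (List.range 25).any fun q ↦
    decide ((f.eval (p : ℤ) (q : ℤ) - 1) % 25 = 0)

lemma oneTest_of_eval_eq_one {f : QuarticForm} {u v : ℤ} (h : f.eval u v = 1) :
    f.oneTest = true := by
  have h1 : ((u % 25).toNat : ℤ) = u % 25 :=
    Int.toNat_of_nonneg (Int.emod_nonneg _ (by norm_num))
  have h2 : ((v % 25).toNat : ℤ) = v % 25 :=
    Int.toNat_of_nonneg (Int.emod_nonneg _ (by norm_num))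
  have h3 : u % 25 < 25 := Int.emod_lt_of_pos _ (by norm_num)
  have h4 : v % 25 < 25 := Int.emod_lt_of_pos _ (by norm_num)
  refine List.any_eq_true.2 ⟨(u % 25).toNat, List.mem_range.2 (by omega),
    List.any_eq_true.2 ⟨(v % 25).toNat, List.mem_range.2 (by omega), ?_⟩⟩
  rw [decide_eq_true_eq, h1, h2]
  have hu : u % 25 ≡ u [ZMOD 25] := Int.mod_modEq u 25
  have hv : v % 25 ≡ v [ZMOD 25] := Int.mod_modEq v 25
  have : f.eval (u % 25) (v % 25) ≡ f.eval u v [ZMOD 25] := by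
    simp only [eval]
    gcongr
  rw [h] at this
  exact Int.emod_eq_emod_iff_emod_sub_eq_zero.1 this

/-- The form with leading coefficients `a`, `b`, invariant `36` and leading coefficients of the
covariants equal to `H`, `T`. -/
def ofSeminvariants (a b H T : ℤ) : QuarticForm :=
  let c := (b ^ 2 - H) / a
  let d := (T + 3 * a * b * c - 2 * b ^ 3) / a ^ 2
  ⟨a, b, c, d, (36 + 4 * b * d - 3 * c ^ 2) / a⟩

lemma ofSeminvariants_eq {f : QuarticForm} (ha : f.a ≠ 0) (hI : f.invI = 36) {H T : ℤ}
    (hH : H = f.b ^ 2 - f.a * f.c) (hT : T = f.a ^ 2 * f.d - 3 * f.a * f.b * f.c + 2 * f.b ^ 3) :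
    ofSeminvariants f.a f.b H T = f := by
  have hc : (f.b ^ 2 - H) / f.a = f.c :=
    Int.ediv_eq_of_eq_mul_right ha (by rw [hH]; ring)
  have hd : (T + 3 * f.a * f.b * f.c - 2 * f.b ^ 3) / f.a ^ 2 = f.d :=
    Int.ediv_eq_of_eq_mul_right (pow_ne_zero 2 ha) (by rw [hT]; ring)
  have he : (36 + 4 * f.b * f.d - 3 * f.c ^ 2) / f.a = f.e :=
    Int.ediv_eq_of_eq_mul_right ha (by rw [← hI, invI]; ring)
  simp only [ofSeminvariants, hc, hd, he]

end QuarticForm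

/-- `eagerInt z f = f z`, written so that the kernel evaluates `z` first. -/
def eagerInt {α : Type*} (z : ℤ) (f : ℤ → α) : α :=
  match z with
  | .ofNat n => eager n fun n ↦ f (.ofNat n)
  | .negSucc n => eager n fun n ↦ f (.negSucc n)

@[simp] lemma eagerInt_eq {α : Type*} (z : ℤ) (f : ℤ → α) : eagerInt z f = f z := by
  cases z <;> simp [eagerInt]

/-- Data for the reduction of the forms of invariants `36` and `J`: a list of forms together with
substitutions which yield all the reduced ones. -/
structure Reduction extends ResolventBound where
  table : List (QuarticForm × List (ℤ × ℤ × ℤ × ℤ))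

namespace Reduction

/-- The test that a form cannot occur or is found in the table. -/
def okForm (R : Reduction) (f : QuarticForm) : Bool :=
  !f.fourthTest || !f.oneTest || R.table.any fun g ↦ g.2.any fun M ↦
    decide ((M.1 * M.2.2.2 - M.2.1 * M.2.2.1) ^ 2 = 1) &&
      f.same (g.1.comp M.1 M.2.1 M.2.2.1 M.2.2.2)

/-- The test of all forms with given leading coefficients of the form and its covariants. -/
def okSeminvariants (R : Reduction) (a H T : ℤ) : Bool :=
  (List.range a.natAbs).all fun b ↦
    decide ((b ^ 2 - H) % a ≠ 0) ||
    (let f := QuarticForm.ofSeminvariants a b H T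
     decide (f.a ^ 2 * f.d - 3 * f.a * f.b * f.c + 2 * f.b ^ 3 ≠ T) || decide (f.invI ≠ 36) ||
      R.okForm f)

/-- The test of all forms with given leading coefficients of the form and its Hessian. -/
def okHess (R : Reduction) (a H : ℤ) : Bool :=
  decide (H % 3 ≠ 0) ||
    eagerInt (4 * (H * H * H) - a * a * (36 * H + R.J * a)) fun N ↦
      eagerInt (Nat.sqrt N.toNat : ℕ) fun s ↦ decide (s * s ≠ N) ||
        R.okSeminvariants a H s && R.okSeminvariants a H (-s)

/-- The lower bound for the leading coefficient of the Hessian. -/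
def lower (R : Reduction) (a : ℤ) : ℤ := (-a * R.c - |a|) / 1000

/-- The upper bound for the leading coefficient of the Hessian. -/
def upper (R : Reduction) (a : ℤ) : ℤ :=
  (16 * R.D + 24 * (R.c * a + |a|) - 9000 * a ^ 2) / 48000

/-- The test of all forms with a given leading coefficient. -/
def okLeading (R : Reduction) (a : ℤ) : Bool :=
  decide (a = 0) || !((List.range 9).any fun r ↦ decide (a ≡ r ^ 4 [ZMOD 9])) ||
    (List.range (R.upper a - R.lower a + 1).toNat).all fun j ↦
      eagerInt (R.lower a + j) (R.okHess a)

/-- The test that the table is complete. -/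
def ok (R : Reduction) : Bool :=
  R.toResolventBound.ok && (List.range 151).all fun i ↦ eagerInt (i - 75) R.okLeading

variable {R : Reduction}

open QuarticForm in
/-- Every reduced form which satisfies the congruence conditions and represents `1` is found in the
table. -/
lemma okForm_of_reduced (hR : R.ok = true) {f : QuarticForm} (hI : f.invI = 36)
    (hJ : f.invJ = R.J) {w : ℂ} (hw : 3 ≤ 4 * w.im ^ 2) (h : f.eval w 1 = 0)
    (hred : f.a ≠ 0 → 0 ≤ f.b ∧ f.b < |f.a|) {r s : ℤ} (hf : f.IsFourth r s) :
    R.okForm f = true := by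
  simp only [ok, Bool.and_eq_true, List.all_eq_true, List.mem_range] at hR
  obtain ⟨hR, hall⟩ := hR
  obtain ⟨ha, hlow, hup, hzero⟩ := ResolventBound.coeff_bounds hR hI hJ hw h
  have ha0 : f.a ≠ 0 := by
    intro h0
    have hb := hzero h0
    have hD : R.D ≤ 180000 := by
      simp only [ResolventBound.ok, Bool.and_eq_true, decide_eq_true_eq] at hR
      exact hR.1.2
    obtain ⟨t, ht⟩ := hf.nine_dvd h0
    have ht0 : 1 ≤ t ^ 2 := by
      have : t ≠ 0 := by
        rintro rfl
        simp [ht] at hb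
      have := sq_pos_of_ne_zero this
      omega
    rw [h0, ht] at hup
    norm_num at hup
    nlinarith
  obtain ⟨hb0, hb1⟩ := hred ha0
  obtain ⟨H, hH⟩ : ∃ H, H = f.b ^ 2 - f.a * f.c := ⟨_, rfl⟩
  obtain ⟨T, hT⟩ : ∃ T, T = f.a ^ 2 * f.d - 3 * f.a * f.b * f.c + 2 * f.b ^ 3 := ⟨_, rfl⟩
  have hfour := hf.fourthTest
  have h3 := hf.three_dvd
  rw [← hH] at hlow hup h3
  rw [abs_le] at ha
  have h1 := hall (f.a + 75).toNat (by omega)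
  rw [eagerInt_eq, Int.toNat_of_nonneg (by omega), add_sub_cancel_right, okLeading, Bool.or_eq_true,
    Bool.or_eq_true] at h1
  have hfour_a : ((List.range 9).any fun r ↦ decide (f.a ≡ r ^ 4 [ZMOD 9])) = true := by
    obtain ⟨r, hr, h'⟩ := List.any_eq_true.1 hfour
    obtain ⟨s, hs, h'⟩ := List.any_eq_true.1 h'
    exact List.any_eq_true.2 ⟨r, hr, decide_eq_true (of_decide_eq_true h').1⟩
  rcases h1 with (h1 | h1) | h1
  · exact absurd (of_decide_eq_true h1) ha0
  · simp [hfour_a] at h1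
  have hL : R.lower f.a ≤ H := by
    unfold lower
    omega
  have hU : H ≤ R.upper f.a := by
    unfold upper
    omega
  have h2 := List.all_eq_true.1 h1 (H - R.lower f.a).toNat (List.mem_range.2 (by omega))
  rw [eagerInt_eq, Int.toNat_of_nonneg (by omega), add_sub_cancel, okHess, Bool.or_eq_true] at h2
  rcases h2 with h2 | h2
  · exact absurd h3 (of_decide_eq_true h2)
  have hN : 4 * (H * H * H) - f.a * f.a * (36 * H + R.J * f.a) = T * T := by
    rw [← hI, ← hJ, hH, hT, invI, invJ]
    ring
  have hs : Nat.sqrt (T * T).toNat = T.natAbs := by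
    rw [show (T * T).toNat = T.natAbs ^ 2 by zify; simp [mul_self_nonneg, sq], Nat.sqrt_eq']
  simp only [eagerInt_eq, hN, hs, Bool.or_eq_true, Bool.and_eq_true, decide_eq_true_eq,
      Int.natCast_natAbs,
    abs_mul_abs_self, ne_eq, not_true, false_or] at h2
  have h4 : R.okSeminvariants f.a H T = true := by
    rcases abs_choice T with h' | h'
    · rw [h'] at h2
      exact h2.1
    · rw [h', neg_neg] at h2
      exact h2.2
  have h5 := List.all_eq_true.1 h4 f.b.toNat (List.mem_range.2 (by
    rw [Int.abs_eq_natAbs] at hb1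
    omega))
  rw [Int.toNat_of_nonneg hb0, ofSeminvariants_eq ha0 hI hH hT] at h5
  have h6 : (f.b ^ 2 - H) % f.a = 0 := by
    rw [hH]
    simp
  simpa [h6, ← hT, hI] using h5

open QuarticForm in
/-- Every solution `(x, y)` arises from a representation of `1` by a form of the table. -/
theorem exists_eval_eq_one (hR : R.ok = true) {x y : ℤ}
    (hxy : 108 * x ^ 3 - 108 * x - 81 * y ^ 2 = R.J) :
    ∃ g ∈ R.table, ∃ u v : ℤ, g.1.eval u v = 1 ∧ g.1.hess u v = 3 * x := by
  have hJ : (base x y).invJ = R.J := (invJ_base x y).trans hxy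
  have hdisc : 46656 < 27 * R.J ^ 2 := by
    simp only [ok, ResolventBound.ok, Bool.and_eq_true, decide_eq_true_eq] at hR
    exact hR.1.2
  obtain ⟨z, hz, h0⟩ := exists_nonreal_root (p := -18 * x) (q := 36 * y) (r := 36 - 27 * x ^ 2) (by
    have h : (46656 - 27 * R.J ^ 2 : ℝ) < 0 := by
      have : (46656 : ℝ) < 27 * R.J ^ 2 := by exact_mod_cast hdisc
      linarith
    have h' : (R.J : ℝ) = 108 * x ^ 3 - 108 * x - 81 * y ^ 2 := by exact_mod_cast hxy.symm
    rw [h'] at h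
    nlinarith)
  obtain ⟨α, β, γ, δ, w, hdet, hw, hroot, hred⟩ := (base x y).exists_reduced hz (by
    rw [← h0]
    simp only [eval, base]
    push_cast
    ring)
  have h1 := okForm_of_reduced hR (by rw [invI_comp, hdet, invI_base]; norm_num)
    (by rw [invJ_comp, hdet, hJ]; norm_num) hw hroot hred (isFourth_comp_base x y α β γ δ)
  have heval : ((base x y).comp α β γ δ).eval δ (-γ) = 1 := by
    rw [eval_comp, Int.cast_id, Int.cast_id, Int.cast_id, Int.cast_id,
      show α * δ + β * -γ = 1 by linear_combination hdet,
      show γ * δ + δ * -γ = 0 by ring]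
    simp [eval, base]
  have hhess : ((base x y).comp α β γ δ).hess δ (-γ) = 3 * x := by
    rw [hess_comp, hdet, show α * δ + β * -γ = 1 by linear_combination hdet,
      show γ * δ + δ * -γ = 0 by ring]
    simp [hess, base]
  simp only [okForm, (isFourth_comp_base x y α β γ δ).fourthTest, oneTest_of_eval_eq_one heval,
      Bool.not_true, Bool.false_or,
    List.any_eq_true, Bool.and_eq_true, decide_eq_true_eq] at h1
  obtain ⟨g, hg, M, -, hM, hsame⟩ := h1
  rw [eq_of_same hsame] at heval hhess
  rw [eval_comp, Int.cast_id, Int.cast_id, Int.cast_id, Int.cast_id] at heval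
  rw [hess_comp, hM, one_mul] at hhess
  exact ⟨g, hg, _, _, heval, hhess⟩

end Reduction

end

/-- Certificate for the equation `thue π u v = 1` attached to `x = 3` in the case `d = -3`. -/
def certNeg3_3 : ThueCert ⟨6, 3, 8, -3, 10⟩ :=
  ⟨⟨⟨46, -9, 56, 8⟩, ⟨15434, -5847, 15532, -1858⟩, ⟨1025, -482, -16, 52⟩, ⟨3204861, -543894,
      2435576, 374540⟩, 5, 6, 1,
    [⟨2, ⟨29, 25, 7⟩, ⟨13, 10, 1⟩⟩, ⟨3, ⟨19, 1, 6⟩, ⟨7, 5, 6⟩⟩]⟩,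
    [⟨2, 2, 2, 1, 8, 4⟩, ⟨2, 3, 2, 1, 16, 8⟩, ⟨2, 4, 2, 1, 32, 16⟩, ⟨3, 0, 1, 2, 6, 12⟩, ⟨193, 0,
        0, 1, 48, 192⟩], ⟨193, 0, 0, 1, 48, 192⟩, [(1, 0)]⟩

lemma certNeg3_3_ok : certNeg3_3.ok = true := by
  decide +kernel

/-- Certificate that `thue π (3 u) v ≠ 9` attached to `x = 3` in the case `d = -3`. -/
def squarecertNeg3_3 : SquareCert ⟨6, 3, 8, -3, 10⟩ :=
  ⟨certNeg3_3.units, [⟨7, 5, 6⟩, ⟨13, 10, 1⟩, ⟨23, 0, 11⟩], 1, 0, [⟨2, 1, 2, 1, 4, 2⟩, ⟨2, 2, 2, 1,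
      8, 4⟩]⟩

lemma squarecertNeg3_3_ok : squarecertNeg3_3.ok = true := by
  decide +kernel

/-- Certificate for the equation `thue π u v = 1` attached to `x = 7` in the case `d = -1`. -/
def certNeg1_7 : ThueCert ⟨6, 3, 20, -21, 46⟩ :=
  ⟨⟨⟨-941, 352, -142, -24⟩, ⟨-13, 4, -2, 0⟩, ⟨2864, -690, 39, 32⟩, ⟨-47296, 17688, -7122, -1205⟩,
      5, 5, 1,
    [⟨2, ⟨29, 18, 10⟩, ⟨13, 9, 0⟩⟩, ⟨3, ⟨13, 9, 0⟩, ⟨13, 0, 6⟩⟩]⟩,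
    [⟨2, 0, 2, 1, 1, 4⟩, ⟨2, 1, 2, 1, 2, 8⟩, ⟨2, 2, 2, 1, 4, 16⟩, ⟨2, 3, 2, 1, 8, 32⟩, ⟨7, 0, 0, 2,
        12, 8⟩], ⟨7, 0, 0, 2, 12, 8⟩, [(1, 0)]⟩

lemma certNeg1_7_ok : certNeg1_7.ok = true := by
  decide +kernel

/-- Certificate for the equation `thue π u v = 1` attached to `x = 22` in the case `d = -1`. -/
def certNeg1_22 : ThueCert ⟨6, 0, 66, -119, 362⟩ :=
  ⟨⟨⟨27, -6, 2, 0⟩, ⟨3915, -846, 142, 16⟩, ⟨42979, -8843, 1287, 160⟩, ⟨841, -226, 99, -1⟩, 5, 8, 1,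
    [⟨2, ⟨29, 2, 20⟩, ⟨13, 10, 8⟩⟩, ⟨3, ⟨13, 10, 8⟩, ⟨13, 2, 5⟩⟩]⟩,
    [⟨2, 0, 2, 1, 1, 4⟩, ⟨2, 1, 2, 1, 2, 8⟩, ⟨2, 2, 2, 1, 4, 16⟩, ⟨7, 0, 0, 2, 12, 8⟩], ⟨7, 0, 0,
        2, 12, 8⟩, [(1, 0)]⟩

lemma certNeg1_22_ok : certNeg1_22.ok = true := by
  decide +kernel

/-- Certificate for the equation `thue π u v = 1` attached to `x = 2` in the case `d = -1`. -/
def certNeg1_2 : ThueCert ⟨6, 0, 6, -1, 2⟩ :=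
  ⟨⟨⟨699, -226, 1858, 328⟩, ⟨-885, 566, 62, -88⟩, ⟨39, -25, 139, -20⟩, ⟨-51, -178, 35, 29⟩, 5, 5, 1,
    [⟨2, ⟨17, 12, 7⟩, ⟨13, 12, 11⟩⟩, ⟨3, ⟨19, 7, 5⟩, ⟨13, 12, 11⟩⟩, ⟨13, ⟨313, 83, 157⟩, ⟨53, 27,
        42⟩⟩]⟩,
    [⟨5, 0, 0, 4, 3, 13⟩], ⟨5, 0, 0, 4, 3, 13⟩, [(1, 0)]⟩

lemma certNeg1_2_ok : certNeg1_2.ok = true := by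
  decide +kernel

/-- Certificate that `thue π (3 u) v ≠ 9` attached to `x = 2` in the case `d = -1`. -/
def squarecertNeg1_2 : SquareCert ⟨6, 0, 6, -1, 2⟩ :=
  ⟨certNeg1_2.units, [⟨11, 10, 2⟩, ⟨13, 12, 11⟩, ⟨17, 12, 7⟩], 1, 0, [⟨3, 0, 1, 2, 6, 6⟩]⟩

lemma squarecertNeg1_2_ok : squarecertNeg1_2.ok = true := by
  decide +kernel

/-- Certificate for the equation `thue π u v = 1` attached to `x = 3` in the case `d = -1`. -/
def certNeg1_3 : ThueCert ⟨6, 3, 8, -5, 10⟩ :=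
  ⟨⟨⟨-2837, 1344, -1486, -304⟩, ⟨-20654197, 10829156, -21808946, 2482584⟩, ⟨-2469992, 1295036,
      -2608086, 296887⟩, ⟨1048, -986, 339, 128⟩, 17, 5, 1,
    [⟨2, ⟨89, 62, 32⟩, ⟨5, 1, 3⟩⟩, ⟨3, ⟨19, 11, 7⟩, ⟨13, 11, 11⟩⟩, ⟨5, ⟨61, 38, 47⟩, ⟨11, 10, 7⟩⟩]⟩,
    [⟨3, 0, 1, 2, 6, 3⟩, ⟨3, 1, 1, 2, 6, 9⟩, ⟨5, 0, 0, 2, 12, 12⟩, ⟨3, 2, 1, 2, 18, 27⟩, ⟨19, 0, 0,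
        2, 45, 9⟩], ⟨19, 0, 0, 2, 45, 9⟩, [(1, 0), (26, 5)]⟩

lemma certNeg1_3_ok : certNeg1_3.ok = true := by
  decide +kernel

/-- Certificate for the equation `thue π u v = 1` attached to `x = -1` in the case `d = 0`. -/
def cert0_Neg1 : ThueCert ⟨6, 3, -4, -1, -2⟩ :=
  ⟨⟨⟨2, -4, 2, -1⟩, ⟨0, 0, -1, 0⟩, ⟨-41, -28, 2, -8⟩, ⟨-1, 0, -2, 0⟩, 7, -1, 1,
    [⟨2, ⟨13, 2, 11⟩, ⟨5, 3, 1⟩⟩, ⟨3, ⟨79, 5, 30⟩, ⟨13, 2, 11⟩⟩]⟩,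
    [⟨2, 1, 2, 1, 8, 2⟩, ⟨2, 2, 2, 1, 16, 4⟩, ⟨3, 0, 1, 2, 12, 6⟩, ⟨3, 1, 1, 2, 12, 18⟩, ⟨193, 0,
        0, 1, 192, 96⟩], ⟨193, 0, 0, 1, 192, 96⟩, [(1, 0)]⟩

lemma cert0_Neg1_ok : cert0_Neg1.ok = true := by
  decide +kernel

/-- Certificate for the equation `thue π u v = 1` attached to `x = 0` in the case `d = 0`. -/
def cert0_0 : ThueCert ⟨6, 0, 0, -1, -1⟩ :=
  ⟨⟨⟨-6, 0, 1, -1⟩, ⟨0, 0, -1, 0⟩, ⟨-46, -30, 63, -22⟩, ⟨8, 0, -3, 1⟩, 7, -2, 1,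
    [⟨2, ⟨17, 8, 5⟩, ⟨5, 3, 4⟩⟩, ⟨3, ⟨13, 8, 2⟩, ⟨19, 12, 5⟩⟩, ⟨5, ⟨31, 23, 21⟩, ⟨31, 2, 11⟩⟩]⟩,
    [⟨31, 0, 0, 1, 15, 15⟩], ⟨31, 0, 0, 1, 15, 15⟩, [(1, 0), (-1, 1)]⟩

lemma cert0_0_ok : cert0_0.ok = true := by
  decide +kernel

/-- Certificate for the equation `thue π u v = 1` attached to `x = 1` in the case `d = 0`. -/
def cert0_1 : ThueCert ⟨6, 3, 2, -1, 1⟩ :=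
  ⟨⟨⟨4, -3, 9, -2⟩, ⟨31, -12, 0, 5⟩, ⟨53, -20, -2, 8⟩, ⟨1, 0, 2, 0⟩, 23, -1, 1,
    [⟨2, ⟨13, 5, 8⟩, ⟨5, 2, 1⟩⟩, ⟨3, ⟨7, 5, 6⟩, ⟨7, 1, 2⟩⟩, ⟨5, ⟨191, 91, 170⟩, ⟨11, 4, 4⟩⟩]⟩,
    [⟨3, 0, 1, 2, 3, 6⟩, ⟨7, 0, 0, 2, 6, 24⟩, ⟨2, 0, 2, 1, 4, 1⟩, ⟨2, 2, 2, 1, 16, 4⟩, ⟨11, 0, 0,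
        2, 30, 60⟩], ⟨11, 0, 0, 2, 30, 60⟩, [(1, 0)]⟩

lemma cert0_1_ok : cert0_1.ok = true := by
  decide +kernel

/-- Certificate for the equation `thue π u v = 1` attached to `x = 4` in the case `d = 0`. -/
def cert0_4 : ThueCert ⟨6, 0, 12, -9, 11⟩ :=
  ⟨⟨⟨-14, 8, -3, -1⟩, ⟨436, -176, 39, 16⟩, ⟨-3, 2, -2, 0⟩, ⟨-15, 2, 2, 0⟩, 23, 2, 1,
    [⟨2, ⟨13, 1, 11⟩, ⟨5, 2, 4⟩⟩, ⟨3, ⟨7, 5, 3⟩, ⟨7, 6, 6⟩⟩]⟩,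
    [⟨3, 0, 1, 2, 3, 6⟩, ⟨7, 0, 0, 2, 6, 24⟩], ⟨7, 0, 0, 2, 6, 24⟩, [(1, 0)]⟩

lemma cert0_4_ok : cert0_4.ok = true := by
  decide +kernel

/-- Certificate for the equation `thue π u v = 1` attached to `x = 2` in the case `d = 0`. -/
def cert0_2 : ThueCert ⟨6, 0, 6, -3, 2⟩ :=
  ⟨⟨⟨-1, 1, 1, 0⟩, ⟨13, -6, 1, 1⟩, ⟨-3, 2, 2, 0⟩, ⟨-3, 2, -2, 0⟩, 7, 0, 1,
    [⟨2, ⟨13, 11, 5⟩, ⟨5, 4, 1⟩⟩, ⟨3, ⟨79, 51, 78⟩, ⟨13, 11, 5⟩⟩]⟩,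
    [⟨2, 1, 2, 1, 8, 2⟩, ⟨3, 0, 1, 2, 12, 6⟩, ⟨3, 1, 1, 2, 12, 18⟩, ⟨2, 3, 2, 1, 32, 8⟩, ⟨193, 0,
        0, 1, 192, 96⟩], ⟨193, 0, 0, 1, 192, 96⟩, [(1, 0), (1, 1)]⟩

lemma cert0_2_ok : cert0_2.ok = true := by
  decide +kernel

/-- Certificate for the equation `thue π u v = 1` attached to `x = 9` in the case `d = 0`. -/
def cert0_9 : ThueCert ⟨6, 3, 26, -31, 73⟩ :=
  ⟨⟨⟨-832, 233, -44, -10⟩, ⟨-20, 7, -4, 0⟩, ⟨14, -5, 3, 0⟩, ⟨-181, 62, -18, -3⟩, 7, 4, 1,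
    [⟨2, ⟨17, 15, 3⟩, ⟨5, 3, 1⟩⟩, ⟨3, ⟨13, 1, 4⟩, ⟨19, 2, 16⟩⟩, ⟨5, ⟨31, 19, 8⟩, ⟨31, 7, 18⟩⟩]⟩,
    [⟨31, 0, 0, 1, 15, 15⟩, ⟨7, 0, 0, 4, 5, 100⟩], ⟨31, 0, 0, 1, 15, 15⟩, [(1, 0)]⟩

lemma cert0_9_ok : cert0_9.ok = true := by
  decide +kernel

/-- Certificate for the equation `thue π u v = 1` attached to `x = -2` in the case `d = 1`. -/
def cert1_Neg2 : ThueCert ⟨6, 0, -6, -1, 2⟩ :=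
  ⟨⟨⟨199971, 101788, 16360, 16520⟩, ⟨5173587723, -5339288060, 1523145464, -810356232⟩, ⟨-1731,
      -937, -352, -160⟩, ⟨-1796634243, 1854177077, -528943442, 281412790⟩, 13, 0, 1,
    [⟨2, ⟨101, 33, 30⟩, ⟨5, 2, 4⟩⟩, ⟨3, ⟨7, 3, 5⟩, ⟨19, 6, 6⟩⟩, ⟨5, ⟨71, 34, 27⟩, ⟨11, 7, 10⟩⟩]⟩,
    [⟨2, 2, 2, 1, 2, 8⟩, ⟨2, 3, 2, 1, 4, 16⟩, ⟨3, 0, 1, 2, 6, 6⟩, ⟨3, 1, 1, 2, 18, 18⟩, ⟨17, 0, 0,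
        2, 18, 144⟩], ⟨17, 0, 0, 2, 18, 144⟩, [(1, 0), (1, 1)]⟩

lemma cert1_Neg2_ok : cert1_Neg2.ok = true := by
  decide +kernel

/-- Certificate that `thue π (3 u) v ≠ 9` attached to `x = -2` in the case `d = 1`. -/
def squarecert1_Neg2 : SquareCert ⟨6, 0, -6, -1, 2⟩ :=
  ⟨cert1_Neg2.units, [⟨5, 2, 4⟩, ⟨7, 3, 5⟩, ⟨11, 7, 10⟩], 1, 0, [⟨3, 0, 1, 2, 6, 6⟩, ⟨3, 1, 1, 2,
      18, 18⟩, ⟨17, 0, 0, 2, 18, 144⟩, ⟨19, 0, 0, 2, 45, 72⟩]⟩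

lemma squarecert1_Neg2_ok : squarecert1_Neg2.ok = true := by
  decide +kernel

/-- Certificate for the equation `thue π u v = 1` attached to `x = -1` in the case `d = 1`. -/
def cert1_Neg1 : ThueCert ⟨6, 3, -4, -3, -2⟩ :=
  ⟨⟨⟨425, 84, -2, 24⟩, ⟨1, 0, 2, 0⟩, ⟨137, 170, 312, 4⟩, ⟨-5973643, 25105966, -15846480, 4538300⟩,
      13, -1, 1,
    [⟨2, ⟨5, 4, 3⟩, ⟨17, 12, 15⟩⟩]⟩,
    [⟨2, 1, 2, 1, 2, 2⟩, ⟨2, 2, 2, 1, 4, 4⟩, ⟨2, 3, 2, 1, 8, 8⟩, ⟨17, 0, 0, 1, 8, 16⟩], ⟨17, 0, 0,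
        1, 8, 16⟩, [(1, 0)]⟩

lemma cert1_Neg1_ok : cert1_Neg1.ok = true := by
  decide +kernel

/-- Certificate for the equation `thue π u v = 1` attached to `x = 0` in the case `d = 1`. -/
def cert1_0 : ThueCert ⟨6, 0, 0, -3, -1⟩ :=
  ⟨⟨⟨54, 0, -1, 3⟩, ⟨0, 0, 1, 0⟩, ⟨121228, 337588, -436023, 93860⟩, ⟨-326, -16, -9, -17⟩, 13, -1, 1,
    [⟨2, ⟨41, 20, 12⟩, ⟨5, 1, 1⟩⟩, ⟨3, ⟨31, 7, 3⟩, ⟨7, 3, 5⟩⟩, ⟨5, ⟨11, 6, 6⟩, ⟨31, 7, 3⟩⟩]⟩,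
    [⟨3, 0, 1, 2, 2, 3⟩, ⟨3, 1, 1, 2, 6, 9⟩, ⟨2, 0, 2, 1, 4, 4⟩, ⟨17, 0, 0, 2, 72, 18⟩], ⟨17, 0, 0,
        2, 72, 18⟩, [(1, 0), (-1, 3)]⟩

lemma cert1_0_ok : cert1_0.ok = true := by
  decide +kernel

/-- Certificate that `thue π (3 u) v ≠ 9` attached to `x = 0` in the case `d = 1`. -/
def squarecert1_0 : SquareCert ⟨6, 0, 0, -3, -1⟩ :=
  ⟨cert1_0.units, [⟨5, 1, 1⟩, ⟨7, 3, 5⟩, ⟨19, 11, 17⟩], 1, 1, [⟨3, 0, 1, 2, 2, 3⟩, ⟨41, 0, 0, 1,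
      20, 10⟩, ⟨3, 1, 1, 2, 6, 9⟩, ⟨19, 0, 0, 2, 180, 45⟩]⟩

lemma squarecert1_0_ok : squarecert1_0.ok = true := by
  decide +kernel

/-- Certificate for the equation `thue π u v = 1` attached to `x = 1` in the case `d = 1`. -/
def cert1_1 : ThueCert ⟨6, 3, 2, -3, 1⟩ :=
  ⟨⟨⟨437, -60, -2, 24⟩, ⟨1, 0, 2, 0⟩, ⟨-71, 10, 0, -4⟩, ⟨-11, 14, -24, 4⟩, 19, -1, 1,
    [⟨2, ⟨29, 28, 19⟩, ⟨5, 1, 3⟩⟩, ⟨3, ⟨37, 24, 3⟩, ⟨7, 3, 1⟩⟩, ⟨7, ⟨421, 216, 408⟩, ⟨29, 6, 20⟩⟩]⟩,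
    [⟨3, 0, 1, 2, 2, 3⟩, ⟨2, 2, 2, 1, 4, 4⟩, ⟨2, 3, 2, 1, 8, 8⟩, ⟨3, 1, 1, 2, 6, 9⟩, ⟨13, 0, 0, 2,
        84, 24⟩], ⟨13, 0, 0, 2, 84, 24⟩, [(1, 0)]⟩

lemma cert1_1_ok : cert1_1.ok = true := by
  decide +kernel

/-- Certificate for the equation `thue π u v = 1` attached to `x = 5` in the case `d = 1`. -/
def cert1_5 : ThueCert ⟨6, 3, 14, -13, 25⟩ :=
  ⟨⟨⟨-572747, 170802, -30438, -12623⟩, ⟨-4478, 2163, -1071, -208⟩, ⟨3025, -1252, -148, 56⟩,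
      ⟨-33103, 9876, -1772, -728⟩, 29, 2, 1,
    [⟨2, ⟨13, 1, 4⟩, ⟨5, 1, 3⟩⟩, ⟨3, ⟨73, 25, 55⟩, ⟨7, 4, 1⟩⟩]⟩,
    [⟨2, 1, 2, 1, 8, 1⟩, ⟨2, 3, 2, 1, 32, 4⟩, ⟨3, 0, 1, 2, 3, 6⟩, ⟨3, 1, 1, 2, 3, 18⟩, ⟨17, 0, 0,
        2, 36, 9⟩], ⟨17, 0, 0, 2, 36, 9⟩, [(1, 0)]⟩

lemma cert1_5_ok : cert1_5.ok = true := by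
  decide +kernel

/-- Certificate that `thue π (3 u) v ≠ 9` attached to `x = 5` in the case `d = 1`. -/
def squarecert1_5 : SquareCert ⟨6, 3, 14, -13, 25⟩ :=
  ⟨cert1_5.units, [⟨5, 1, 3⟩, ⟨7, 4, 1⟩, ⟨13, 1, 4⟩], 0, 1, [⟨3, 0, 1, 2, 3, 6⟩, ⟨3, 1, 1, 2, 3,
      18⟩, ⟨17, 0, 0, 2, 36, 9⟩]⟩

lemma squarecert1_5_ok : squarecert1_5.ok = true := by
  decide +kernel

/-- Certificate for the equation `thue π u v = 1` attached to `x = 6` in the case `d = 1`. -/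
def cert1_6 : ThueCert ⟨6, 0, 18, -17, 26⟩ :=
  ⟨⟨⟨867, -266, 46, 16⟩, ⟨3, -2, 2, 0⟩, ⟨-78629, 32722, -5880, -1904⟩, ⟨-18221, 12062, -15936,
      1184⟩, 19, 2, 1,
    [⟨2, ⟨53, 19, 16⟩, ⟨5, 4, 1⟩⟩, ⟨3, ⟨13, 0, 0⟩, ⟨13, 8, 2⟩⟩]⟩,
    [⟨3, 1, 1, 2, 6, 3⟩, ⟨3, 2, 1, 2, 18, 3⟩, ⟨2, 3, 2, 1, 8, 8⟩, ⟨2, 4, 2, 1, 16, 16⟩, ⟨17, 0, 0,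
        2, 72, 144⟩], ⟨17, 0, 0, 2, 72, 144⟩, [(1, 0)]⟩

lemma cert1_6_ok : cert1_6.ok = true := by
  decide +kernel

/-- Certificate for the equation `thue π u v = 1` attached to `x = 26` in the case `d = 1`. -/
def cert1_26 : ThueCert ⟨6, 0, 78, -153, 506⟩ :=
  ⟨⟨⟨-27, 6, -2, 0⟩, ⟨-75, 6, 2, 0⟩, ⟨-93673, 19186, -3120, -312⟩, ⟨-6878353753, 1234897454,
      -150148008, -18443832⟩, 13, 8, 1,
    [⟨2, ⟨5, 1, 1⟩, ⟨17, 5, 7⟩⟩]⟩,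
    [⟨2, 1, 2, 1, 2, 2⟩, ⟨2, 2, 2, 1, 4, 4⟩, ⟨2, 3, 2, 1, 8, 8⟩, ⟨17, 0, 0, 1, 8, 16⟩], ⟨17, 0, 0,
        1, 8, 16⟩, [(1, 0)]⟩

lemma cert1_26_ok : cert1_26.ok = true := by
  decide +kernel

/-- Certificate for the equation `thue π u v = 1` attached to `x = 28` in the case `d = 1`. -/
def cert1_28 : ThueCert ⟨6, 0, 84, -171, 587⟩ :=
  ⟨⟨⟨27, -6, 2, 0⟩, ⟨87, -6, -2, 0⟩, ⟨-19889, 3454, -408, -48⟩, ⟨-17, 2, 0, 0⟩, 19, 8, 1,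
    [⟨2, ⟨29, 6, 6⟩, ⟨5, 2, 4⟩⟩, ⟨3, ⟨37, 23, 8⟩, ⟨7, 3, 5⟩⟩, ⟨7, ⟨421, 354, 257⟩, ⟨29, 6, 6⟩⟩]⟩,
    [⟨3, 0, 1, 2, 2, 3⟩, ⟨3, 1, 1, 2, 6, 9⟩, ⟨2, 2, 2, 1, 4, 4⟩, ⟨13, 0, 0, 2, 84, 24⟩, ⟨2, 4, 2,
        1, 16, 16⟩], ⟨13, 0, 0, 2, 84, 24⟩, [(1, 0), (17, 2)]⟩

lemma cert1_28_ok : cert1_28.ok = true := by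
  decide +kernel

/-- Certificate for the equation `thue π u v = 1` attached to `x = 15` in the case `d = 1`. -/
def cert1_15 : ThueCert ⟨6, 3, 44, -67, 190⟩ :=
  ⟨⟨⟨-1421, 312, -46, -8⟩, ⟨-13, 4, -2, 0⟩, ⟨489275, -114786, 17520, 2948⟩, ⟨17999111, -3972006,
      593544, 102172⟩, 19, 5, 1,
    [⟨2, ⟨53, 35, 27⟩, ⟨5, 4, 3⟩⟩, ⟨3, ⟨13, 5, 8⟩, ⟨13, 4, 0⟩⟩]⟩,
    [⟨2, 2, 2, 1, 4, 4⟩, ⟨3, 1, 1, 2, 6, 3⟩, ⟨3, 2, 1, 2, 18, 3⟩, ⟨2, 4, 2, 1, 16, 16⟩, ⟨17, 0, 0,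
        2, 72, 144⟩], ⟨17, 0, 0, 2, 72, 144⟩, [(1, 0)]⟩

lemma cert1_15_ok : cert1_15.ok = true := by
  decide +kernel

/-- Certificate for the equation `thue π u v = 1` attached to `x = -2` in the case `d = 2`. -/
def cert2_Neg2 : ThueCert ⟨6, 0, -6, -3, 2⟩ :=
  ⟨⟨⟨195, -358, 142, -48⟩, ⟨3, 2, 2, 0⟩, ⟨-637620573, -180378826, -16715917, -29802701⟩, ⟨-2823,
      4187, 9271, -392⟩, 5, 0, 1,
    [⟨2, ⟨29, 8, 1⟩, ⟨13, 7, 6⟩⟩, ⟨3, ⟨19, 2, 7⟩, ⟨13, 7, 6⟩⟩]⟩,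
    [⟨2, 1, 2, 1, 2, 8⟩, ⟨2, 2, 2, 1, 4, 16⟩, ⟨3, 0, 1, 2, 6, 6⟩, ⟨3, 1, 1, 2, 18, 6⟩, ⟨17, 0, 0,
        2, 36, 144⟩], ⟨17, 0, 0, 2, 36, 144⟩, [(1, 0)]⟩

lemma cert2_Neg2_ok : cert2_Neg2.ok = true := by
  decide +kernel

/-- Certificate for the equation `thue π u v = 1` attached to `x = 2` in the case `d = 2`. -/
def cert2_2 : ThueCert ⟨6, 0, 6, -5, 2⟩ :=
  ⟨⟨⟨25311, -5517, 407, 924⟩, ⟨-27, 78, -209, -35⟩, ⟨-450651, 1184632, -2266816, 291768⟩,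
      ⟨-2635731, 574408, -42176, -96248⟩, 11, 0, 1,
    [⟨2, ⟨37, 25, 24⟩, ⟨5, 2, 4⟩⟩, ⟨3, ⟨67, 48, 49⟩, ⟨7, 5, 3⟩⟩]⟩,
    [⟨2, 0, 2, 1, 4, 1⟩, ⟨2, 1, 2, 1, 8, 1⟩, ⟨5, 0, 0, 2, 8, 12⟩, ⟨3, 0, 1, 2, 6, 6⟩], ⟨5, 0, 0, 2,
        8, 12⟩, [(1, 0)]⟩

lemma cert2_2_ok : cert2_2.ok = true := by
  decide +kernel

/-- Certificate for the equation `thue π u v = 1` attached to `x = 3` in the case `d = 2`. -/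
def cert2_3 : ThueCert ⟨6, 3, 8, -7, 10⟩ :=
  ⟨⟨⟨94, -53, 80, -8⟩, ⟨74, -67, 4, 6⟩, ⟨-1412098, 929544, -1550258, 169181⟩, ⟨-11144, 2804, -349,
      -336⟩, 5, 1, 1,
    [⟨2, ⟨41, 5, 31⟩, ⟨29, 11, 10⟩⟩, ⟨3, ⟨19, 16, 1⟩, ⟨31, 8, 5⟩⟩]⟩,
    [⟨2, 0, 2, 1, 2, 4⟩, ⟨3, 0, 1, 2, 6, 6⟩, ⟨3, 1, 1, 2, 18, 6⟩, ⟨2, 2, 2, 1, 8, 16⟩, ⟨97, 0, 0,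
        1, 48, 96⟩], ⟨97, 0, 0, 1, 48, 96⟩, [(1, 0)]⟩

lemma cert2_3_ok : cert2_3.ok = true := by
  decide +kernel

/-- Certificate that `thue π (3 u) v ≠ 9` attached to `x = 3` in the case `d = 2`. -/
def squarecert2_3 : SquareCert ⟨6, 3, 8, -7, 10⟩ :=
  ⟨cert2_3.units, [⟨19, 16, 1⟩, ⟨23, 0, 11⟩, ⟨31, 8, 5⟩], 1, 0, [⟨3, 0, 1, 2, 6, 6⟩, ⟨3, 1, 1, 2,
      18, 6⟩]⟩

lemma squarecert2_3_ok : squarecert2_3.ok = true := by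
  decide +kernel

/-- Certificate for the equation `thue π u v = 1` attached to `x = 103` in the case `d = 2`. -/
def cert2_103 : ThueCert ⟨6, 3, 308, -1207, 8110⟩ :=
  ⟨⟨⟨-109, 12, -2, 0⟩, ⟨-21581, 2048, -142, -8⟩, ⟨1485800523712, -138126388844, 9134814030,
      532408981⟩, ⟨1128748, -103174, 6483, 392⟩, 5, 17, 1,
    [⟨2, ⟨41, 6, 26⟩, ⟨13, 6, 12⟩⟩, ⟨3, ⟨13, 6, 12⟩, ⟨19, 6, 15⟩⟩, ⟨7, ⟨71, 1, 47⟩, ⟨29, 12, 9⟩⟩]⟩,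
    [⟨2, 0, 2, 1, 1, 4⟩, ⟨2, 1, 2, 1, 2, 8⟩, ⟨2, 2, 2, 1, 4, 16⟩, ⟨3, 0, 1, 2, 6, 3⟩, ⟨13, 0, 0, 2,
        12, 14⟩], ⟨13, 0, 0, 2, 12, 14⟩, [(1, 0)]⟩

lemma cert2_103_ok : cert2_103.ok = true := by
  decide +kernel

/-- Certificate for the equation `thue π u v = 1` attached to `x = -1` in the case `d = 3`. -/
def cert3_Neg1 : ThueCert ⟨6, 3, -4, -5, -2⟩ :=
  ⟨⟨⟨1193, 140, -2, 40⟩, ⟨1, 0, 2, 0⟩, ⟨-5532, -11792, -7574, 1887⟩, ⟨-850061260472, 3031696496538,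
      -1984707813845, 433904234644⟩, 7, -1, 1,
    [⟨2, ⟨29, 18, 10⟩, ⟨13, 1, 4⟩⟩, ⟨3, ⟨67, 4, 58⟩, ⟨13, 1, 4⟩⟩]⟩,
    [⟨2, 0, 2, 1, 1, 4⟩, ⟨5, 0, 0, 2, 3, 12⟩], ⟨5, 0, 0, 2, 3, 12⟩, [(1, 0)]⟩

lemma cert3_Neg1_ok : cert3_Neg1.ok = true := by
  decide +kernel

/-- Certificate for the equation `thue π u v = 1` attached to `x = 1` in the case `d = 3`. -/
def cert3_1 : ThueCert ⟨6, 3, 2, -5, 1⟩ :=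
  ⟨⟨⟨-1205, 100, 2, -40⟩, ⟨-1, 0, -2, 0⟩, ⟨1207288, 4031577, 1991433, -256082⟩,
      ⟨107273268871930231, -170331026329759416, 229975443318335568, -34391226591514351⟩, 7, -1, 1,
    [⟨2, ⟨17, 4, 5⟩, ⟨13, 3, 1⟩⟩, ⟨3, ⟨61, 12, 54⟩, ⟨13, 3, 1⟩⟩]⟩,
    [⟨2, 0, 2, 1, 1, 4⟩, ⟨5, 0, 0, 2, 3, 6⟩], ⟨5, 0, 0, 2, 3, 6⟩, [(1, 0)]⟩

lemma cert3_1_ok : cert3_1.ok = true := by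
  decide +kernel

/-- Certificate for the equation `thue π u v = 1` attached to `x = 74` in the case `d = 3`. -/
def cert3_74 : ThueCert ⟨6, 0, 222, -735, 4106⟩ :=
  ⟨⟨⟨75, -10, 2, 0⟩, ⟨219, -10, -2, 0⟩, ⟨-59558947, 6751382, -559469, -36793⟩, ⟨5197255111557007,
      -568015275131699, 43406242444675, 3026063350568⟩, 7, 14, 1,
    [⟨2, ⟨29, 20, 28⟩, ⟨13, 5, 2⟩⟩, ⟨3, ⟨67, 66, 56⟩, ⟨13, 5, 2⟩⟩]⟩,
    [⟨2, 0, 2, 1, 1, 4⟩, ⟨5, 0, 0, 2, 3, 12⟩], ⟨5, 0, 0, 2, 3, 12⟩, [(1, 0)]⟩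

lemma cert3_74_ok : cert3_74.ok = true := by
  decide +kernel

/-- Certificate for the equation `thue π u v = 1` attached to `x = 76` in the case `d = 3`. -/
def cert3_76 : ThueCert ⟨6, 0, 228, -765, 4331⟩ :=
  ⟨⟨⟨-75, 10, -2, 0⟩, ⟨-231, 10, 2, 0⟩, ⟨-915439258430399035426, 98786445963351677488,
      -7459297340938023237, -512618185617090587⟩, ⟨11515120052, -1282283608, 103732593, 6782744⟩,
      7, 14, 1,
    [⟨2, ⟨17, 3, 10⟩, ⟨13, 3, 8⟩⟩, ⟨3, ⟨61, 0, 0⟩, ⟨13, 3, 8⟩⟩]⟩,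
    [⟨2, 0, 2, 1, 1, 4⟩, ⟨5, 0, 0, 2, 3, 6⟩], ⟨5, 0, 0, 2, 3, 6⟩, [(1, 0)]⟩

lemma cert3_76_ok : cert3_76.ok = true := by
  decide +kernel

/-- Certificate for the equation `thue π u v = 1` attached to `x = 0` in the case `d = 3`. -/
def cert3_0 : ThueCert ⟨6, 0, 0, -5, -1⟩ :=
  ⟨⟨⟨-115235432438395920260, -561185229721654423828, 603643507912043457183,
      -108182586742995191668⟩, ⟨542260932992745070, 2406765329555744992, -9564185537472366063,
      -2160038861817869273⟩, ⟨153885533802288133023, -108182586742995191668, 115235432438395920260,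
      -14991932470325177472⟩, ⟨9564185537472366063, 49980966549179699588, 65343426787528823260,
      2406765329555744992⟩, 19, -1, 1,
    [⟨2, ⟨13, 12, 11⟩, ⟨29, 19, 7⟩⟩, ⟨3, ⟨67, 22, 36⟩, ⟨7, 5, 3⟩⟩]⟩,
    [⟨7, 0, 0, 2, 2, 24⟩], ⟨7, 0, 0, 2, 2, 24⟩, [(1, 0), (-1, 5)]⟩

lemma cert3_0_ok : cert3_0.ok = true := by
  decide +kernel

/-- The reduction data for the invariant `J = 1863`. -/
def reductionNeg3 : Reduction where
  J := 1863
  c := -8139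
  D := 162730
  table := [(.base 3 3, [(-1, 0, 0, -1), (-1, 0, 0, 1)]),
    (.ninth 3 3, [(0, -1, 1, -1), (0, 1, 1, 0)])]

lemma reductionNeg3_ok : reductionNeg3.ok = true := by
  decide +kernel

/-- The reduction data for the invariant `J = 1215`. -/
def reductionNeg2 : Reduction where
  J := 1215
  c := -7168
  D := 118141
  table := []

lemma reductionNeg2_ok : reductionNeg2.ok = true := by
  decide +kernel

/-- The reduction data for the invariant `J = 567`. -/
def reductionNeg1 : Reduction where
  J := 567
  c := -5788
  D := 64503
  table := [(.base 2 1, [(-1, 0, 0, -1), (-1, 0, 0, 1)]),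
    (.base 3 5, [(-1, 0, 0, -1), (-1, 0, 0, 1)]),
    (.base 7 21, [(4, 1, 1, 0), (4, -5, 1, -1)]),
    (.base 22 119, [(8, -7, 1, -1), (8, -1, 1, 0)]),
    (.ninth 2 1, [(0, -1, 1, -1), (0, 1, 1, 0)])]

lemma reductionNeg1_ok : reductionNeg1.ok = true := by
  decide +kernel

/-- The reduction data for the invariant `J = -81`. -/
def reduction0 : Reduction where
  J := -81
  c := 3787
  D := 7047
  table := [(.base (-1) 1, [(-1, 0, 0, -1), (-1, 0, 0, 1)]),
    (.base 0 1, [(-1, 0, 0, -1), (-1, 0, 0, 1)]),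
    (.base 1 1, [(-1, 0, 0, -1), (-1, 0, 0, 1)]),
    (.base 2 3, [(3, 1, 1, 0), (3, -1, 1, 0)]),
    (.base 4 9, [(4, 1, 1, 0), (4, 3, 1, 1)]),
    (.base 9 31, [(6, 5, 1, 1), (6, -5, 1, -1), (11, 6, 2, 1), (11, 5, 2, 1)])]

lemma reduction0_ok : reduction0.ok = true := by
  decide +kernel

/-- The reduction data for the invariant `J = -729`. -/
def reduction1 : Reduction where
  J := -729
  c := 6197
  D := 79246
  table := [(.base (-2) 1, [(-1, 0, 0, -1), (-1, 0, 0, 1)]),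
    (.base (-1) 3, [(-1, 0, 0, -1), (-1, 0, 0, 1)]),
    (.base 0 3, [(-1, 0, 0, -1), (-1, 0, 0, 1)]),
    (.base 1 3, [(-1, 0, 0, -1), (-1, 0, 0, 1)]),
    (.base 5 13, [(-1, 0, 0, -1), (-1, 0, 0, 1)]),
    (.base 6 17, [(-1, 0, 0, -1), (-1, 0, 0, 1), (5, 1, 1, 0), (5, 4, 1, 1)]),
    (.base 15 67, [(7, 1, 1, 0), (7, 6, 1, 1)]),
    (.base 26 153, [(9, 1, 1, 0), (9, -1, 1, 0)]),
    (.base 28 171, [(9, 1, 1, 0), (9, -1, 1, 0), (10, 9, 1, 1), (10, 1, 1, 0)]),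
    (.ninth (-2) 1, [(-1, 0, 0, -1), (-1, 0, 0, 1)]),
    (.ninth 0 3, [(-1, 0, 0, -1), (-1, 0, 0, 1)]),
    (.ninth 5 13, [(1, 1, 1, 0), (1, 0, 1, 1), (2, 1, 1, 1), (2, 1, 1, 0)])]

lemma reduction1_ok : reduction1.ok = true := by
  decide +kernel

/-- The reduction data for the invariant `J = -1377`. -/
def reduction2 : Reduction where
  J := -1377
  c := 7436
  D := 129927
  table := [(.base (-2) 3, [(-1, 0, 0, -1), (-1, 0, 0, 1)]),
    (.base 2 5, [(-1, 0, 0, -1), (-1, 0, 0, 1)]),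
    (.base 3 7, [(-1, 0, 0, -1), (-1, 0, 0, 1)]),
    (.base 103 1207, [(18, 17, 1, 1), (18, -17, 1, -1)]),
    (.ninth 3 7, [(1, 1, 1, 0), (1, 0, 1, 1)])]

lemma reduction2_ok : reduction2.ok = true := by
  decide +kernel

/-- The reduction data for the invariant `J = -2025`. -/
def reduction3 : Reduction where
  J := -2025
  c := 8346
  D := 173018
  table := [(.base (-1) 5, [(-1, 0, 0, -1), (-1, 0, 0, 1)]),
    (.base 0 5, [(-1, 0, 0, -1), (-1, 0, 0, 1)]),
    (.base 1 5, [(-1, 0, 0, -1), (-1, 0, 0, 1)]),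
    (.base 74 735, [(15, 1, 1, 0), (15, -1, 1, 0)]),
    (.base 76 765, [(15, 1, 1, 0), (15, -1, 1, 0)])]

lemma reduction3_ok : reduction3.ok = true := by
  decide +kernel

namespace QuarticForm

lemma hess_neg (f : QuarticForm) (u v : ℤ) : f.hess (-u) (-v) = f.hess u v := by
  simp only [hess]
  ring

lemma hess_mem_of_base_eval_eq_one {π : QuarticParams} {s : ThueCert π} (hs : s.ok = true)
    {x y : ℤ} (h2 : 2 * π.n + π.P * π.m = 18 * x) (h3 : -π.Q * π.m ^ 2 = 36 * y)
    (h4 : π.n ^ 2 + π.P * π.m * π.n - π.k * π.m ^ 2 = 36 - 27 * x ^ 2) {u v : ℤ}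
    (h : (base x y).eval u v = 1) :
    (base x y).hess u v ∈ s.sols.map fun w ↦ (base x y).hess w.1 w.2 := by
  have huv : thue π u v = 1 := by
    rw [← h]
    simp only [thue, base, eval, Int.cast_id]
    linear_combination v ^ 4 * h4 + u * v ^ 3 * h3 - u ^ 2 * v ^ 2 * h2
  rcases ThueCert.mem_sols hs huv with h' | h'
  · exact List.mem_map.2 ⟨_, h', rfl⟩
  · exact List.mem_map.2 ⟨_, h', hess_neg _ _ _⟩

lemma ninth_eval_ne_one {π : QuarticParams} {s : SquareCert π} (hs : s.ok = true)
    {x y : ℤ} (h2 : 2 * π.n + π.P * π.m = 18 * x) (h3 : -π.Q * π.m ^ 2 = 36 * y)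
    (h4 : π.n ^ 2 + π.P * π.m * π.n - π.k * π.m ^ 2 = 36 - 27 * x ^ 2) (u v : ℤ) :
    (ninth x y).eval u v ≠ 1 := by
  intro h
  refine SquareCert.thue_ne_nine hs (x := u) (y := v) ?_
  simp only [ninth, eval, Int.cast_id] at h
  simp only [thue]
  linear_combination 9 * h + v ^ 4 * h4 + 3 * u * v ^ 3 * h3 - 9 * u ^ 2 * v ^ 2 * h2

end QuarticForm

open QuarticForm

lemma eq_of_sq_eq {y : ℤ} (hy : 3 ≤ y) (c : ℤ) (hc : 0 ≤ c) (h : y ^ 2 = c ^ 2) : y = c :=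
  (pow_left_inj₀ (by omega) hc two_ne_zero).1 h

lemma solutions_neg_three {x y : ℤ} (hx : 2 ≤ x) (hy : 3 ≤ y)
    (h : 108 * x ^ 3 - 108 * x - 81 * y ^ 2 = 1863) :
    x = 3 ∧ y = 3 := by
  obtain ⟨g, hg, u, v, h1, h2⟩ := Reduction.exists_eval_eq_one reductionNeg3_ok h
  simp only [reductionNeg3, List.mem_cons, List.not_mem_nil, or_false] at hg
  have hX : x = 3 := by
    rcases hg with rfl | rfl
    · have := hess_mem_of_base_eval_eq_one certNeg3_3_ok
        (by norm_num) (by norm_num) (by norm_num) h1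
      rw [h2] at this
      simp [certNeg3_3, hess, base] at this
      omega
    · exact absurd h1 (ninth_eval_ne_one squarecertNeg3_3_ok
        (by norm_num) (by norm_num) (by norm_num) u v)
  subst hX
  exact ⟨rfl, eq_of_sq_eq hy 3 (by norm_num) (by linarith)⟩

lemma solutions_neg_two {x y : ℤ} 
    (h : 108 * x ^ 3 - 108 * x - 81 * y ^ 2 = 1215) :
    False := by
  obtain ⟨g, hg, u, v, h1, h2⟩ := Reduction.exists_eval_eq_one reductionNeg2_ok h
  simp [reductionNeg2] at hg

lemma solutions_neg_one {x y : ℤ} (hx : 2 ≤ x) (hy : 3 ≤ y)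
    (h : 108 * x ^ 3 - 108 * x - 81 * y ^ 2 = 567) :
    x = 3 ∧ y = 5 ∨ x = 7 ∧ y = 21 ∨ x = 22 ∧ y = 119 ∨ x = 425778 ∧ y = 320807265 := by
  obtain ⟨g, hg, u, v, h1, h2⟩ := Reduction.exists_eval_eq_one reductionNeg1_ok h
  simp only [reductionNeg1, List.mem_cons, List.not_mem_nil, or_false] at hg
  have hX : x = 3 ∨ x = 7 ∨ x = 22 ∨ x = 425778 := by
    rcases hg with rfl | rfl | rfl | rfl | rfl
    · have := hess_mem_of_base_eval_eq_one certNeg1_2_ok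
        (by norm_num) (by norm_num) (by norm_num) h1
      rw [h2] at this
      simp [certNeg1_2, hess, base] at this
      obtain rfl : x = 2 := by omega
      nlinarith
    · have := hess_mem_of_base_eval_eq_one certNeg1_3_ok
        (by norm_num) (by norm_num) (by norm_num) h1
      rw [h2] at this
      simp [certNeg1_3, hess, base] at this
      omega
    · have := hess_mem_of_base_eval_eq_one certNeg1_7_ok
        (by norm_num) (by norm_num) (by norm_num) h1
      rw [h2] at this
      simp [certNeg1_7, hess, base] at this
      omega
    · have := hess_mem_of_base_eval_eq_one certNeg1_22_ok
        (by norm_num) (by norm_num) (by norm_num) h1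
      rw [h2] at this
      simp [certNeg1_22, hess, base] at this
      omega
    · exact absurd h1 (ninth_eval_ne_one squarecertNeg1_2_ok
        (by norm_num) (by norm_num) (by norm_num) u v)
  rcases hX with rfl | rfl | rfl | rfl
  · have := eq_of_sq_eq hy 5 (by norm_num) (by linarith)
    omega
  · have := eq_of_sq_eq hy 21 (by norm_num) (by linarith)
    omega
  · have := eq_of_sq_eq hy 119 (by norm_num) (by linarith)
    omega
  · have := eq_of_sq_eq hy 320807265 (by norm_num) (by linarith)
    omega

lemma solutions_zero {x y : ℤ} (hx : 2 ≤ x) (hy : 3 ≤ y)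
    (h : 108 * x ^ 3 - 108 * x - 81 * y ^ 2 = -81) :
    x = 2 ∧ y = 3 ∨ x = 4 ∧ y = 9 ∨ x = 9 ∧ y = 31 ∨ x = 21 ∧ y = 111 ∨ x = 35 ∧ y = 239 := by
  obtain ⟨g, hg, u, v, h1, h2⟩ := Reduction.exists_eval_eq_one reduction0_ok h
  simp only [reduction0, List.mem_cons, List.not_mem_nil, or_false] at hg
  have hX : x = 2 ∨ x = 4 ∨ x = 9 ∨ x = 21 ∨ x = 35 := by
    rcases hg with rfl | rfl | rfl | rfl | rfl | rfl
    · have := hess_mem_of_base_eval_eq_one cert0_Neg1_ok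
        (by norm_num) (by norm_num) (by norm_num) h1
      rw [h2] at this
      simp [cert0_Neg1, hess, base] at this
      omega
    · have := hess_mem_of_base_eval_eq_one cert0_0_ok
        (by norm_num) (by norm_num) (by norm_num) h1
      rw [h2] at this
      simp [cert0_0, hess, base] at this
      omega
    · have := hess_mem_of_base_eval_eq_one cert0_1_ok
        (by norm_num) (by norm_num) (by norm_num) h1
      rw [h2] at this
      simp [cert0_1, hess, base] at this
      omega
    · have := hess_mem_of_base_eval_eq_one cert0_2_ok
        (by norm_num) (by norm_num) (by norm_num) h1
      rw [h2] at this
      simp [cert0_2, hess, base] at this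
      omega
    · have := hess_mem_of_base_eval_eq_one cert0_4_ok
        (by norm_num) (by norm_num) (by norm_num) h1
      rw [h2] at this
      simp [cert0_4, hess, base] at this
      omega
    · have := hess_mem_of_base_eval_eq_one cert0_9_ok
        (by norm_num) (by norm_num) (by norm_num) h1
      rw [h2] at this
      simp [cert0_9, hess, base] at this
      omega
  rcases hX with rfl | rfl | rfl | rfl | rfl
  · have := eq_of_sq_eq hy 3 (by norm_num) (by linarith)
    omega
  · have := eq_of_sq_eq hy 9 (by norm_num) (by linarith)
    omega
  · have := eq_of_sq_eq hy 31 (by norm_num) (by linarith)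
    omega
  · have := eq_of_sq_eq hy 111 (by norm_num) (by linarith)
    omega
  · have := eq_of_sq_eq hy 239 (by norm_num) (by linarith)
    omega

lemma solutions_one {x y : ℤ} (hx : 2 ≤ x) (hy : 3 ≤ y)
    (h : 108 * x ^ 3 - 108 * x - 81 * y ^ 2 = -729) :
    x = 5 ∧ y = 13 ∨ x = 6 ∧ y = 17 ∨ x = 15 ∧ y = 67 ∨ x = 26 ∧ y = 153 ∨ x = 28 ∧ y = 171 ∨
        x = 259 ∧ y = 4813 ∨ x = 664 ∧ y = 19757 ∨ x = 19629 ∧ y = 3175533 := by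
  obtain ⟨g, hg, u, v, h1, h2⟩ := Reduction.exists_eval_eq_one reduction1_ok h
  simp only [reduction1, List.mem_cons, List.not_mem_nil, or_false] at hg
  have hX : x = 5 ∨ x = 6 ∨ x = 15 ∨ x = 26 ∨ x = 28 ∨ x = 259 ∨ x = 664 ∨ x = 19629 := by
    rcases hg with rfl | rfl | rfl | rfl | rfl | rfl | rfl | rfl | rfl | rfl | rfl | rfl
    · have := hess_mem_of_base_eval_eq_one cert1_Neg2_ok
        (by norm_num) (by norm_num) (by norm_num) h1
      rw [h2] at this
      simp [cert1_Neg2, hess, base] at this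
      omega
    · have := hess_mem_of_base_eval_eq_one cert1_Neg1_ok
        (by norm_num) (by norm_num) (by norm_num) h1
      rw [h2] at this
      simp [cert1_Neg1, hess, base] at this
      omega
    · have := hess_mem_of_base_eval_eq_one cert1_0_ok
        (by norm_num) (by norm_num) (by norm_num) h1
      rw [h2] at this
      simp [cert1_0, hess, base] at this
      omega
    · have := hess_mem_of_base_eval_eq_one cert1_1_ok
        (by norm_num) (by norm_num) (by norm_num) h1
      rw [h2] at this
      simp [cert1_1, hess, base] at this
      omega
    · have := hess_mem_of_base_eval_eq_one cert1_5_ok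
        (by norm_num) (by norm_num) (by norm_num) h1
      rw [h2] at this
      simp [cert1_5, hess, base] at this
      omega
    · have := hess_mem_of_base_eval_eq_one cert1_6_ok
        (by norm_num) (by norm_num) (by norm_num) h1
      rw [h2] at this
      simp [cert1_6, hess, base] at this
      omega
    · have := hess_mem_of_base_eval_eq_one cert1_15_ok
        (by norm_num) (by norm_num) (by norm_num) h1
      rw [h2] at this
      simp [cert1_15, hess, base] at this
      omega
    · have := hess_mem_of_base_eval_eq_one cert1_26_ok
        (by norm_num) (by norm_num) (by norm_num) h1
      rw [h2] at this
      simp [cert1_26, hess, base] at this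
      omega
    · have := hess_mem_of_base_eval_eq_one cert1_28_ok
        (by norm_num) (by norm_num) (by norm_num) h1
      rw [h2] at this
      simp [cert1_28, hess, base] at this
      omega
    · exact absurd h1 (ninth_eval_ne_one squarecert1_Neg2_ok
        (by norm_num) (by norm_num) (by norm_num) u v)
    · exact absurd h1 (ninth_eval_ne_one squarecert1_0_ok
        (by norm_num) (by norm_num) (by norm_num) u v)
    · exact absurd h1 (ninth_eval_ne_one squarecert1_5_ok
        (by norm_num) (by norm_num) (by norm_num) u v)
  rcases hX with rfl | rfl | rfl | rfl | rfl | rfl | rfl | rfl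
  · have := eq_of_sq_eq hy 13 (by norm_num) (by linarith)
    omega
  · have := eq_of_sq_eq hy 17 (by norm_num) (by linarith)
    omega
  · have := eq_of_sq_eq hy 67 (by norm_num) (by linarith)
    omega
  · have := eq_of_sq_eq hy 153 (by norm_num) (by linarith)
    omega
  · have := eq_of_sq_eq hy 171 (by norm_num) (by linarith)
    omega
  · have := eq_of_sq_eq hy 4813 (by norm_num) (by linarith)
    omega
  · have := eq_of_sq_eq hy 19757 (by norm_num) (by linarith)
    omega
  · have := eq_of_sq_eq hy 3175533 (by norm_num) (by linarith)
    omega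

lemma solutions_two {x y : ℤ} (hx : 2 ≤ x) (hy : 3 ≤ y)
    (h : 108 * x ^ 3 - 108 * x - 81 * y ^ 2 = -1377) :
    x = 2 ∧ y = 5 ∨ x = 3 ∧ y = 7 ∨ x = 103 ∧ y = 1207 := by
  obtain ⟨g, hg, u, v, h1, h2⟩ := Reduction.exists_eval_eq_one reduction2_ok h
  simp only [reduction2, List.mem_cons, List.not_mem_nil, or_false] at hg
  have hX : x = 2 ∨ x = 3 ∨ x = 103 := by
    rcases hg with rfl | rfl | rfl | rfl | rfl
    · have := hess_mem_of_base_eval_eq_one cert2_Neg2_ok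
        (by norm_num) (by norm_num) (by norm_num) h1
      rw [h2] at this
      simp [cert2_Neg2, hess, base] at this
      omega
    · have := hess_mem_of_base_eval_eq_one cert2_2_ok
        (by norm_num) (by norm_num) (by norm_num) h1
      rw [h2] at this
      simp [cert2_2, hess, base] at this
      omega
    · have := hess_mem_of_base_eval_eq_one cert2_3_ok
        (by norm_num) (by norm_num) (by norm_num) h1
      rw [h2] at this
      simp [cert2_3, hess, base] at this
      omega
    · have := hess_mem_of_base_eval_eq_one cert2_103_ok
        (by norm_num) (by norm_num) (by norm_num) h1
      rw [h2] at this
      simp [cert2_103, hess, base] at this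
      omega
    · exact absurd h1 (ninth_eval_ne_one squarecert2_3_ok
        (by norm_num) (by norm_num) (by norm_num) u v)
  rcases hX with rfl | rfl | rfl
  · have := eq_of_sq_eq hy 5 (by norm_num) (by linarith)
    omega
  · have := eq_of_sq_eq hy 7 (by norm_num) (by linarith)
    omega
  · have := eq_of_sq_eq hy 1207 (by norm_num) (by linarith)
    omega

lemma solutions_three {x y : ℤ} (hx : 2 ≤ x) (hy : 3 ≤ y)
    (h : 108 * x ^ 3 - 108 * x - 81 * y ^ 2 = -2025) :
    x = 74 ∧ y = 735 ∨ x = 76 ∧ y = 765 ∨ x = 421725 ∧ y = 316237515 := by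
  obtain ⟨g, hg, u, v, h1, h2⟩ := Reduction.exists_eval_eq_one reduction3_ok h
  simp only [reduction3, List.mem_cons, List.not_mem_nil, or_false] at hg
  have hX : x = 74 ∨ x = 76 ∨ x = 421725 := by
    rcases hg with rfl | rfl | rfl | rfl | rfl
    · have := hess_mem_of_base_eval_eq_one cert3_Neg1_ok
        (by norm_num) (by norm_num) (by norm_num) h1
      rw [h2] at this
      simp [cert3_Neg1, hess, base] at this
      omega
    · have := hess_mem_of_base_eval_eq_one cert3_0_ok
        (by norm_num) (by norm_num) (by norm_num) h1
      rw [h2] at this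
      simp [cert3_0, hess, base] at this
      omega
    · have := hess_mem_of_base_eval_eq_one cert3_1_ok
        (by norm_num) (by norm_num) (by norm_num) h1
      rw [h2] at this
      simp [cert3_1, hess, base] at this
      omega
    · have := hess_mem_of_base_eval_eq_one cert3_74_ok
        (by norm_num) (by norm_num) (by norm_num) h1
      rw [h2] at this
      simp [cert3_74, hess, base] at this
      omega
    · have := hess_mem_of_base_eval_eq_one cert3_76_ok
        (by norm_num) (by norm_num) (by norm_num) h1
      rw [h2] at this
      simp [cert3_76, hess, base] at this
      omega
  rcases hX with rfl | rfl | rfl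
  · have := eq_of_sq_eq hy 735 (by norm_num) (by linarith)
    omega
  · have := eq_of_sq_eq hy 765 (by norm_num) (by linarith)
    omega
  · have := eq_of_sq_eq hy 316237515 (by norm_num) (by linarith)
    omega

lemma choose_two_eq_choose_three_add_iff {n m : ℕ} (hn : 2 ≤ n) (hm : 3 ≤ m) (d : ℤ) :
    (n.choose 2 : ℤ) = (m.choose 3 : ℤ) + d ↔
      108 * (m - 1 : ℤ) ^ 3 - 108 * (m - 1) - 81 * (2 * n - 1) ^ 2 = -81 * (8 * d + 1) := by
  obtain ⟨n, rfl⟩ := Nat.exists_eq_add_of_le' hn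
  obtain ⟨m, rfl⟩ := Nat.exists_eq_add_of_le' hm
  have h1 := Nat.descFactorial_eq_factorial_mul_choose (n + 2) 2
  have h2 := Nat.descFactorial_eq_factorial_mul_choose (m + 3) 3
  simp [Nat.descFactorial, Nat.factorial] at h1 h2
  zify at h1 h2
  push_cast
  constructor
  · intro h
    linear_combination -324 * h1 + 108 * h2 - 648 * h
  · intro h
    refine mul_left_cancel₀ (a := (648 : ℤ)) (by norm_num) ?_
    linear_combination -324 * h1 + 108 * h2 - h

theorem binomial_eq_2_3 (d : ℤ) (hd1 : -3 ≤ d) (hd2 : d ≤ 3)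
    (n m : ℕ) (hn : 2 ≤ n) (hm : 3 ≤ m) :
    (n.choose 2 : ℤ) = (m.choose 3 : ℤ) + d ↔
      (d = 3 ∧ n = 368 ∧ m = 75) ∨
      (d = 3 ∧ n = 383 ∧ m = 77) ∨
      (d = 3 ∧ n = 158118758 ∧ m = 421726) ∨
      (d = 2 ∧ n = 3 ∧ m = 3) ∨
      (d = 2 ∧ n = 4 ∧ m = 4) ∨
      (d = 2 ∧ n = 604 ∧ m = 104) ∨
      (d = 1 ∧ n = 7 ∧ m = 6) ∨
      (d = 1 ∧ n = 9 ∧ m = 7) ∨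
      (d = 1 ∧ n = 34 ∧ m = 16) ∨
      (d = 1 ∧ n = 77 ∧ m = 27) ∨
      (d = 1 ∧ n = 86 ∧ m = 29) ∨
      (d = 1 ∧ n = 2407 ∧ m = 260) ∨
      (d = 1 ∧ n = 9879 ∧ m = 665) ∨
      (d = 1 ∧ n = 1587767 ∧ m = 19630) ∨
      (d = 0 ∧ n = 2 ∧ m = 3) ∨
      (d = 0 ∧ n = 5 ∧ m = 5) ∨
      (d = 0 ∧ n = 16 ∧ m = 10) ∨
      (d = 0 ∧ n = 56 ∧ m = 22) ∨
      (d = 0 ∧ n = 120 ∧ m = 36) ∨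
      (d = -1 ∧ n = 3 ∧ m = 4) ∨
      (d = -1 ∧ n = 11 ∧ m = 8) ∨
      (d = -1 ∧ n = 60 ∧ m = 23) ∨
      (d = -1 ∧ n = 160403633 ∧ m = 425779) ∨
      (d = -3 ∧ n = 2 ∧ m = 4) := by
  rw [choose_two_eq_choose_three_add_iff hn hm]
  constructor
  · intro h
    have hx : (2 : ℤ) ≤ m - 1 := by omega
    have hy : (3 : ℤ) ≤ 2 * n - 1 := by omega
    interval_cases d
    · have := solutions_neg_three hx hy h
      clear h
      obtain ⟨rfl, rfl⟩ : n = 2 ∧ m = 4 := by omega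
      simp
    · exact (solutions_neg_two h).elim
    · have := solutions_neg_one hx hy h
      clear h
      rcases this with this | this | this | this
      · obtain ⟨rfl, rfl⟩ : n = 3 ∧ m = 4 := by omega
        simp
      · obtain ⟨rfl, rfl⟩ : n = 11 ∧ m = 8 := by omega
        simp
      · obtain ⟨rfl, rfl⟩ : n = 60 ∧ m = 23 := by omega
        simp
      · obtain ⟨rfl, rfl⟩ : n = 160403633 ∧ m = 425779 := by omega
        simp
    · have := solutions_zero hx hy h
      clear h
      rcases this with this | this | this | this | this
      · obtain ⟨rfl, rfl⟩ : n = 2 ∧ m = 3 := by omega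
        simp
      · obtain ⟨rfl, rfl⟩ : n = 5 ∧ m = 5 := by omega
        simp
      · obtain ⟨rfl, rfl⟩ : n = 16 ∧ m = 10 := by omega
        simp
      · obtain ⟨rfl, rfl⟩ : n = 56 ∧ m = 22 := by omega
        simp
      · obtain ⟨rfl, rfl⟩ : n = 120 ∧ m = 36 := by omega
        simp
    · have := solutions_one hx hy h
      clear h
      rcases this with this | this | this | this | this | this | this | this
      · obtain ⟨rfl, rfl⟩ : n = 7 ∧ m = 6 := by omega
        simp
      · obtain ⟨rfl, rfl⟩ : n = 9 ∧ m = 7 := by omega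
        simp
      · obtain ⟨rfl, rfl⟩ : n = 34 ∧ m = 16 := by omega
        simp
      · obtain ⟨rfl, rfl⟩ : n = 77 ∧ m = 27 := by omega
        simp
      · obtain ⟨rfl, rfl⟩ : n = 86 ∧ m = 29 := by omega
        simp
      · obtain ⟨rfl, rfl⟩ : n = 2407 ∧ m = 260 := by omega
        simp
      · obtain ⟨rfl, rfl⟩ : n = 9879 ∧ m = 665 := by omega
        simp
      · obtain ⟨rfl, rfl⟩ : n = 1587767 ∧ m = 19630 := by omega
        simp
    · have := solutions_two hx hy h
      clear h
      rcases this with this | this | this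
      · obtain ⟨rfl, rfl⟩ : n = 3 ∧ m = 3 := by omega
        simp
      · obtain ⟨rfl, rfl⟩ : n = 4 ∧ m = 4 := by omega
        simp
      · obtain ⟨rfl, rfl⟩ : n = 604 ∧ m = 104 := by omega
        simp
    · have := solutions_three hx hy h
      clear h
      rcases this with this | this | this
      · obtain ⟨rfl, rfl⟩ : n = 368 ∧ m = 75 := by omega
        simp
      · obtain ⟨rfl, rfl⟩ : n = 383 ∧ m = 77 := by omega
        simp
      · obtain ⟨rfl, rfl⟩ : n = 158118758 ∧ m = 421726 := by omega
        simp
  · rintro (⟨rfl, rfl, rfl⟩ | ⟨rfl, rfl, rfl⟩ | ⟨rfl, rfl, rfl⟩ | ⟨rfl, rfl, rfl⟩ | ⟨rfl, rfl,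
      rfl⟩ | ⟨rfl, rfl, rfl⟩ | ⟨rfl, rfl, rfl⟩ | ⟨rfl, rfl, rfl⟩ | ⟨rfl, rfl, rfl⟩ | ⟨rfl, rfl,
      rfl⟩ | ⟨rfl, rfl, rfl⟩ | ⟨rfl, rfl, rfl⟩ | ⟨rfl, rfl, rfl⟩ | ⟨rfl, rfl, rfl⟩ | ⟨rfl, rfl,
      rfl⟩ | ⟨rfl, rfl, rfl⟩ | ⟨rfl, rfl, rfl⟩ | ⟨rfl, rfl, rfl⟩ | ⟨rfl, rfl, rfl⟩ | ⟨rfl, rfl,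
      rfl⟩ | ⟨rfl, rfl, rfl⟩ | ⟨rfl, rfl, rfl⟩ | ⟨rfl, rfl, rfl⟩ | ⟨rfl, rfl, rfl⟩) <;> norm_num
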